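/- arXiv:1507.02883 — 4 statements merged into one kernel-verified Lean document; each statement's English description precedes it below -/
import Mathlib

section
/- Sundman-type asymptotics at a collision: let y be an isolated collision solution at the origin, I(t) = |y(t)|², and μ = (α+2)·√(m₁/(2α)). Then, as t → 0⁺: I(t)/(μt)^{4/(2+α)} → 1, İ(t)·(2+α)/(4μ·(μt)^{(2−α)/(2+α)}) → 1, and Ï(t)·(2+α)²/(4(2−α)μ²·(μt)^{−2α/(2+α)}) → 1. Moreover, as t → 0 (from either side): (½|ẏ(t)|²)·(2+α)²·(μ|t|)^{2α/(2+α)}/(2μ²) → 1 and V(y(t))·(2+α)²·(μ|t|)^{2α/(2+α)}/(2μ²) → 1. -/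
open Filter Topology

/-- The plane angular momentum and the radial momentum determine the kinetic energy. -/
lemma inner_sq_add_inner_I_mul_sq (z w : ℂ) :
    inner ℝ z w ^ 2 + inner ℝ (Complex.I * z) w ^ 2 = ‖z‖ ^ 2 * ‖w‖ ^ 2 := by
  simp only [Complex.inner, ← Complex.normSq_eq_norm_sq, Complex.normSq_apply]
  simp
  ring

lemma mul_sqrt_eq {α M μ : ℝ} (hμ : μ = (α + 2) * √(M / (2 * α))) :
    (2 + α) / 2 * √(2 * M / α) = μ := by
  rw [hμ, show 2 * M / α = 2 ^ 2 * (M / (2 * α)) by field_simp,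
    Real.sqrt_mul (by norm_num), Real.sqrt_sq (by norm_num)]
  ring

lemma div_mul_div_eq_one {α M μ : ℝ} (hα : 0 < α) (hM : 0 < M)
    (hμ : μ = (α + 2) * √(M / (2 * α))) : (2 + α) ^ 2 / (2 * μ ^ 2) * (M / α) = 1 := by
  rw [hμ, mul_pow, Real.sq_sqrt (by positivity)]
  field_simp
  ring

/-- A motion `y` with velocity `v` on `(0, δ)` that collides with the origin at time `0` under the
homogeneous attraction of a mass `M` at the origin and a bounded perturbing force `g`; the
function `e` is the kinetic energy minus the potential of the mass `M`. -/
structure IsPerturbedCollision (α M δ C : ℝ) (y v g : ℝ → ℂ) (e : ℝ → ℝ) : Prop where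
  exponent_pos : 0 < α
  exponent_lt : α < 2
  mass_pos : 0 < M
  time_pos : 0 < δ
  hasDerivAt_position : ∀ t ∈ Set.Ioo 0 δ, HasDerivAt y (v t) t
  hasDerivAt_velocity : ∀ t ∈ Set.Ioo 0 δ, HasDerivAt v (-(M / ‖y t‖ ^ (α + 2)) • y t + g t) t
  ne_zero : ∀ t ∈ Set.Ioo 0 δ, y t ≠ 0
  tendsto_zero : Tendsto y (𝓝[>] 0) (𝓝 0)
  force_le : ∀ t ∈ Set.Ioo 0 δ, ‖g t‖ ≤ C
  energy_eq : ∀ t ∈ Set.Ioo 0 δ, 1 / 2 * ‖v t‖ ^ 2 = M / (α * ‖y t‖ ^ α) + e t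
  energy_le : ∀ t ∈ Set.Ioo 0 δ, |e t| ≤ C

namespace IsPerturbedCollision

variable {α M δ C : ℝ} {y v g : ℝ → ℂ} {e : ℝ → ℝ}

lemma tendsto_norm (hc : IsPerturbedCollision α M δ C y v g e) :
    Tendsto (fun t => ‖y t‖) (𝓝[>] 0) (𝓝 0) := by
  simpa using hc.tendsto_zero.norm

lemma eventually_mem (hc : IsPerturbedCollision α M δ C y v g e) :
    ∀ᶠ t in 𝓝[>] (0 : ℝ), t ∈ Set.Ioo 0 δ :=
  Ioo_mem_nhdsGT hc.time_pos

lemma tendsto_norm_rpow (hc : IsPerturbedCollision α M δ C y v g e) {p : ℝ} (hp : 0 < p) :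
    Tendsto (fun t => ‖y t‖ ^ p) (𝓝[>] 0) (𝓝 0) := by
  simpa [Real.zero_rpow hp.ne'] using hc.tendsto_norm.rpow_const (Or.inr hp.le)

/-- Restriction to a shorter time interval. -/
lemma mono (hc : IsPerturbedCollision α M δ C y v g e) {δ' : ℝ} (h0 : 0 < δ') (h : δ' ≤ δ) :
    IsPerturbedCollision α M δ' C y v g e := by
  have hs : Set.Ioo 0 δ' ⊆ Set.Ioo 0 δ := Set.Ioo_subset_Ioo_right h
  exact ⟨hc.exponent_pos, hc.exponent_lt, hc.mass_pos, h0,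
    fun t ht => hc.hasDerivAt_position t (hs ht), fun t ht => hc.hasDerivAt_velocity t (hs ht),
    fun t ht => hc.ne_zero t (hs ht), hc.tendsto_zero, fun t ht => hc.force_le t (hs ht),
    fun t ht => hc.energy_eq t (hs ht), fun t ht => hc.energy_le t (hs ht)⟩

/-- The Lagrange–Jacobi identity, for half of the derivative of `‖y‖ ^ 2`. -/
lemma hasDerivAt_inner (hc : IsPerturbedCollision α M δ C y v g e) {t : ℝ}
    (ht : t ∈ Set.Ioo 0 δ) :
    HasDerivAt (fun s => inner ℝ (y s) (v s))
      ((2 - α) * (M / (α * ‖y t‖ ^ α)) + (2 * e t + inner ℝ (y t) (g t))) t := by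
  refine ((hc.hasDerivAt_position t ht).inner ℝ (hc.hasDerivAt_velocity t ht)).congr_deriv ?_
  have hr : 0 < ‖y t‖ := norm_pos_iff.2 (hc.ne_zero t ht)
  have hα := hc.exponent_pos
  have hra : 0 < ‖y t‖ ^ α := Real.rpow_pos_of_pos hr α
  have hv := hc.energy_eq t ht
  rw [real_inner_self_eq_norm_sq, inner_add_right, real_inner_smul_right,
    real_inner_self_eq_norm_sq, Real.rpow_add hr, Real.rpow_two]
  have : ‖v t‖ ^ 2 = 2 * (M / (α * ‖y t‖ ^ α) + e t) := by linarith
  rw [this]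
  field_simp
  ring

lemma hasDerivAt_inner_I_mul (hc : IsPerturbedCollision α M δ C y v g e) {t : ℝ}
    (ht : t ∈ Set.Ioo 0 δ) :
    HasDerivAt (fun s => inner ℝ (Complex.I * y s) (v s)) (inner ℝ (Complex.I * y t) (g t)) t := by
  refine (((hc.hasDerivAt_position t ht).const_mul Complex.I).inner ℝ
    (hc.hasDerivAt_velocity t ht)).congr_deriv ?_
  simp only [Complex.inner]
  simp
  ring

lemma abs_inner_add_le (hc : IsPerturbedCollision α M δ C y v g e) {t : ℝ}
    (ht : t ∈ Set.Ioo 0 δ) : |2 * e t + inner ℝ (y t) (g t)| ≤ 2 * C + ‖y t‖ * C := by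
  have h1 := hc.energy_le t ht
  have h2 := (abs_real_inner_le_norm (y t) (g t)).trans
    (mul_le_mul_of_nonneg_left (hc.force_le t ht) (norm_nonneg _))
  calc _ ≤ |2 * e t| + |inner ℝ (y t) (g t)| := abs_add_le _ _
    _ ≤ _ := by rw [abs_mul, abs_two]; linarith

/-- Near the collision the distance to the origin increases. -/
lemma exists_inner_pos (hc : IsPerturbedCollision α M δ C y v g e) :
    ∃ δ' ∈ Set.Ioc 0 δ, ∀ t ∈ Set.Ioo 0 δ', 0 < inner ℝ (y t) (v t) := by
  have hα := hc.exponent_pos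
  have hα2 := hc.exponent_lt
  have hM := hc.mass_pos
  have hlim : Tendsto (fun t => (2 * C + ‖y t‖ * C) * ‖y t‖ ^ α) (𝓝[>] 0) (𝓝 0) := by
    simpa using ((hc.tendsto_norm.mul_const C).const_add (2 * C)).mul (hc.tendsto_norm_rpow hα)
  have hpos : 0 < (2 - α) * (M / α) := mul_pos (by linarith) (by positivity)
  obtain ⟨δ', hδ', hsub⟩ := (mem_nhdsGT_iff_exists_Ioo_subset' hc.time_pos).1
    (hlim.eventually_lt_const hpos)
  set η := min δ' δ
  have hη0 : 0 < η := lt_min hδ' hc.time_pos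
  refine ⟨η, ⟨hη0, min_le_right _ _⟩, ?_⟩
  replace hc := hc.mono hη0 (min_le_right _ _)
  have hder : ∀ t ∈ Set.Ioo 0 η,
      0 < (2 - α) * (M / (α * ‖y t‖ ^ α)) + (2 * e t + inner ℝ (y t) (g t)) := by
    intro t ht
    have hra : 0 < ‖y t‖ ^ α := Real.rpow_pos_of_pos (norm_pos_iff.2 (hc.ne_zero t ht)) α
    have h1 : (2 * C + ‖y t‖ * C) * ‖y t‖ ^ α < (2 - α) * (M / α) :=
      hsub ⟨ht.1, ht.2.trans_le (min_le_left _ _)⟩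
    rw [← lt_div_iff₀ hra] at h1
    have h2 := (abs_le.1 (hc.abs_inner_add_le ht)).1
    have h3 : (2 - α) * (M / (α * ‖y t‖ ^ α)) = (2 - α) * (M / α) / ‖y t‖ ^ α := by
      field_simp
    linarith
  have hmono : StrictMonoOn (fun t => inner ℝ (y t) (v t)) (Set.Ioo 0 η) := by
    refine strictMonoOn_of_hasDerivWithinAt_pos (convex_Ioo 0 η)
      (fun t ht => (hc.hasDerivAt_inner ht).continuousAt.continuousWithinAt)
      (fun t ht => (hc.hasDerivAt_inner (interior_subset ht)).hasDerivWithinAt)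
      (fun t ht => hder t (interior_subset ht))
  intro t ht
  by_contra! hneg
  have hsub' : Set.Ioc 0 t ⊆ Set.Ioo 0 η := fun s hs => ⟨hs.1, hs.2.trans_lt ht.2⟩
  have hanti : StrictAntiOn (fun s => ‖y s‖ ^ 2) (Set.Ioc 0 t) := by
    refine strictAntiOn_of_hasDerivWithinAt_neg (convex_Ioc 0 t)
      (fun s hs => (hc.hasDerivAt_position s (hsub' hs)).norm_sq.continuousAt.continuousWithinAt)
      (fun s hs => (hc.hasDerivAt_position s
        (hsub' (interior_subset hs))).norm_sq.hasDerivWithinAt) (fun s hs => ?_)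
    rw [interior_Ioc] at hs
    have : inner ℝ (y s) (v s) < inner ℝ (y t) (v t) :=
      hmono (hsub' ⟨hs.1, hs.2.le⟩) ht hs.2
    linarith
  have hle : ‖y t‖ ^ 2 ≤ 0 := by
    have h0 : Tendsto (fun s => ‖y s‖ ^ 2) (𝓝[>] 0) (𝓝 0) := by
      simpa using hc.tendsto_norm.pow 2
    refine ge_of_tendsto h0 ?_
    filter_upwards [Ioo_mem_nhdsGT ht.1] with s hs
    exact (hanti ⟨hs.1, hs.2.le⟩ ⟨ht.1, le_rfl⟩ hs.2).le
  have : 0 < ‖y t‖ := norm_pos_iff.2 (hc.ne_zero t ht)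
  nlinarith

lemma norm_mul_norm_velocity_sq (hc : IsPerturbedCollision α M δ C y v g e) {t : ℝ}
    (ht : t ∈ Set.Ioo 0 δ) :
    ‖y t‖ ^ α * ‖v t‖ ^ 2 = 2 * M / α + 2 * (e t * ‖y t‖ ^ α) := by
  have hra : 0 < ‖y t‖ ^ α := Real.rpow_pos_of_pos (norm_pos_iff.2 (hc.ne_zero t ht)) α
  have hα := hc.exponent_pos
  have : ‖v t‖ ^ 2 = 2 * (M / (α * ‖y t‖ ^ α) + e t) := by linarith [hc.energy_eq t ht]
  rw [this]
  field_simp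

lemma tendsto_energy_mul (hc : IsPerturbedCollision α M δ C y v g e) {f : ℝ → ℝ}
    (hf : Tendsto f (𝓝[>] 0) (𝓝 0)) : Tendsto (fun t => e t * f t) (𝓝[>] 0) (𝓝 0) :=
  bdd_le_mul_tendsto_zero' C (hc.eventually_mem.mono hc.energy_le) hf

/-- The angular momentum vanishes at the collision. -/
lemma tendsto_inner_I_mul (hc : IsPerturbedCollision α M δ C y v g e) :
    Tendsto (fun t => inner ℝ (Complex.I * y t) (v t)) (𝓝[>] 0) (𝓝 0) := by
  have hα := hc.exponent_pos
  have hα2 := hc.exponent_lt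
  have h1 : Tendsto (fun t => ‖y t‖ ^ (2 - α) * (2 * M / α + 2 * (e t * ‖y t‖ ^ α)))
      (𝓝[>] 0) (𝓝 0) := by
    simpa using (hc.tendsto_norm_rpow (sub_pos.2 hα2)).mul
      (((hc.tendsto_energy_mul (hc.tendsto_norm_rpow hα)).const_mul 2).const_add (2 * M / α))
  have h2 : Tendsto (fun t => inner ℝ (Complex.I * y t) (v t) ^ 2) (𝓝[>] 0) (𝓝 0) := by
    refine squeeze_zero' (Eventually.of_forall fun t => sq_nonneg _) ?_ h1
    filter_upwards [hc.eventually_mem] with t ht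
    have hr : 0 < ‖y t‖ := norm_pos_iff.2 (hc.ne_zero t ht)
    rw [← hc.norm_mul_norm_velocity_sq ht, ← mul_assoc, ← Real.rpow_add hr, sub_add_cancel,
      Real.rpow_two]
    nlinarith [inner_sq_add_inner_I_mul_sq (y t) (v t), sq_nonneg (inner ℝ (y t) (v t))]
  rw [tendsto_zero_iff_abs_tendsto_zero]
  simpa [Function.comp_def, Real.sqrt_sq_eq_abs] using h2.sqrt

lemma abs_inner_I_mul_le (hc : IsPerturbedCollision α M δ C y v g e)
    (hpos : ∀ t ∈ Set.Ioo 0 δ, 0 < inner ℝ (y t) (v t)) {t : ℝ} (ht : t ∈ Set.Ioo 0 δ) :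
    |inner ℝ (Complex.I * y t) (v t)| ≤ ‖y t‖ * C * t := by
  have hC : 0 ≤ C := (norm_nonneg _).trans (hc.force_le t ht)
  have hmono : StrictMonoOn (fun s => ‖y s‖ ^ 2) (Set.Ioo 0 δ) :=
    strictMonoOn_of_hasDerivWithinAt_pos (convex_Ioo 0 δ)
      (fun s hs => (hc.hasDerivAt_position s hs).norm_sq.continuousAt.continuousWithinAt)
      (fun s hs => (hc.hasDerivAt_position s (interior_subset hs)).norm_sq.hasDerivWithinAt)
      (fun s hs => mul_pos two_pos (hpos s (interior_subset hs)))
  have hsub : Set.Ioc 0 t ⊆ Set.Ioo 0 δ := fun s hs => ⟨hs.1, hs.2.trans_lt ht.2⟩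
  have hlim := (hc.tendsto_inner_I_mul.const_sub (inner ℝ (Complex.I * y t) (v t))).abs
  rw [sub_zero] at hlim
  refine le_of_tendsto hlim ?_
  filter_upwards [Ioo_mem_nhdsGT ht.1] with s hs
  have hb : ∀ u ∈ Set.Ioc 0 t, ‖inner ℝ (Complex.I * y u) (g u)‖ ≤ ‖y t‖ * C := by
    intro u hu
    have hle : ‖y u‖ ≤ ‖y t‖ := by
      have := hmono.monotoneOn (hsub hu) ht hu.2
      exact (sq_le_sq₀ (norm_nonneg _) (norm_nonneg _)).1 this
    refine (abs_real_inner_le_norm _ _).trans ?_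
    rw [norm_mul, Complex.norm_I, one_mul]
    exact mul_le_mul hle (hc.force_le u (hsub hu)) (norm_nonneg _) (norm_nonneg _)
  have := Convex.norm_image_sub_le_of_norm_hasDerivWithin_le
    (fun u hu => (hc.hasDerivAt_inner_I_mul (hsub hu)).hasDerivWithinAt) hb (convex_Ioc 0 t)
    ⟨hs.1, hs.2.le⟩ ⟨ht.1, le_rfl⟩
  rw [Real.norm_eq_abs, Real.norm_eq_abs, abs_of_pos (sub_pos.2 hs.2)] at this
  refine this.trans (mul_le_mul_of_nonneg_left (by linarith [hs.1]) (by positivity))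

/-- Asymptotics of the radial momentum. -/
lemma tendsto_rpow_mul_inner (hc : IsPerturbedCollision α M δ C y v g e) :
    Tendsto (fun t => ‖y t‖ ^ ((α - 2) / 2) * inner ℝ (y t) (v t)) (𝓝[>] 0)
      (𝓝 √(2 * M / α)) := by
  obtain ⟨δ', hδ', hpos⟩ := hc.exists_inner_pos
  replace hc := hc.mono hδ'.1 hδ'.2
  have hα := hc.exponent_pos
  have ht0 : Tendsto (fun t : ℝ => t) (𝓝[>] 0) (𝓝 0) := nhdsWithin_le_nhds
  have hJ : Tendsto (fun t => ‖y t‖ ^ (α - 2) * inner ℝ (Complex.I * y t) (v t) ^ 2)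
      (𝓝[>] 0) (𝓝 0) := by
    have h1 : Tendsto (fun t => ‖y t‖ ^ α * (C * t) ^ 2) (𝓝[>] 0) (𝓝 0) := by
      simpa using (hc.tendsto_norm_rpow hα).mul ((ht0.const_mul C).pow 2)
    refine squeeze_zero' (Eventually.of_forall fun t => by positivity) ?_ h1
    filter_upwards [hc.eventually_mem] with t ht
    have hr : 0 < ‖y t‖ := norm_pos_iff.2 (hc.ne_zero t ht)
    have h2 := sq_le_sq' (abs_le.1 (hc.abs_inner_I_mul_le hpos ht)).1
      (abs_le.1 (hc.abs_inner_I_mul_le hpos ht)).2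
    calc _ ≤ ‖y t‖ ^ (α - 2) * (‖y t‖ * C * t) ^ 2 := by gcongr
      _ = _ := by
        rw [Real.rpow_sub hr, Real.rpow_two]
        field_simp
  have hQ : Tendsto (fun t => (2 * M / α + 2 * (e t * ‖y t‖ ^ α)) -
      ‖y t‖ ^ (α - 2) * inner ℝ (Complex.I * y t) (v t) ^ 2) (𝓝[>] 0) (𝓝 (2 * M / α)) := by
    simpa using (((hc.tendsto_energy_mul (hc.tendsto_norm_rpow hα)).const_mul 2).const_add
      (2 * M / α)).sub hJ
  refine hQ.sqrt.congr' ?_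
  filter_upwards [hc.eventually_mem] with t ht
  have hr : 0 < ‖y t‖ := norm_pos_iff.2 (hc.ne_zero t ht)
  have hD := hpos t ht
  rw [← Real.sqrt_sq (show 0 ≤ ‖y t‖ ^ ((α - 2) / 2) * inner ℝ (y t) (v t) by positivity)]
  congr 1
  rw [← hc.norm_mul_norm_velocity_sq ht, mul_pow, ← Real.rpow_mul_natCast hr.le]
  have h1 := inner_sq_add_inner_I_mul_sq (y t) (v t)
  have h2 : ‖y t‖ ^ α = ‖y t‖ ^ (α - 2) * ‖y t‖ ^ 2 := by
    rw [Real.rpow_sub hr, Real.rpow_two]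
    field_simp
  rw [h2, show (α - 2) / 2 * ((2 : ℕ) : ℝ) = α - 2 by push_cast; ring]
  linear_combination - ‖y t‖ ^ (α - 2) * h1

/-- Asymptotics of the distance to the origin. -/
lemma tendsto_rpow_div (hc : IsPerturbedCollision α M δ C y v g e) :
    Tendsto (fun t => ‖y t‖ ^ ((2 + α) / 2) / t) (𝓝[>] 0)
      (𝓝 ((2 + α) / 2 * √(2 * M / α))) := by
  have hα := hc.exponent_pos
  refine HasDerivAt.lhopital_zero_nhdsGT (g' := fun _ => 1)
    (f' := fun t => (2 + α) / 2 * (‖y t‖ ^ ((α - 2) / 2) * inner ℝ (y t) (v t)))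
    ?_ (Eventually.of_forall fun t => hasDerivAt_id t) (Eventually.of_forall fun _ => one_ne_zero)
    (hc.tendsto_norm_rpow (by linarith)) nhdsWithin_le_nhds ?_
  · filter_upwards [hc.eventually_mem] with t ht
    have hr : 0 < ‖y t‖ := norm_pos_iff.2 (hc.ne_zero t ht)
    have h1 := (hc.hasDerivAt_position t ht).norm_sq.rpow_const (p := (2 + α) / 4)
      (Or.inl (by positivity))
    convert h1 using 1
    · ext s
      rw [← Real.rpow_natCast_mul (norm_nonneg _)]
      congr 1
      push_cast; ring
    · rw [← Real.rpow_natCast_mul hr.le,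
        show ((2 : ℕ) : ℝ) * ((2 + α) / 4 - 1) = (α - 2) / 2 by push_cast; ring]
      ring
  · simpa using hc.tendsto_rpow_mul_inner.const_mul ((2 + α) / 2)

lemma tendsto_norm_rpow_div (hc : IsPerturbedCollision α M δ C y v g e) {μ : ℝ}
    (hμ : μ = (α + 2) * √(M / (2 * α))) (b : ℝ) :
    Tendsto (fun t => ‖y t‖ ^ b / (μ * t) ^ (2 * b / (2 + α))) (𝓝[>] 0) (𝓝 1) := by
  have hα := hc.exponent_pos
  have hM := hc.mass_pos
  have hμ0 : 0 < μ := by rw [hμ]; positivity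
  have h1 : Tendsto (fun t => ‖y t‖ ^ ((2 + α) / 2) / t / μ) (𝓝[>] 0) (𝓝 1) := by
    have := hc.tendsto_rpow_div.div_const μ
    rwa [mul_sqrt_eq hμ, div_self hμ0.ne'] at this
  have h2 := h1.rpow_const (p := 2 * b / (2 + α)) (Or.inl one_ne_zero)
  rw [Real.one_rpow] at h2
  refine h2.congr' ?_
  filter_upwards [self_mem_nhdsWithin] with t (ht : 0 < t)
  rw [div_div, mul_comm t, Real.div_rpow (by positivity) (by positivity),
    ← Real.rpow_mul (norm_nonneg _)]
  congr 2
  field_simp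

lemma tendsto_mul_rpow (hc : IsPerturbedCollision α M δ C y v g e) {μ : ℝ}
    (hμ : μ = (α + 2) * √(M / (2 * α))) {E : ℝ → ℝ} {B : ℝ}
    (hE : ∀ᶠ t in 𝓝[>] 0, |E t| ≤ B) :
    Tendsto (fun t => (M / (α * ‖y t‖ ^ α) + E t) * (μ * t) ^ (2 * α / (2 + α)))
      (𝓝[>] 0) (𝓝 (M / α)) := by
  have hα := hc.exponent_pos
  have hM := hc.mass_pos
  have hμ0 : 0 < μ := by rw [hμ]; positivity
  have hS : Tendsto (fun t => (μ * t) ^ (2 * α / (2 + α))) (𝓝[>] 0) (𝓝 0) := by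
    have h0 : Tendsto (fun t : ℝ => μ * t) (𝓝[>] 0) (𝓝 0) := by
      simpa using (tendsto_nhdsWithin_of_tendsto_nhds tendsto_id :
        Tendsto (fun t : ℝ => t) (𝓝[>] 0) (𝓝 0)).const_mul μ
    have hp : 0 < 2 * α / (2 + α) := by positivity
    simpa [Real.zero_rpow hp.ne'] using h0.rpow_const (Or.inr hp.le)
  have h1 := (((hc.tendsto_norm_rpow_div hμ α).inv₀ one_ne_zero).const_mul (M / α)).add
    (bdd_le_mul_tendsto_zero' B hE hS)
  rw [inv_one, mul_one, add_zero] at h1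
  refine h1.congr fun t => ?_
  rw [inv_div, add_mul]
  congr 1
  ring

lemma hasDerivAt_norm_sq (hc : IsPerturbedCollision α M δ C y v g e) {t : ℝ}
    (ht : t ∈ Set.Ioo 0 δ) : HasDerivAt (fun s => ‖y s‖ ^ 2) (2 * inner ℝ (y t) (v t)) t :=
  (hc.hasDerivAt_position t ht).norm_sq

lemma hasDerivAt_deriv_norm_sq (hc : IsPerturbedCollision α M δ C y v g e) {t : ℝ}
    (ht : t ∈ Set.Ioo 0 δ) : HasDerivAt (deriv fun s => ‖y s‖ ^ 2)
      (2 * ((2 - α) * (M / (α * ‖y t‖ ^ α)) + (2 * e t + inner ℝ (y t) (g t)))) t := by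
  refine ((hc.hasDerivAt_inner ht).const_mul 2).congr_of_eventuallyEq ?_
  filter_upwards [isOpen_Ioo.mem_nhds ht] with s hs
  exact (hc.hasDerivAt_norm_sq hs).deriv

theorem tendsto_norm_sq_div (hc : IsPerturbedCollision α M δ C y v g e) {μ : ℝ}
    (hμ : μ = (α + 2) * √(M / (2 * α))) :
    Tendsto (fun t => ‖y t‖ ^ 2 / (μ * t) ^ ((4 : ℝ) / (2 + α))) (𝓝[>] 0) (𝓝 1) := by
  have := hc.tendsto_norm_rpow_div hμ 2
  norm_num at this
  exact this

theorem tendsto_deriv_norm_sq (hc : IsPerturbedCollision α M δ C y v g e) {μ : ℝ}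
    (hμ : μ = (α + 2) * √(M / (2 * α))) :
    Tendsto (fun t => deriv (fun s => ‖y s‖ ^ 2) t * (2 + α) /
      (4 * μ * (μ * t) ^ ((2 - α) / (2 + α)))) (𝓝[>] 0) (𝓝 1) := by
  have hα := hc.exponent_pos
  have hM := hc.mass_pos
  have hμ0 : 0 < μ := by rw [hμ]; positivity
  have hs : (2 + α) * √(2 * M / α) = 2 * μ := by linarith [mul_sqrt_eq hμ]
  have h1 := ((hc.tendsto_rpow_mul_inner).mul
    (hc.tendsto_norm_rpow_div hμ ((2 - α) / 2))).const_mul ((2 + α) / (2 * μ))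
  rw [mul_one, div_mul_eq_mul_div, hs, div_self (by positivity)] at h1
  refine h1.congr' ?_
  filter_upwards [hc.eventually_mem] with t ht
  have hr : 0 < ‖y t‖ := norm_pos_iff.2 (hc.ne_zero t ht)
  have hrr : ‖y t‖ ^ ((α - 2) / 2) * ‖y t‖ ^ ((2 - α) / 2) = 1 := by
    rw [← Real.rpow_add hr, show (α - 2) / 2 + (2 - α) / 2 = 0 by ring, Real.rpow_zero]
  rw [(hc.hasDerivAt_norm_sq ht).deriv,
    show 2 * ((2 - α) / 2) / (2 + α) = (2 - α) / (2 + α) by ring]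
  have hS : 0 < (μ * t) ^ ((2 - α) / (2 + α)) := Real.rpow_pos_of_pos (mul_pos hμ0 ht.1) _
  field_simp
  linear_combination (4 * inner ℝ (y t) (v t)) * hrr

theorem tendsto_deriv_deriv_norm_sq (hc : IsPerturbedCollision α M δ C y v g e) {μ : ℝ}
    (hμ : μ = (α + 2) * √(M / (2 * α))) :
    Tendsto (fun t => deriv (deriv (fun s => ‖y s‖ ^ 2)) t * (2 + α) ^ 2 /
      (4 * (2 - α) * μ ^ 2 * (μ * t) ^ (-(2 * α) / (2 + α)))) (𝓝[>] 0) (𝓝 1) := by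
  have hα := hc.exponent_pos
  have hα2 : 0 < 2 - α := sub_pos.2 hc.exponent_lt
  have hM := hc.mass_pos
  have hμ0 : 0 < μ := by rw [hμ]; positivity
  have hE : ∀ᶠ t in 𝓝[>] 0, |(2 * e t + inner ℝ (y t) (g t)) / (2 - α)| ≤
      (2 * C + 1 * C) / (2 - α) := by
    filter_upwards [hc.eventually_mem, hc.tendsto_norm.eventually_lt_const one_pos] with t ht h1
    have hC : 0 ≤ C := (norm_nonneg _).trans (hc.force_le t ht)
    rw [abs_div, abs_of_pos hα2]
    have := hc.abs_inner_add_le ht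
    gcongr
    exact this.trans (by gcongr)
  have h1 := (hc.tendsto_mul_rpow hμ hE).const_mul ((2 + α) ^ 2 / (2 * μ ^ 2))
  rw [div_mul_div_eq_one hα hM hμ] at h1
  refine h1.congr' ?_
  filter_upwards [hc.eventually_mem] with t ht
  have hr : 0 < ‖y t‖ := norm_pos_iff.2 (hc.ne_zero t ht)
  have hra : 0 < ‖y t‖ ^ α := Real.rpow_pos_of_pos hr α
  have hS : 0 < (μ * t) ^ (2 * α / (2 + α)) := Real.rpow_pos_of_pos (mul_pos hμ0 ht.1) _
  rw [(hc.hasDerivAt_deriv_norm_sq ht).deriv, neg_div, Real.rpow_neg (mul_pos hμ0 ht.1).le]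
  field_simp
  ring

/-- A function that differs boundedly from the potential of the mass `M` has the asymptotics
of the kinetic energy. -/
theorem tendsto_potential (hc : IsPerturbedCollision α M δ C y v g e) {μ : ℝ}
    (hμ : μ = (α + 2) * √(M / (2 * α))) {U : ℝ → ℝ} {B : ℝ}
    (hU : ∀ t ∈ Set.Ioo 0 δ, |U t - M / (α * ‖y t‖ ^ α)| ≤ B) :
    Tendsto (fun t => U t * (2 + α) ^ 2 * (μ * |t|) ^ (2 * α / (2 + α)) / (2 * μ ^ 2))
      (𝓝[>] 0) (𝓝 1) := by
  have hα := hc.exponent_pos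
  have hM := hc.mass_pos
  have hμ0 : 0 < μ := by rw [hμ]; positivity
  have h1 := (hc.tendsto_mul_rpow hμ (hc.eventually_mem.mono hU)).const_mul
    ((2 + α) ^ 2 / (2 * μ ^ 2))
  rw [div_mul_div_eq_one hα hM hμ] at h1
  refine h1.congr' ?_
  filter_upwards [self_mem_nhdsWithin] with t (ht : 0 < t)
  rw [abs_of_pos ht, add_sub_cancel]
  ring

theorem tendsto_kinetic (hc : IsPerturbedCollision α M δ C y v g e) {μ : ℝ}
    (hμ : μ = (α + 2) * √(M / (2 * α))) :
    Tendsto (fun t => 1 / 2 * ‖v t‖ ^ 2 * (2 + α) ^ 2 * (μ * |t|) ^ (2 * α / (2 + α)) /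
      (2 * μ ^ 2)) (𝓝[>] 0) (𝓝 1) := by
  refine hc.tendsto_potential hμ (B := C) fun t ht => ?_
  rw [hc.energy_eq t ht, add_sub_cancel_left]
  exact hc.energy_le t ht

end IsPerturbedCollision

/-- A solution of the `N`-center equation colliding with the center at the origin is a perturbed
collision on a short time interval. -/
lemma exists_isPerturbedCollision {ι : Type*} [Fintype ι] {c : ι → ℂ} {m : ι → ℝ} {i : ι}
    (hc : Function.Injective c) (hci : c i = 0) (hm : 0 < m i) {α δ h : ℝ} (hα : 0 < α)
    (hα2 : α < 2) (hδ : 0 < δ) {y v : ℝ → ℂ}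
    (hy : ∀ t ∈ Set.Ioo 0 δ, HasDerivAt y (v t) t)
    (hv : ∀ t ∈ Set.Ioo 0 δ, HasDerivAt v
      (-∑ j, (m j : ℂ) * (y t - c j) / ((‖y t - c j‖ ^ (α + 2) : ℝ) : ℂ)) t)
    (hne : ∀ t ∈ Set.Ioo 0 δ, y t ≠ 0) (hlim : Tendsto y (𝓝[>] 0) (𝓝 0))
    (hen : ∀ t ∈ Set.Ioo 0 δ, 1 / 2 * ‖v t‖ ^ 2 - ∑ j, m j / (α * ‖y t - c j‖ ^ α) = h) :
    ∃ δ' C : ℝ, ∃ (g : ℝ → ℂ) (e : ℝ → ℝ), IsPerturbedCollision α (m i) δ' C y v g e ∧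
      ∀ t ∈ Set.Ioo 0 δ', |∑ j, m j / (α * ‖y t - c j‖ ^ α) - m i / (α * ‖y t‖ ^ α)| ≤ C := by
  classical
  set F : ℂ → ℂ := fun z => -∑ j ∈ Finset.univ.erase i,
    (m j : ℂ) * (z - c j) / ((‖z - c j‖ ^ (α + 2) : ℝ) : ℂ) with hF
  set W : ℂ → ℝ := fun z => ∑ j ∈ Finset.univ.erase i, m j / (α * ‖z - c j‖ ^ α)
  have hcj : ∀ j ∈ Finset.univ.erase i, ‖(0 : ℂ) - c j‖ ≠ 0 := by
    intro j hj
    rw [zero_sub, norm_neg, norm_ne_zero_iff, ← hci]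
    exact hc.ne (Finset.ne_of_mem_erase hj)
  have hnorm : ∀ j, ContinuousAt (fun z : ℂ => ‖z - c j‖) 0 := fun j => by fun_prop
  have hFc : ContinuousAt F 0 := by
    refine (tendsto_finsetSum _ fun j hj => ?_).neg
    have h1 := (hnorm j).rpow_const (p := α + 2) (Or.inl (hcj j hj))
    have h2 : ContinuousAt (fun z : ℂ => ((‖z - c j‖ ^ (α + 2) : ℝ) : ℂ)) 0 :=
      Complex.continuous_ofReal.continuousAt.comp h1
    refine ContinuousAt.div (by fun_prop) h2 ?_
    exact Complex.ofReal_ne_zero.2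
      (Real.rpow_pos_of_pos ((norm_nonneg _).lt_of_ne' (hcj j hj)) _).ne'
  have hWc : ContinuousAt W 0 := by
    refine tendsto_finsetSum _ fun j hj => ?_
    have h1 := (hnorm j).rpow_const (p := α) (Or.inl (hcj j hj))
    refine ContinuousAt.div continuousAt_const (continuousAt_const.mul h1) ?_
    exact (mul_pos hα (Real.rpow_pos_of_pos ((norm_nonneg _).lt_of_ne' (hcj j hj)) _)).ne'
  have hFb := (hFc.tendsto.comp hlim).norm.eventually_lt_const (lt_add_one _)
  have hWb := (hWc.tendsto.comp hlim).abs.eventually_lt_const (lt_add_one _)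
  obtain ⟨δ₁, hδ₁, hsub⟩ := (mem_nhdsGT_iff_exists_Ioo_subset' hδ).1 (hFb.and hWb)
  set C := max (‖F 0‖ + 1) (|W 0| + 1 + |h|)
  have hforce : ∀ t ∈ Set.Ioo 0 (min δ₁ δ), ‖F (y t)‖ ≤ C ∧ |W (y t)| + |h| ≤ C := by
    intro t ht
    obtain ⟨h1, h2⟩ := hsub ⟨ht.1, ht.2.trans_le (min_le_left _ _)⟩
    exact ⟨(h1.trans_le (le_max_left _ _)).le,
      (by simpa using h2.le : |W (y t)| + |h| ≤ _).trans (le_max_right _ _)⟩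
  have hV : ∀ t, ∑ j, m j / (α * ‖y t - c j‖ ^ α) = m i / (α * ‖y t‖ ^ α) + W (y t) := by
    intro t
    rw [← Finset.add_sum_erase _ _ (Finset.mem_univ i), hci, sub_zero]
  have hmem : ∀ t ∈ Set.Ioo 0 (min δ₁ δ), t ∈ Set.Ioo 0 δ := fun t ht =>
    ⟨ht.1, ht.2.trans_le (min_le_right _ _)⟩
  refine ⟨min δ₁ δ, C, fun t => F (y t), fun t => W (y t) + h,
    ⟨hα, hα2, hm, lt_min hδ₁ hδ, fun t ht => hy t (hmem t ht), fun t ht => ?_,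
      fun t ht => hne t (hmem t ht), hlim, fun t ht => (hforce t ht).1, fun t ht => ?_,
      fun t ht => (abs_add_le _ _).trans (hforce t ht).2⟩, fun t ht => ?_⟩
  · refine (hv t (hmem t ht)).congr_deriv ?_
    rw [← Finset.add_sum_erase _ _ (Finset.mem_univ i), hci, sub_zero, neg_add, hF,
      Complex.real_smul]
    push_cast
    ring
  · linarith [hen t (hmem t ht), hV t]
  · rw [hV, add_sub_cancel_left]
    linarith [(hforce t ht).2, abs_nonneg h]

/-- Sundman-type asymptotics at a collision. -/
theorem stmt_4
    (N : ℕ) (hN : 0 < N) (c : Fin N → ℂ) (m : Fin N → ℝ)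
    (hc_inj : Function.Injective c) (hm : ∀ j, 0 < m j)
    (α : ℝ) (hα1 : 1 ≤ α) (hα2 : α < 2)
    (hc1 : c ⟨0, hN⟩ = 0)
    (δ : ℝ) (hδ : 0 < δ) (y : ℝ → ℂ)
    (hy_cont : ContinuousOn y (Set.Icc (-δ) δ))
    (hy0 : y 0 = 0)
    (hy_ne : ∀ t ∈ Set.Icc (-δ) δ, t ≠ 0 → ∀ j, y t ≠ c j)
    (hy_d1 : ∀ t ∈ Set.Icc (-δ) δ, t ≠ 0 → DifferentiableAt ℝ y t)
    (hy_d2 : ∀ t ∈ Set.Icc (-δ) δ, t ≠ 0 → DifferentiableAt ℝ (deriv y) t)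
    (hy_eq : ∀ t ∈ Set.Icc (-δ) δ, t ≠ 0 →
      deriv (deriv y) t = -∑ j, (m j : ℂ) * (y t - c j) / ((‖y t - c j‖ ^ (α + 2) : ℝ) : ℂ))
    (h : ℝ)
    (hy_energy : ∀ t ∈ Set.Icc (-δ) δ, t ≠ 0 →
      (1 / 2) * ‖deriv y t‖ ^ 2 - ∑ j, m j / (α * ‖y t - c j‖ ^ α) = h)
    (μ : ℝ) (hμ : μ = (α + 2) * Real.sqrt (m ⟨0, hN⟩ / (2 * α))) :
    (Filter.Tendsto (fun t : ℝ => ‖y t‖ ^ 2 / (μ * t) ^ ((4 : ℝ) / (2 + α)))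
      (𝓝[>] (0 : ℝ)) (𝓝 1)) ∧
    (Filter.Tendsto (fun t : ℝ =>
        deriv (fun s => ‖y s‖ ^ 2) t * (2 + α) / (4 * μ * (μ * t) ^ ((2 - α) / (2 + α))))
      (𝓝[>] (0 : ℝ)) (𝓝 1)) ∧
    (Filter.Tendsto (fun t : ℝ =>
        deriv (deriv (fun s => ‖y s‖ ^ 2)) t * (2 + α) ^ 2 /
          (4 * (2 - α) * μ ^ 2 * (μ * t) ^ (-(2 * α) / (2 + α))))
      (𝓝[>] (0 : ℝ)) (𝓝 1)) ∧
    (Filter.Tendsto (fun t : ℝ =>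
        ((1 / 2) * ‖deriv y t‖ ^ 2) * (2 + α) ^ 2 * (μ * |t|) ^ (2 * α / (2 + α)) / (2 * μ ^ 2))
      (𝓝[≠] (0 : ℝ)) (𝓝 1)) ∧
    (Filter.Tendsto (fun t : ℝ =>
        (∑ j, m j / (α * ‖y t - c j‖ ^ α)) * (2 + α) ^ 2 * (μ * |t|) ^ (2 * α / (2 + α)) /
          (2 * μ ^ 2))
      (𝓝[≠] (0 : ℝ)) (𝓝 1)) := by
  have hα : 0 < α := by linarith
  have hpos : ∀ t ∈ Set.Ioo 0 δ, t ∈ Set.Icc (-δ) δ ∧ t ≠ 0 := fun t ht =>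
    ⟨⟨by linarith [ht.1], ht.2.le⟩, ht.1.ne'⟩
  have hneg : ∀ t ∈ Set.Ioo 0 δ, -t ∈ Set.Icc (-δ) δ ∧ -t ≠ 0 := fun t ht =>
    ⟨⟨by linarith [ht.2], by linarith [ht.1]⟩, neg_ne_zero.2 ht.1.ne'⟩
  have hlim : Tendsto y (𝓝 0) (𝓝 0) := by
    have := hy_cont.continuousAt (Icc_mem_nhds (by linarith) hδ)
    rwa [ContinuousAt, hy0] at this
  have hderiv2 : ∀ t ∈ Set.Icc (-δ) δ, t ≠ 0 → HasDerivAt (deriv y)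
      (-∑ j, (m j : ℂ) * (y t - c j) / ((‖y t - c j‖ ^ (α + 2) : ℝ) : ℂ)) t := fun t ht h0 =>
    hy_eq t ht h0 ▸ (hy_d2 t ht h0).hasDerivAt
  obtain ⟨δ₁, C₁, g₁, e₁, hc₁, hV₁⟩ := exists_isPerturbedCollision hc_inj hc1 (hm _) hα hα2 hδ
    (y := y) (v := deriv y)
    (fun t ht => (hy_d1 t (hpos t ht).1 (hpos t ht).2).hasDerivAt)
    (fun t ht => hderiv2 t (hpos t ht).1 (hpos t ht).2)
    (fun t ht => hc1 ▸ hy_ne t (hpos t ht).1 (hpos t ht).2 _)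
    (hlim.mono_left nhdsWithin_le_nhds)
    (fun t ht => hy_energy t (hpos t ht).1 (hpos t ht).2)
  obtain ⟨δ₂, C₂, g₂, e₂, hc₂, hV₂⟩ := exists_isPerturbedCollision hc_inj hc1 (hm _) hα hα2 hδ
    (y := fun t => y (-t)) (v := fun t => -deriv y (-t))
    (fun t ht => ((hy_d1 (-t) (hneg t ht).1 (hneg t ht).2).hasDerivAt.scomp t
      (hasDerivAt_neg t)).congr_deriv (by simp))
    (fun t ht => ((hderiv2 (-t) (hneg t ht).1 (hneg t ht).2).scomp t
      (hasDerivAt_neg t)).neg.congr_deriv (by simp))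
    (fun t ht => hc1 ▸ hy_ne (-t) (hneg t ht).1 (hneg t ht).2 _)
    (hlim.comp (by simpa using (tendsto_neg (0 : ℝ)).mono_left nhdsWithin_le_nhds))
    (fun t ht => by simpa using hy_energy (-t) (hneg t ht).1 (hneg t ht).2)
  have hreflect : Tendsto (fun t : ℝ => -t) (𝓝[<] 0) (𝓝[>] 0) := by
    simpa using tendsto_neg_nhdsLT (a := (0 : ℝ))
  refine ⟨hc₁.tendsto_norm_sq_div hμ, hc₁.tendsto_deriv_norm_sq hμ,
    hc₁.tendsto_deriv_deriv_norm_sq hμ, ?_, ?_⟩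
  · rw [← nhdsLT_sup_nhdsGT]
    refine Tendsto.sup ?_ (hc₁.tendsto_kinetic hμ)
    simpa [Function.comp_def] using (hc₂.tendsto_kinetic hμ).comp hreflect
  · rw [← nhdsLT_sup_nhdsGT]
    refine Tendsto.sup ?_ (hc₁.tendsto_potential hμ hV₁)
    simpa [Function.comp_def] using (hc₂.tendsto_potential hμ hV₂).comp hreflect
end

section
/- Asymptotic collision directions: let y be an isolated collision solution at the origin, I(t) = |y(t)|² and J(t) = Im(conj(y(t))·ẏ(t)). Then there exist real numbers θ₋, θ₊ such that lim_{t → 0⁻} y(t)/|y(t)| = e^{iθ₋} and lim_{t → 0⁺} y(t)/|y(t)| = e^{iθ₊}; moreover there exist C > 0 and δ₀ ∈ (0, δ] with |J(t)/I(t)| ≤ C·|t|^{α/(2+α)} for all t ∈ [−δ₀, δ₀] \ {0}; in particular the angular velocity J(t)/I(t) tends to 0 as t → 0. -/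
open Filter Topology
open scoped ComplexConjugate

/-- A nonnegative function vanishing at `0` that is at least as convex as `k s²` on `[0, t]`
dominates `k s²` at the right endpoint. -/
theorem mul_sq_le_of_convexOn_sub_mul_sq {f : ℝ → ℝ} {k t : ℝ} (ht : 0 < t) (hf0 : f 0 = 0)
    (hf : ∀ s ∈ Set.Ioo 0 t, 0 ≤ f s)
    (hconv : ConvexOn ℝ (Set.Icc 0 t) fun s => f s - k * s ^ 2) : k * t ^ 2 ≤ f t := by
  have hs : ∀ s ∈ Set.Ioo 0 t, 0 ≤ f t - k * t ^ 2 + k * t * s := by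
    intro s hs
    have hq : s / t ≤ 1 := (div_le_one ht).2 hs.2.le
    have hc := hconv.2 (Set.left_mem_Icc.2 ht.le) (Set.right_mem_Icc.2 ht.le)
      (sub_nonneg.2 hq) (div_nonneg hs.1.le ht.le) (by ring)
    have hst : s / t * t = s := by field_simp
    simp only [smul_eq_mul, mul_zero, zero_add, hf0, hst] at hc
    have hpos := hf s hs
    have h1 : 0 ≤ s / t * (f t - k * t ^ 2 + k * t * s) := by
      have : s / t * (k * t * s) = k * s ^ 2 := by field_simp
      nlinarith
    exact nonneg_of_mul_nonneg_right h1 (div_pos hs.1 ht)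
  have hlim : Tendsto (fun s => f t - k * t ^ 2 + k * t * s) (𝓝[>] 0)
      (𝓝 (f t - k * t ^ 2 + k * t * 0)) :=
    (Continuous.tendsto (by fun_prop) 0).mono_left nhdsWithin_le_nhds
  have := ge_of_tendsto hlim (by
    filter_upwards [Ioo_mem_nhdsGT ht] with s h using hs s h)
  linarith

/-- Derivative of the moment of inertia `‖y‖²`. -/
theorem hasDerivAt_norm_sq_complex {y : ℝ → ℂ} {v : ℂ} {t : ℝ} (h : HasDerivAt y v t) :
    HasDerivAt (fun s => ‖y s‖ ^ 2) (2 * (conj (y t) * v).re) t := by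
  have := h.norm_sq
  simpa [Complex.inner, mul_comm] using this

/-- Derivative of `conj y * v` along `ẏ = v`, `v̇ = a`. -/
theorem hasDerivAt_conj_mul {y v : ℝ → ℂ} {a : ℂ} {t : ℝ} (hy : HasDerivAt y (v t) t)
    (hv : HasDerivAt v a t) :
    HasDerivAt (fun s => conj (y s) * v s) (((‖v t‖ ^ 2 : ℝ) : ℂ) + conj (y t) * a) t := by
  have h1 : HasDerivAt (fun s => conj (y s)) (conj (v t)) t := by
    simpa using hy.star
  have := h1.mul hv
  rwa [Complex.conj_mul', ← Complex.ofReal_pow] at this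

theorem HasDerivAt.complex_re {f : ℝ → ℂ} {f' : ℂ} {t : ℝ} (h : HasDerivAt f f' t) :
    HasDerivAt (fun s => (f s).re) f'.re t :=
  Complex.reCLM.hasFDerivAt.comp_hasDerivAt t h

theorem HasDerivAt.complex_im {f : ℝ → ℂ} {f' : ℂ} {t : ℝ} (h : HasDerivAt f f' t) :
    HasDerivAt (fun s => (f s).im) f'.im t :=
  Complex.imCLM.hasFDerivAt.comp_hasDerivAt t h

/-- The direction `y / ‖y‖` rotates with the angular velocity `J / I`. -/
theorem hasDerivAt_div_norm {y : ℝ → ℂ} {v : ℂ} {t : ℝ} (h : HasDerivAt y v t) (hne : y t ≠ 0) :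
    HasDerivAt (fun s => y s / ((‖y s‖ : ℝ) : ℂ))
      ((((conj (y t) * v).im / ‖y t‖ ^ 2 : ℝ) : ℂ) * Complex.I * (y t / ((‖y t‖ : ℝ) : ℂ))) t := by
  have hr : ‖y t‖ ≠ 0 := norm_ne_zero_iff.2 hne
  have hn : HasDerivAt (fun s => ‖y s‖) ((conj (y t) * v).re / ‖y t‖) t := by
    have := (hasDerivAt_norm_sq_complex h).sqrt (by positivity)
    simp only [Real.sqrt_sq (norm_nonneg _)] at this
    convert this using 1
    field_simp
  have hrC : ((‖y t‖ : ℝ) : ℂ) ≠ 0 := by exact_mod_cast hr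
  refine (h.fun_div hn.ofReal_comp hrC).congr_deriv ?_
  have key : conj (y t) * v = ((conj (y t) * v).re : ℂ) + ((conj (y t) * v).im : ℂ) * Complex.I :=
    (Complex.re_add_im _).symm
  have hc : conj (y t) * y t = ((‖y t‖ : ℝ) : ℂ) ^ 2 := Complex.conj_mul' _
  push_cast
  generalize ((conj (y t) * v).re : ℂ) = p at *
  generalize ((conj (y t) * v).im : ℂ) = q at *
  field_simp
  linear_combination (y t) * key - v * hc

/-- A curve on `(0, δ]` whose direction has bounded angular velocity has an asymptotic direction
at `0`. -/
theorem exists_tendsto_direction {δ M : ℝ} (hδ : 0 < δ) {y v : ℝ → ℂ}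
    (hne : ∀ t ∈ Set.Ioc 0 δ, y t ≠ 0) (hyv : ∀ t ∈ Set.Ioc 0 δ, HasDerivAt y (v t) t)
    (hM : ∀ t ∈ Set.Ioc 0 δ, |(conj (y t) * v t).im / ‖y t‖ ^ 2| ≤ M) :
    ∃ θ : ℝ, Tendsto (fun t => y t / ((‖y t‖ : ℝ) : ℂ)) (𝓝[>] 0)
      (𝓝 (Complex.exp ((θ : ℂ) * Complex.I))) := by
  have hone : ∀ t ∈ Set.Ioc 0 δ, ‖y t / ((‖y t‖ : ℝ) : ℂ)‖ = 1 := by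
    intro t ht
    have : ‖y t‖ ≠ 0 := norm_ne_zero_iff.2 (hne t ht)
    simp [this]
  have hlip : LipschitzOnWith M.toNNReal (fun t => y t / ((‖y t‖ : ℝ) : ℂ)) (Set.Ioc 0 δ) := by
    refine (convex_Ioc 0 δ).lipschitzOnWith_of_nnnorm_hasDerivWithin_le
      (fun t ht => (hasDerivAt_div_norm (hyv t ht) (hne t ht)).hasDerivWithinAt) fun t ht => ?_
    rw [← NNReal.coe_le_coe, coe_nnnorm, norm_mul, hone t ht, norm_mul, Complex.norm_real,
      Complex.norm_I, mul_one, mul_one, Real.norm_eq_abs]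
    exact (hM t ht).trans (Real.le_coe_toNNReal M)
  have hmem : Set.Ioc 0 δ ∈ 𝓝[>] (0 : ℝ) := Ioc_mem_nhdsGT hδ
  have hcauchy : Cauchy (map (fun t => y t / ((‖y t‖ : ℝ) : ℂ)) (𝓝[>] (0 : ℝ))) :=
    (cauchy_nhds.mono nhdsWithin_le_nhds).map_of_le hlip.uniformContinuousOn
      (le_principal_iff.2 hmem)
  obtain ⟨u, hu⟩ := CompleteSpace.complete hcauchy
  have hu1 : ‖u‖ = 1 := by
    refine tendsto_nhds_unique (Tendsto.norm (f := fun t => y t / ((‖y t‖ : ℝ) : ℂ)) hu) ?_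
    refine tendsto_const_nhds.congr' ?_
    filter_upwards [hmem] with t ht using (hone t ht).symm
  refine ⟨u.arg, ?_⟩
  have : Complex.exp ((u.arg : ℂ) * Complex.I) = u := by
    simpa [hu1] using Complex.norm_mul_exp_arg_mul_I u
  rwa [this]

/-- The convexity of the moment of inertia bounds the radius from below. -/
theorem collision_radius_bounds {α δ B : ℝ} (hα : 0 ≤ α) (hB : 0 < B) {y v a : ℝ → ℂ}
    (hy : ContinuousOn y (Set.Icc 0 δ)) (hy0 : y 0 = 0) (hne : ∀ t ∈ Set.Ioc 0 δ, y t ≠ 0)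
    (hyv : ∀ t ∈ Set.Ioc 0 δ, HasDerivAt y (v t) t)
    (hva : ∀ t ∈ Set.Ioc 0 δ, HasDerivAt v (a t) t)
    (hconv : ∀ t ∈ Set.Ioc 0 δ, B * ‖y t‖ ^ (-α) ≤ ‖v t‖ ^ 2 + (conj (y t) * a t).re)
    {t : ℝ} (ht : t ∈ Set.Ioc 0 δ) :
    (∀ s ∈ Set.Ioc 0 t, ‖y s‖ ≤ ‖y t‖) ∧ B * t ^ 2 ≤ ‖y t‖ ^ (2 + α) := by
  have hsub : ∀ {t}, t ∈ Set.Ioc 0 δ → ∀ s ∈ Set.Ioc 0 t, s ∈ Set.Ioc 0 δ :=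
    fun ht s hs => ⟨hs.1, hs.2.trans ht.2⟩
  have hcx : ∀ k : ℝ, ∀ t ∈ Set.Ioc 0 δ,
      (∀ s ∈ Set.Ioo 0 t, k ≤ ‖v s‖ ^ 2 + (conj (y s) * a s).re) →
      ConvexOn ℝ (Set.Icc 0 t) fun s => ‖y s‖ ^ 2 - k * s ^ 2 := by
    intro k t ht hk
    refine convexOn_of_hasDerivWithinAt2_nonneg (convex_Icc 0 t)
      (f' := fun s => 2 * (conj (y s) * v s).re - k * (2 * s))
      (f'' := fun s => 2 * (‖v s‖ ^ 2 + (conj (y s) * a s).re) - k * 2)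
      (((hy.mono (Set.Icc_subset_Icc_right ht.2)).norm.pow 2).sub (by fun_prop)) ?_ ?_ ?_
    all_goals
      rw [interior_Icc]
      intro s hs
      have hs' := hsub ht s ⟨hs.1, hs.2.le⟩
    · have h2 : HasDerivAt (fun s : ℝ => s ^ 2) (2 * s) s := by simpa using hasDerivAt_pow 2 s
      exact ((hasDerivAt_norm_sq_complex (hyv s hs')).sub (h2.const_mul k)).hasDerivWithinAt
    · have h1 := (hasDerivAt_conj_mul (hyv s hs') (hva s hs')).complex_re
      rw [Complex.add_re, Complex.ofReal_re] at h1
      have h2 : HasDerivAt (fun s : ℝ => 2 * s) 2 s := by simpa using (hasDerivAt_id s).const_mul 2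
      exact ((h1.const_mul 2).sub (h2.const_mul k)).hasDerivWithinAt
    · have := hk s hs
      linarith
  have hmono : ∀ s ∈ Set.Ioc 0 t, ‖y s‖ ≤ ‖y t‖ := by
    intro s hs
    have hc := hcx 0 t ht fun s hs =>
      le_trans (by positivity) (hconv s (hsub ht s ⟨hs.1, hs.2.le⟩))
    simp only [zero_mul, sub_zero] at hc
    have hmax := hc.le_max_of_mem_Icc (Set.left_mem_Icc.2 ht.1.le) (Set.right_mem_Icc.2 ht.1.le)
      ⟨hs.1.le, hs.2⟩
    simp only [hy0, norm_zero, ne_eq, OfNat.ofNat_ne_zero, not_false_eq_true, zero_pow] at hmax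
    rw [max_eq_right (by positivity)] at hmax
    exact le_of_sq_le_sq hmax (norm_nonneg _)
  refine ⟨hmono, ?_⟩
  have hr : 0 < ‖y t‖ := norm_pos_iff.2 (hne t ht)
  have hk := mul_sq_le_of_convexOn_sub_mul_sq (f := fun s => ‖y s‖ ^ 2) ht.1 (by simp [hy0])
    (fun s _ => by positivity)
    (hcx (B * ‖y t‖ ^ (-α)) t ht fun s hs => by
      have hs' : s ∈ Set.Ioc 0 t := ⟨hs.1, hs.2.le⟩
      refine le_trans ?_ (hconv s (hsub ht s hs'))
      exact mul_le_mul_of_nonneg_left (Real.rpow_le_rpow_of_nonpos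
        (norm_pos_iff.2 (hne s (hsub ht s hs'))) (hmono s hs') (neg_nonpos.2 hα)) hB.le)
  rw [Real.rpow_add hr, Real.rpow_two]
  rw [Real.rpow_neg hr.le] at hk
  have hp : 0 < ‖y t‖ ^ α := Real.rpow_pos_of_pos hr α
  calc B * t ^ 2 = B * (‖y t‖ ^ α)⁻¹ * t ^ 2 * ‖y t‖ ^ α := by field_simp
    _ ≤ ‖y t‖ ^ 2 * ‖y t‖ ^ α := mul_le_mul_of_nonneg_right hk hp.le

/-- Angular velocity estimate after a collision, for a force whose torque is at most linear in the
radius. -/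
theorem collision_angular_velocity_le {α δ A B : ℝ} (hα : 0 ≤ α) (hA : 0 ≤ A) (hB : 0 < B)
    {y v a : ℝ → ℂ}
    (hy : ContinuousOn y (Set.Icc 0 δ)) (hy0 : y 0 = 0) (hne : ∀ t ∈ Set.Ioc 0 δ, y t ≠ 0)
    (hyv : ∀ t ∈ Set.Ioc 0 δ, HasDerivAt y (v t) t)
    (hva : ∀ t ∈ Set.Ioc 0 δ, HasDerivAt v (a t) t)
    (htorque : ∀ t ∈ Set.Ioc 0 δ, |(conj (y t) * a t).im| ≤ A * ‖y t‖)
    (hconv : ∀ t ∈ Set.Ioc 0 δ, B * ‖y t‖ ^ (-α) ≤ ‖v t‖ ^ 2 + (conj (y t) * a t).re)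
    (hlim : Tendsto (fun t => (conj (y t) * v t).im) (𝓝[>] 0) (𝓝 0))
    {t : ℝ} (ht : t ∈ Set.Ioc 0 δ) :
    |(conj (y t) * v t).im / ‖y t‖ ^ 2| ≤ A * B ^ (-(1 / (2 + α))) * t ^ (α / (2 + α)) := by
  obtain ⟨hmono, hlow⟩ := collision_radius_bounds hα hB hy hy0 hne hyv hva hconv ht
  have hr : 0 < ‖y t‖ := norm_pos_iff.2 (hne t ht)
  have hJ : |(conj (y t) * v t).im| ≤ A * ‖y t‖ * t := by
    have hε : ∀ ε ∈ Set.Ioo 0 t,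
        |(conj (y t) * v t).im - (conj (y ε) * v ε).im| ≤ A * ‖y t‖ * t := by
      intro ε hε
      have hsub : ∀ s ∈ Set.Icc ε t, s ∈ Set.Ioc 0 t := fun s hs => ⟨hε.1.trans_le hs.1, hs.2⟩
      have hle := (convex_Icc ε t).norm_image_sub_le_of_norm_hasDerivWithin_le
        (f := fun s => (conj (y s) * v s).im) (f' := fun s => (conj (y s) * a s).im)
        (C := A * ‖y t‖)
        (fun s hs => by
          have hs' : s ∈ Set.Ioc 0 δ := ⟨(hsub s hs).1, hs.2.trans ht.2⟩
          have h1 := (hasDerivAt_conj_mul (hyv s hs') (hva s hs')).complex_im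
          rw [Complex.add_im, Complex.ofReal_im, zero_add] at h1
          exact h1.hasDerivWithinAt)
        (fun s hs => (htorque s ⟨(hsub s hs).1, hs.2.trans ht.2⟩).trans
          (mul_le_mul_of_nonneg_left (hmono s (hsub s hs)) hA))
        (Set.left_mem_Icc.2 hε.2.le) (Set.right_mem_Icc.2 hε.2.le)
      refine hle.trans (mul_le_mul_of_nonneg_left ?_ (by positivity))
      rw [Real.norm_of_nonneg (sub_nonneg.2 hε.2.le)]
      linarith [hε.1]
    have hl : Tendsto (fun ε => |(conj (y t) * v t).im - (conj (y ε) * v ε).im|) (𝓝[>] 0)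
        (𝓝 |(conj (y t) * v t).im - 0|) := (tendsto_const_nhds.sub hlim).abs
    rw [sub_zero] at hl
    exact le_of_tendsto hl (by filter_upwards [Ioo_mem_nhdsGT ht.1] with ε h using hε ε h)
  have h2α : 0 < 2 + α := by linarith
  have hroot : B ^ (1 / (2 + α)) * t ^ (2 / (2 + α)) ≤ ‖y t‖ := by
    have := Real.rpow_le_rpow (by have := ht.1; positivity) hlow (by positivity : 0 ≤ 1 / (2 + α))
    rw [← Real.rpow_mul hr.le, mul_one_div_cancel h2α.ne', Real.rpow_one,
      Real.mul_rpow hB.le (by positivity), ← Real.rpow_two, ← Real.rpow_mul ht.1.le,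
      mul_one_div] at this
    exact this
  have hsplit : t ^ (α / (2 + α)) * t ^ (2 / (2 + α)) = t := by
    rw [← Real.rpow_add ht.1, ← add_div, add_comm α 2, div_self h2α.ne', Real.rpow_one]
  have hBp : 0 < B ^ (1 / (2 + α)) := Real.rpow_pos_of_pos hB _
  have htp : 0 < t ^ (α / (2 + α)) := Real.rpow_pos_of_pos ht.1 _
  rw [abs_div, abs_of_nonneg (sq_nonneg ‖y t‖), div_le_iff₀ (by positivity), Real.rpow_neg hB.le]
  refine hJ.trans ?_
  calc A * ‖y t‖ * t
      = A * (B ^ (1 / (2 + α)))⁻¹ * t ^ (α / (2 + α)) * ‖y t‖ *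
          (B ^ (1 / (2 + α)) * t ^ (2 / (2 + α))) := by
        rw [show A * ‖y t‖ * t = A * ‖y t‖ * (t ^ (α / (2 + α)) * t ^ (2 / (2 + α))) by
          rw [hsplit]]
        field_simp
    _ ≤ A * (B ^ (1 / (2 + α)))⁻¹ * t ^ (α / (2 + α)) * ‖y t‖ * ‖y t‖ := by gcongr
    _ = _ := by ring

/-- Asymptotic direction and angular velocity estimate after a collision. -/
theorem collision_direction_and_angular_velocity {α δ A B D : ℝ} (hα : 0 ≤ α) (hα2 : α < 2)
    (hδ : 0 < δ) (hA : 0 ≤ A) (hB : 0 < B) {y v a : ℝ → ℂ}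
    (hy : ContinuousOn y (Set.Icc 0 δ)) (hy0 : y 0 = 0) (hne : ∀ t ∈ Set.Ioc 0 δ, y t ≠ 0)
    (hyv : ∀ t ∈ Set.Ioc 0 δ, HasDerivAt y (v t) t)
    (hva : ∀ t ∈ Set.Ioc 0 δ, HasDerivAt v (a t) t)
    (hbd : ∀ t ∈ Set.Ioc 0 δ, |(conj (y t) * a t).im| ≤ A * ‖y t‖ ∧
      B * ‖y t‖ ^ (-α) ≤ ‖v t‖ ^ 2 + (conj (y t) * a t).re ∧
      (conj (y t) * v t).im ^ 2 ≤ D * ‖y t‖ ^ (2 - α)) :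
    (∃ θ : ℝ, Tendsto (fun t => y t / ((‖y t‖ : ℝ) : ℂ)) (𝓝[>] 0)
      (𝓝 (Complex.exp ((θ : ℂ) * Complex.I)))) ∧
    ∀ t ∈ Set.Ioc 0 δ,
      |(conj (y t) * v t).im / ‖y t‖ ^ 2| ≤ A * B ^ (-(1 / (2 + α))) * t ^ (α / (2 + α)) := by
  have hIoc : Set.Ioc 0 δ ∈ 𝓝[>] (0 : ℝ) := Ioc_mem_nhdsGT hδ
  have hy_lim : Tendsto y (𝓝[>] 0) (𝓝 0) := by
    have := hy 0 (Set.left_mem_Icc.2 hδ.le)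
    rw [ContinuousWithinAt, hy0] at this
    exact this.mono_left (nhdsWithin_le_of_mem (mem_of_superset hIoc Set.Ioc_subset_Icc_self))
  have hJ : Tendsto (fun t => (conj (y t) * v t).im) (𝓝[>] 0) (𝓝 0) := by
    have hr : Tendsto (fun t => D * ‖y t‖ ^ (2 - α)) (𝓝[>] 0) (𝓝 0) := by
      have := (hy_lim.norm.rpow_const (p := 2 - α) (Or.inr (by linarith))).const_mul D
      simpa [Real.zero_rpow (by linarith : 2 - α ≠ 0)] using this
    have hsq : Tendsto (fun t => (conj (y t) * v t).im ^ 2) (𝓝[>] 0) (𝓝 0) :=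
      squeeze_zero' (Eventually.of_forall fun t => sq_nonneg _)
        (by filter_upwards [hIoc] with t ht using (hbd t ht).2.2) hr
    have := hsq.sqrt
    simp only [Real.sqrt_sq_eq_abs, Real.sqrt_zero] at this
    exact (tendsto_zero_iff_abs_tendsto_zero _).2 this
  have hbound := fun t (ht : t ∈ Set.Ioc 0 δ) => collision_angular_velocity_le hα hA hB hy hy0 hne
    hyv hva (fun t ht => (hbd t ht).1) (fun t ht => (hbd t ht).2.1) hJ ht
  refine ⟨exists_tendsto_direction hδ hne hyv (M := A * B ^ (-(1 / (2 + α))) * δ ^ (α / (2 + α)))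
    fun t ht => (hbound t ht).trans ?_, hbound⟩
  have := ht.1.le
  have := ht.2
  gcongr

/-- Bounds near a center for the torque, for the second derivative of the moment of inertia and
for the angular momentum at energy `h`. -/
theorem nCenter_bounds_near_center {N : ℕ} (j₀ : Fin N) {c : Fin N → ℂ} {m : Fin N → ℝ}
    (hc : Function.Injective c) (hm : ∀ j, 0 < m j) {α : ℝ} (hα : 0 < α) (hα2 : α < 2)
    (hc0 : c j₀ = 0) (h : ℝ) :
    ∃ A B D : ℝ, 0 ≤ A ∧ 0 < B ∧ ∀ᶠ x in 𝓝 (0 : ℂ), x ≠ 0 → ∀ v a : ℂ,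
      a = -∑ j, (m j : ℂ) * (x - c j) / ((‖x - c j‖ ^ (α + 2) : ℝ) : ℂ) →
      (1 / 2) * ‖v‖ ^ 2 - ∑ j, m j / (α * ‖x - c j‖ ^ α) = h →
      |(conj x * a).im| ≤ A * ‖x‖ ∧
      B * ‖x‖ ^ (-α) ≤ ‖v‖ ^ 2 + (conj x * a).re ∧
      (conj x * v).im ^ 2 ≤ D * ‖x‖ ^ (2 - α) := by
  set s := Finset.univ.erase j₀
  set F : ℂ → ℂ := fun x => ∑ j ∈ s, (m j : ℂ) * (x - c j) / ((‖x - c j‖ ^ (α + 2) : ℝ) : ℂ)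
  set P : ℂ → ℝ := fun x => ∑ j ∈ s, m j / (α * ‖x - c j‖ ^ α)
  have hcne : ∀ j ∈ s, 0 < ‖(0 : ℂ) - c j‖ := by
    intro j hj
    rw [norm_pos_iff, sub_ne_zero, ← hc0]
    exact fun hj' => (Finset.ne_of_mem_erase hj) (hc hj').symm
  have hpow : ∀ p : ℝ, ∀ j ∈ s, ContinuousAt (fun x : ℂ => ‖x - c j‖ ^ p) 0 := fun p j hj =>
    ContinuousAt.rpow_const (by fun_prop) (Or.inl (hcne j hj).ne')
  have hFc : ContinuousAt F 0 := by
    refine tendsto_finsetSum s fun j hj => ?_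
    refine ContinuousAt.div (by fun_prop)
      (Complex.continuous_ofReal.continuousAt.comp (hpow (α + 2) j hj)) ?_
    exact_mod_cast (Real.rpow_pos_of_pos (hcne j hj) _).ne'
  have hPc : ContinuousAt P 0 := by
    refine tendsto_finsetSum s fun j hj => ?_
    exact ContinuousAt.div continuousAt_const (continuousAt_const.mul (hpow α j hj))
      (mul_pos hα (Real.rpow_pos_of_pos (hcne j hj) _)).ne'
  set K := ‖F 0‖ + 1
  set L := P 0 + 1
  set μ := m j₀
  have hμ : 0 < μ := hm j₀
  have hgap : 0 < 2 / α - 1 := by rw [sub_pos, lt_div_iff₀ hα]; linarith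
  have hsmall : ∀ᶠ x in 𝓝 (0 : ℂ),
      ‖x‖ ^ α * (2 * |h| + K * ‖x‖) < (2 / α - 1) * μ / 2 := by
    have hct : ContinuousAt (fun x : ℂ => ‖x‖ ^ α * (2 * |h| + K * ‖x‖)) 0 :=
      (ContinuousAt.rpow_const (by fun_prop) (Or.inr hα.le)).mul (by fun_prop)
    refine hct.eventually_lt continuousAt_const ?_
    simp only [norm_zero, Real.zero_rpow hα.ne', zero_mul]
    positivity
  refine ⟨K, (2 / α - 1) * μ / 2, 2 * |h| + 2 * μ / α + 2 * |L|, by positivity, by positivity, ?_⟩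
  filter_upwards [hFc.norm.eventually_lt continuousAt_const (lt_add_one ‖F 0‖),
    hPc.eventually_lt continuousAt_const (lt_add_one (P 0)), hsmall,
    Metric.ball_mem_nhds (0 : ℂ) one_pos] with x hxF hxP hxs hx1 hx v a ha hE
  have hr : 0 < ‖x‖ := norm_pos_iff.2 hx
  have hr1 : ‖x‖ < 1 := by simpa using hx1
  rw [← Finset.add_sum_erase _ _ (Finset.mem_univ j₀), hc0, sub_zero] at ha hE
  change a = -((μ : ℂ) * x / ((‖x‖ ^ (α + 2) : ℝ) : ℂ) + F x) at ha
  change 1 / 2 * ‖v‖ ^ 2 - (μ / (α * ‖x‖ ^ α) + P x) = h at hE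
  have hra : 0 < ‖x‖ ^ α := Real.rpow_pos_of_pos hr α
  have hP0 : 0 ≤ P x := Finset.sum_nonneg fun j _ => by have := hm j; positivity
  have hxa : conj x * a = ((-(μ * (‖x‖ ^ α)⁻¹) : ℝ) : ℂ) - conj x * F x := by
    have hxx : conj x * x = ((‖x‖ ^ 2 : ℝ) : ℂ) := by
      rw [Complex.conj_mul', Complex.ofReal_pow]
    have hq : μ * ‖x‖ ^ 2 / ‖x‖ ^ (α + 2) = μ * (‖x‖ ^ α)⁻¹ := by
      rw [Real.rpow_add hr, Real.rpow_two]
      field_simp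
    rw [← hq, ha]
    push_cast at hxx ⊢
    linear_combination (-(μ : ℂ) / ((‖x‖ ^ (α + 2) : ℝ) : ℂ)) * hxx
  have hFn : ‖conj x * F x‖ ≤ K * ‖x‖ := by
    rw [norm_mul, RCLike.norm_conj, mul_comm]
    gcongr
  have hv : ‖v‖ ^ 2 = 2 * h + 2 * μ / α * (‖x‖ ^ α)⁻¹ + 2 * P x := by
    have : μ / (α * ‖x‖ ^ α) = μ / α * (‖x‖ ^ α)⁻¹ := by field_simp
    rw [this] at hE
    linear_combination 2 * hE
  refine ⟨?_, ?_, ?_⟩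
  · rw [hxa, Complex.sub_im, Complex.ofReal_im, zero_sub, abs_neg]
    exact (Complex.abs_im_le_norm _).trans hFn
  · rw [hxa, Complex.sub_re, Complex.ofReal_re, hv, Real.rpow_neg hr.le]
    have hre := (Complex.re_le_norm _).trans hFn
    have hs : 2 * |h| + K * ‖x‖ ≤ (2 / α - 1) * μ / 2 * (‖x‖ ^ α)⁻¹ := by
      rw [← div_eq_mul_inv, le_div_iff₀ hra]
      linarith
    have hsplit : 2 * μ / α * (‖x‖ ^ α)⁻¹ - μ * (‖x‖ ^ α)⁻¹ =
        2 * ((2 / α - 1) * μ / 2 * (‖x‖ ^ α)⁻¹) := by ring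
    linarith [neg_abs_le h]
  · have him : (conj x * v).im ^ 2 ≤ ‖x‖ ^ 2 * ‖v‖ ^ 2 := by
      rw [← sq_abs, ← mul_pow]
      gcongr
      simpa using Complex.abs_im_le_norm (conj x * v)
    refine him.trans ?_
    rw [hv, Real.rpow_sub hr, Real.rpow_two, div_eq_mul_inv (‖x‖ ^ 2), mul_left_comm]
    refine mul_le_mul_of_nonneg_left ?_ (sq_nonneg _)
    have hinv : 1 ≤ (‖x‖ ^ α)⁻¹ := (one_le_inv₀ hra).2 (Real.rpow_le_one hr.le hr1.le hα.le)
    have h1 : 2 * h + 2 * P x ≤ 2 * |h| + 2 * |L| := by linarith [le_abs_self h, le_abs_self L]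
    have h2 : 2 * |h| + 2 * |L| ≤ (2 * |h| + 2 * |L|) * (‖x‖ ^ α)⁻¹ :=
      le_mul_of_one_le_right (by positivity) hinv
    linarith

/-- existence of asymptotic collision directions, with a quantitative bound on
the angular velocity J(t)/I(t). -/
theorem stmt_6
    (N : ℕ) (hN : 0 < N) (c : Fin N → ℂ) (m : Fin N → ℝ)
    (hc_inj : Function.Injective c) (hm : ∀ j, 0 < m j)
    (α : ℝ) (hα1 : 1 ≤ α) (hα2 : α < 2)
    (hc1 : c ⟨0, hN⟩ = 0)
    (δ : ℝ) (hδ : 0 < δ) (y : ℝ → ℂ)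
    (hy_cont : ContinuousOn y (Set.Icc (-δ) δ))
    (hy0 : y 0 = 0)
    (hy_ne : ∀ t ∈ Set.Icc (-δ) δ, t ≠ 0 → ∀ j, y t ≠ c j)
    (hy_d1 : ∀ t ∈ Set.Icc (-δ) δ, t ≠ 0 → DifferentiableAt ℝ y t)
    (hy_d2 : ∀ t ∈ Set.Icc (-δ) δ, t ≠ 0 → DifferentiableAt ℝ (deriv y) t)
    (hy_eq : ∀ t ∈ Set.Icc (-δ) δ, t ≠ 0 →
      deriv (deriv y) t = -∑ j, (m j : ℂ) * (y t - c j) / ((‖y t - c j‖ ^ (α + 2) : ℝ) : ℂ))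
    (h : ℝ)
    (hy_energy : ∀ t ∈ Set.Icc (-δ) δ, t ≠ 0 →
      (1 / 2) * ‖deriv y t‖ ^ 2 - ∑ j, m j / (α * ‖y t - c j‖ ^ α) = h) :
    ∃ θm θp : ℝ,
      Filter.Tendsto (fun t : ℝ => y t / ((‖y t‖ : ℝ) : ℂ)) (𝓝[<] (0 : ℝ))
        (𝓝 (Complex.exp ((θm : ℂ) * Complex.I))) ∧
      Filter.Tendsto (fun t : ℝ => y t / ((‖y t‖ : ℝ) : ℂ)) (𝓝[>] (0 : ℝ))
        (𝓝 (Complex.exp ((θp : ℂ) * Complex.I))) ∧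
      (∃ C : ℝ, 0 < C ∧ ∃ δ₀ : ℝ, 0 < δ₀ ∧ δ₀ ≤ δ ∧
        ∀ t ∈ Set.Icc (-δ₀) δ₀, t ≠ 0 →
          |((starRingEnd ℂ) (y t) * deriv y t).im / ‖y t‖ ^ 2|
            ≤ C * |t| ^ (α / (2 + α))) ∧
      Filter.Tendsto (fun t : ℝ => ((starRingEnd ℂ) (y t) * deriv y t).im / ‖y t‖ ^ 2)
        (𝓝[≠] (0 : ℝ)) (𝓝 0) := by
  obtain ⟨A, B, D, hA, hB, hev⟩ :=
    nCenter_bounds_near_center ⟨0, hN⟩ hc_inj hm (zero_lt_one.trans_le hα1) hα2 hc1 h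
  have hα0 : 0 ≤ α := zero_le_one.trans hα1
  have hcont0 : Tendsto y (𝓝 0) (𝓝 0) := by
    have := hy_cont.continuousAt (Icc_mem_nhds (neg_lt_zero.2 hδ) hδ)
    rwa [ContinuousAt, hy0] at this
  obtain ⟨ε, hε, hball⟩ := Metric.eventually_nhds_iff.1 (hcont0.eventually hev)
  set δ₀ := min δ (ε / 2)
  have hδ₀ : 0 < δ₀ := lt_min hδ (half_pos hε)
  have hδ₀δ : δ₀ ≤ δ := min_le_left _ _
  have hmem : ∀ t, |t| ≤ δ₀ → t ∈ Set.Icc (-δ) δ := fun t ht => abs_le.1 (ht.trans hδ₀δ)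
  have hne : ∀ t, |t| ≤ δ₀ → t ≠ 0 → y t ≠ 0 := fun t ht h0 =>
    hc1 ▸ hy_ne t (hmem t ht) h0 ⟨0, hN⟩
  have hbd : ∀ t, |t| ≤ δ₀ → t ≠ 0 → ∀ v : ℂ, ‖v‖ = ‖deriv y t‖ →
      |(conj (y t) * deriv (deriv y) t).im| ≤ A * ‖y t‖ ∧
      B * ‖y t‖ ^ (-α) ≤ ‖v‖ ^ 2 + (conj (y t) * deriv (deriv y) t).re ∧
      (conj (y t) * v).im ^ 2 ≤ D * ‖y t‖ ^ (2 - α) := by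
    intro t ht h0 v hv
    have hdist : dist t 0 < ε := by
      rw [Real.dist_0_eq_abs]
      linarith [min_le_right δ (ε / 2)]
    exact hball hdist (hne t ht h0) v _ (hy_eq t (hmem t ht) h0)
      (by rw [hv]; exact hy_energy t (hmem t ht) h0)
  have habs : ∀ t ∈ Set.Ioc 0 δ₀, |t| ≤ δ₀ := fun t ht => by rw [abs_of_pos ht.1]; exact ht.2
  have habs' : ∀ t ∈ Set.Ioc 0 δ₀, |(-t)| ≤ δ₀ := fun t ht => by rw [abs_neg]; exact habs t ht
  obtain ⟨⟨θp, hθp⟩, hp⟩ := collision_direction_and_angular_velocity hα0 hα2 hδ₀ hA hB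
    (y := y) (v := deriv y) (a := deriv (deriv y)) (D := D)
    (hy_cont.mono (Set.Icc_subset_Icc (neg_nonpos.2 hδ.le) hδ₀δ)) hy0
    (fun t ht => hne t (habs t ht) ht.1.ne')
    (fun t ht => (hy_d1 t (hmem t (habs t ht)) ht.1.ne').hasDerivAt)
    (fun t ht => (hy_d2 t (hmem t (habs t ht)) ht.1.ne').hasDerivAt)
    (fun t ht => hbd t (habs t ht) ht.1.ne' _ rfl)
  obtain ⟨⟨θm, hθm⟩, hn⟩ := collision_direction_and_angular_velocity hα0 hα2 hδ₀ hA hB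
    (y := fun t => y (-t)) (v := fun t => -deriv y (-t)) (a := fun t => deriv (deriv y) (-t))
    (D := D)
    (hy_cont.comp continuousOn_neg fun t ht =>
      ⟨neg_le_neg (ht.2.trans hδ₀δ), (neg_nonpos.2 ht.1).trans hδ.le⟩)
    (by simpa using hy0)
    (fun t ht => hne (-t) (habs' t ht) (neg_ne_zero.2 ht.1.ne'))
    (fun t ht => ((hy_d1 (-t) (hmem _ (habs' t ht))
      (neg_ne_zero.2 ht.1.ne')).hasDerivAt.scomp t (hasDerivAt_neg t)).congr_deriv (by simp))
    (fun t ht => ((hy_d2 (-t) (hmem _ (habs' t ht))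
      (neg_ne_zero.2 ht.1.ne')).hasDerivAt.scomp t (hasDerivAt_neg t)).neg.congr_deriv (by simp))
    (fun t ht => hbd (-t) (habs' t ht) (neg_ne_zero.2 ht.1.ne') _ (norm_neg _))
  set C := A * B ^ (-(1 / (2 + α)))
  have hC : 0 ≤ C := by positivity
  have hbound : ∀ t ∈ Set.Icc (-δ₀) δ₀, t ≠ 0 →
      |(conj (y t) * deriv y t).im / ‖y t‖ ^ 2| ≤ (C + 1) * |t| ^ (α / (2 + α)) := by
    intro t ht h0
    refine le_trans ?_ (mul_le_mul_of_nonneg_right (lt_add_one C).le (by positivity))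
    rcases lt_or_gt_of_ne h0 with hlt | hgt
    · rw [abs_of_neg hlt]
      simpa only [neg_neg, mul_neg, Complex.neg_im, neg_div, abs_neg] using
        hn (-t) ⟨neg_pos.2 hlt, neg_le.1 ht.1⟩
    · rw [abs_of_pos hgt]
      exact hp t ⟨hgt, ht.2⟩
  refine ⟨θm, θp, ?_, hθp, ⟨C + 1, by positivity, δ₀, hδ₀, hδ₀δ, hbound⟩, ?_⟩
  · have hneg : Tendsto (fun t : ℝ => -t) (𝓝[<] 0) (𝓝[>] 0) := by
      simpa using tendsto_neg_nhdsLT (a := (0 : ℝ))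
    simpa [Function.comp_def] using hθm.comp hneg
  · have hexp : 0 < α / (2 + α) := by positivity
    have hlim : Tendsto (fun t : ℝ => (C + 1) * |t| ^ (α / (2 + α))) (𝓝[≠] 0) (𝓝 0) := by
      have hct : Continuous fun t : ℝ => (C + 1) * |t| ^ (α / (2 + α)) :=
        continuous_const.mul (continuous_abs.rpow_const fun _ => Or.inr hexp.le)
      have := (hct.tendsto 0).mono_left (nhdsWithin_le_nhds (s := {0}ᶜ))
      simpa [Real.zero_rpow hexp.ne'] using this
    refine squeeze_zero_norm' ?_ hlim
    filter_upwards [self_mem_nhdsWithin,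
      mem_nhdsWithin_of_mem_nhds (Icc_mem_nhds (neg_lt_zero.2 hδ₀) hδ₀)] with t h0 ht
    exact hbound t ht h0
end

section
/- Blow-up convergence to the parabolic collision-ejection solution: let y be an isolated collision solution at the origin, let θ₋, θ₊ ∈ ℝ satisfy y(t)/|y(t)| → e^{iθ∓} as t → 0∓, set μ = (α+2)·√(m₁/(2α)), and define ȳ(t) = (μ|t|)^{2/(α+2)} e^{iθ₊} for t ≥ 0 and ȳ(t) = (μ|t|)^{2/(α+2)} e^{iθ₋} for t ≤ 0. For λ > 0 define the blow-up y_λ(t) = λ^{−2/(2+α)} y(λ t). Then for every T > 0 there is a sequence λ_n → 0⁺ such that y_{λ_n} converges uniformly to ȳ on [−T, T], and the derivatives ẏ_{λ_n} converge uniformly to ȳ' on every compact subset of [−T, T] \ {0}. -/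
open Filter Topology

/-- A function with positive derivative to the right of `0` is strictly increasing there. -/
theorem exists_strictMonoOn_Ioo_of_hasDerivAt_pos {f f' : ℝ → ℝ}
    (hf : ∀ᶠ t in 𝓝[>] (0 : ℝ), HasDerivAt f (f' t) t) (hf' : ∀ᶠ t in 𝓝[>] (0 : ℝ), 0 < f' t) :
    ∃ ε > 0, StrictMonoOn f (Set.Ioo 0 ε) := by
  obtain ⟨ε, hε, h⟩ := mem_nhdsGT_iff_exists_Ioo_subset.1 (hf.and hf')
  refine ⟨ε, hε, strictMonoOn_of_deriv_pos (convex_Ioo 0 ε)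
    (fun t ht => (h ht).1.continuousAt.continuousWithinAt) fun t ht => ?_⟩
  rw [interior_Ioo] at ht
  rw [(h ht).1.deriv]
  exact (h ht).2

/-- A function with positive derivative to the right of `0` and right limit `0` is positive there. -/
theorem eventually_pos_of_hasDerivAt_pos {f f' : ℝ → ℝ}
    (hf : ∀ᶠ t in 𝓝[>] (0 : ℝ), HasDerivAt f (f' t) t) (hf' : ∀ᶠ t in 𝓝[>] (0 : ℝ), 0 < f' t)
    (h0 : Tendsto f (𝓝[>] 0) (𝓝 0)) : ∀ᶠ t in 𝓝[>] (0 : ℝ), 0 < f t := by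
  obtain ⟨ε, hε, hmono⟩ := exists_strictMonoOn_Ioo_of_hasDerivAt_pos hf hf'
  filter_upwards [Ioo_mem_nhdsGT hε] with t ht
  have ht2 : t / 2 ∈ Set.Ioo 0 ε := ⟨by linarith [ht.1], by linarith [ht.1, ht.2]⟩
  have hle : 0 ≤ f (t / 2) := by
    refine le_of_tendsto h0 ?_
    filter_upwards [Ioo_mem_nhdsGT ht2.1] with s hs
    exact (hmono ⟨hs.1, hs.2.trans ht2.2⟩ ht2 hs.2).le
  exact hle.trans_lt (hmono ht2 ht (by linarith [ht.1]))

/-- If the derivative of `g` is bounded by an increasing function `f` to the right of `0` and `g`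
has right limit `0`, then `|g t| ≤ f t * t`. -/
theorem eventually_abs_le_mul_of_hasDerivAt {f g g' : ℝ → ℝ} {ε : ℝ} (hε : 0 < ε)
    (hmono : MonotoneOn f (Set.Ioo 0 ε))
    (hg : ∀ᶠ t in 𝓝[>] (0 : ℝ), HasDerivAt g (g' t) t) (hg' : ∀ᶠ t in 𝓝[>] (0 : ℝ), |g' t| ≤ f t)
    (h0 : Tendsto g (𝓝[>] 0) (𝓝 0)) : ∀ᶠ t in 𝓝[>] (0 : ℝ), |g t| ≤ f t * t := by
  obtain ⟨ε', hε', h⟩ := mem_nhdsGT_iff_exists_Ioo_subset.1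
    ((hg.and hg').and (Ioo_mem_nhdsGT hε))
  filter_upwards [Ioo_mem_nhdsGT hε'] with t ht
  have hlim : Tendsto (fun s => |g t - g s|) (𝓝[>] 0) (𝓝 |g t - 0|) :=
    (tendsto_const_nhds.sub h0).abs
  rw [sub_zero] at hlim
  refine le_of_tendsto hlim ?_
  filter_upwards [Ioo_mem_nhdsGT ht.1] with s hs
  have hsub : ∀ x ∈ Set.Icc s t, x ∈ Set.Ioo 0 ε' := fun x hx =>
    ⟨hs.1.trans_le hx.1, hx.2.trans_lt ht.2⟩
  have hft : 0 ≤ f t := (abs_nonneg _).trans (h ht).1.2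
  have key := Convex.norm_image_sub_le_of_norm_hasDerivWithin_le (f := g) (f' := g') (C := f t)
    (fun x hx => (h (hsub x hx)).1.1.hasDerivWithinAt)
    (fun x hx => (h (hsub x hx)).1.2.trans (hmono (h (hsub x hx)).2 (h ht).2 hx.2))
    (convex_Icc s t) (Set.left_mem_Icc.2 hs.2.le) (Set.right_mem_Icc.2 hs.2.le)
  rw [Real.norm_eq_abs, Real.norm_eq_abs, abs_of_pos (sub_pos.2 hs.2)] at key
  exact key.trans (mul_le_mul_of_nonneg_left (by linarith [hs.1]) hft)

/-- A right-hand solution `z` with velocity `v` of a perturbed attractive `α`-homogeneous Kepler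
problem, with bounded force perturbation `F` and bounded energy perturbation `W`, which collides
with the origin at time `0`. -/
structure PerturbedCollision (m α B : ℝ) (z v F : ℝ → ℂ) (W : ℝ → ℝ) : Prop where
  hasDerivAt_pos : ∀ᶠ t in 𝓝[>] (0 : ℝ), HasDerivAt z (v t) t
  hasDerivAt_vel : ∀ᶠ t in 𝓝[>] (0 : ℝ),
    HasDerivAt v (-((m : ℂ) * z t / ((‖z t‖ ^ (α + 2) : ℝ) : ℂ)) + F t) t
  force_le : ∀ᶠ t in 𝓝[>] (0 : ℝ), ‖F t‖ ≤ B
  energy : ∀ᶠ t in 𝓝[>] (0 : ℝ), ‖v t‖ ^ 2 = 2 * (m / (α * ‖z t‖ ^ α) + W t)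
  energy_le : ∀ᶠ t in 𝓝[>] (0 : ℝ), |W t| ≤ B
  ne_zero : ∀ᶠ t in 𝓝[>] (0 : ℝ), z t ≠ 0
  tendsto_zero : Tendsto z (𝓝[>] 0) (𝓝 0)

namespace PerturbedCollision

variable {m α B : ℝ} {z v F : ℝ → ℂ} {W : ℝ → ℝ}

theorem bound_nonneg (H : PerturbedCollision m α B z v F W) : 0 ≤ B := by
  obtain ⟨t, ht⟩ := H.energy_le.exists
  exact (abs_nonneg _).trans ht

theorem tendsto_norm (H : PerturbedCollision m α B z v F W) :
    Tendsto (fun t => ‖z t‖) (𝓝[>] 0) (𝓝 0) := by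
  simpa using H.tendsto_zero.norm

theorem tendsto_norm_rpow (H : PerturbedCollision m α B z v F W) {p : ℝ} (hp : 0 < p) :
    Tendsto (fun t => ‖z t‖ ^ p) (𝓝[>] 0) (𝓝 0) := by
  simpa [Real.zero_rpow hp.ne'] using H.tendsto_norm.rpow_const (Or.inr hp.le)

/-- Multiplying the squared velocity by `‖z‖ ^ α` gives the limit `2 m / α`. -/
theorem tendsto_norm_vel_sq_mul (H : PerturbedCollision m α B z v F W) (hα : 0 < α) :
    Tendsto (fun t => ‖v t‖ ^ 2 * ‖z t‖ ^ α) (𝓝[>] 0) (𝓝 (2 * m / α)) := by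
  have hW : Tendsto (fun t => W t * ‖z t‖ ^ α) (𝓝[>] 0) (𝓝 0) := by
    have hb : IsBoundedUnder (· ≤ ·) (𝓝[>] (0 : ℝ)) (norm ∘ W) := ⟨B, H.energy_le⟩
    simpa [mul_comm] using (H.tendsto_norm_rpow hα).zero_mul_isBoundedUnder_le hb
  have h2 : Tendsto (fun t => 2 * m / α + 2 * (W t * ‖z t‖ ^ α)) (𝓝[>] 0)
      (𝓝 (2 * m / α + 2 * 0)) := tendsto_const_nhds.add (hW.const_mul 2)
  rw [mul_zero, add_zero] at h2
  refine h2.congr' ?_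
  filter_upwards [H.energy, H.ne_zero] with t hE hz
  have hr : 0 < ‖z t‖ ^ α := Real.rpow_pos_of_pos (norm_pos_iff.2 hz) _
  rw [hE]
  field_simp

theorem hasDerivAt_conj_mul (H : PerturbedCollision m α B z v F W) :
    ∀ᶠ t in 𝓝[>] (0 : ℝ), HasDerivAt (fun s => star (z s) * v s)
      (((‖v t‖ ^ 2 - m / ‖z t‖ ^ α : ℝ) : ℂ) + star (z t) * F t) t := by
  filter_upwards [H.hasDerivAt_pos, H.hasDerivAt_vel, H.ne_zero] with t h1 h2 hz
  have hr : 0 < ‖z t‖ := norm_pos_iff.2 hz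
  have hra : 0 < ‖z t‖ ^ α := Real.rpow_pos_of_pos hr _
  refine (h1.star.mul h2).congr_deriv ?_
  have e1 : star (v t) * v t = ((‖v t‖ ^ 2 : ℝ) : ℂ) := by
    rw [mul_comm]; exact_mod_cast Complex.mul_conj' (v t)
  have e2 : star (z t) * z t = ((‖z t‖ ^ 2 : ℝ) : ℂ) := by
    rw [mul_comm]; exact_mod_cast Complex.mul_conj' (z t)
  have e3 : star (z t) * ((m : ℂ) * z t / ((‖z t‖ ^ (α + 2) : ℝ) : ℂ)) =
      ((m / ‖z t‖ ^ α : ℝ) : ℂ) := by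
    rw [mul_div_assoc', mul_left_comm, e2, Real.rpow_add hr, Real.rpow_two]
    norm_cast
    field_simp
  rw [mul_add, mul_neg, e1, e3]
  push_cast
  ring

theorem norm_conj_mul_force_le (H : PerturbedCollision m α B z v F W) :
    ∀ᶠ t in 𝓝[>] (0 : ℝ), ‖star (z t) * F t‖ ≤ B * ‖z t‖ := by
  filter_upwards [H.force_le] with t hF
  rw [norm_mul, norm_star, mul_comm]
  gcongr

theorem tendsto_conj_mul (H : PerturbedCollision m α B z v F W) (hα : 0 < α) (hα2 : α < 2) :
    Tendsto (fun s => star (z s) * v s) (𝓝[>] 0) (𝓝 0) := by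
  rw [tendsto_zero_iff_norm_tendsto_zero]
  have h := ((H.tendsto_norm_vel_sq_mul hα).mul
    (H.tendsto_norm_rpow (p := 2 - α) (by linarith))).sqrt
  rw [mul_zero, Real.sqrt_zero] at h
  refine h.congr' ?_
  filter_upwards [H.ne_zero] with t hz
  have hr : 0 < ‖z t‖ := norm_pos_iff.2 hz
  rw [mul_assoc, ← Real.rpow_add hr, add_sub_cancel, Real.rpow_two, ← mul_pow,
    Real.sqrt_sq (by positivity), norm_mul, norm_star, mul_comm]

theorem eventually_re_conj_mul_pos (H : PerturbedCollision m α B z v F W) (hm : 0 < m)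
    (hα : 0 < α) (hα2 : α < 2) :
    ∀ᶠ t in 𝓝[>] (0 : ℝ), 0 < (star (z t) * v t).re := by
  have hd : ∀ᶠ t in 𝓝[>] (0 : ℝ), HasDerivAt (fun s => (star (z s) * v s).re)
      (‖v t‖ ^ 2 - m / ‖z t‖ ^ α + (star (z t) * F t).re) t := by
    filter_upwards [H.hasDerivAt_conj_mul] with t ht
    have := Complex.reCLM.hasFDerivAt.comp_hasDerivAt t ht
    simp only [Complex.reCLM_apply, Complex.add_re, Complex.ofReal_re] at this
    exact this
  refine eventually_pos_of_hasDerivAt_pos hd ?_ ?_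
  · have h1 : Tendsto (fun t => ‖v t‖ ^ 2 * ‖z t‖ ^ α - m - B * ‖z t‖ * ‖z t‖ ^ α) (𝓝[>] 0)
        (𝓝 (2 * m / α - m - B * 0 * 0)) :=
      ((H.tendsto_norm_vel_sq_mul hα).sub_const m).sub
        ((H.tendsto_norm.const_mul B).mul (H.tendsto_norm_rpow hα))
    have hpos : 0 < 2 * m / α - m - B * 0 * 0 := by
      have : m < 2 * m / α := by rw [lt_div_iff₀ hα]; nlinarith
      linarith
    filter_upwards [h1.eventually_const_lt hpos, H.norm_conj_mul_force_le, H.ne_zero]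
      with t ht hF hz
    have hra : 0 < ‖z t‖ ^ α := Real.rpow_pos_of_pos (norm_pos_iff.2 hz) _
    have h2 := (abs_le.1 ((Complex.abs_re_le_norm _).trans hF)).1
    have h3 : 0 < ‖v t‖ ^ 2 - m / ‖z t‖ ^ α - B * ‖z t‖ := by
      refine pos_of_mul_pos_left (b := ‖z t‖ ^ α) ?_ hra.le
      rw [sub_mul, sub_mul, div_mul_cancel₀ _ hra.ne']
      exact ht
    linarith
  · exact (Complex.continuous_re.tendsto 0).comp (H.tendsto_conj_mul hα hα2)

theorem hasDerivAt_norm_sq (H : PerturbedCollision m α B z v F W) :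
    ∀ᶠ t in 𝓝[>] (0 : ℝ), HasDerivAt (fun s => ‖z s‖ ^ 2) (2 * (star (z t) * v t).re) t := by
  filter_upwards [H.hasDerivAt_pos] with t ht
  convert ht.norm_sq using 2
  rw [Complex.inner, mul_comm]
  rfl

theorem exists_monotoneOn_norm (H : PerturbedCollision m α B z v F W) (hm : 0 < m)
    (hα : 0 < α) (hα2 : α < 2) : ∃ ε > 0, MonotoneOn (fun t => ‖z t‖) (Set.Ioo 0 ε) := by
  obtain ⟨ε, hε, h⟩ := exists_strictMonoOn_Ioo_of_hasDerivAt_pos H.hasDerivAt_norm_sq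
    ((H.eventually_re_conj_mul_pos hm hα hα2).mono fun t ht => by positivity)
  exact ⟨ε, hε, fun s hs t ht hst =>
    (sq_le_sq₀ (norm_nonneg _) (norm_nonneg _)).1 (h.monotoneOn hs ht hst)⟩

theorem abs_im_conj_mul_le (H : PerturbedCollision m α B z v F W) (hm : 0 < m)
    (hα : 0 < α) (hα2 : α < 2) :
    ∀ᶠ t in 𝓝[>] (0 : ℝ), |(star (z t) * v t).im| ≤ B * ‖z t‖ * t := by
  obtain ⟨ε, hε, hmono⟩ := H.exists_monotoneOn_norm hm hα hα2
  refine eventually_abs_le_mul_of_hasDerivAt (f := fun t => B * ‖z t‖)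
    (g' := fun t => (star (z t) * F t).im) hε
    (fun s hs t ht hst => mul_le_mul_of_nonneg_left (hmono hs ht hst) H.bound_nonneg) ?_ ?_ ?_
  · filter_upwards [H.hasDerivAt_conj_mul] with t ht
    have := Complex.imCLM.hasFDerivAt.comp_hasDerivAt t ht
    simp only [Complex.imCLM_apply, Complex.add_im, Complex.ofReal_im, zero_add] at this
    exact this
  · filter_upwards [H.norm_conj_mul_force_le] with t hF
    exact (Complex.abs_im_le_norm _).trans hF
  · exact (Complex.continuous_im.tendsto 0).comp (H.tendsto_conj_mul hα hα2)

/-- The angular momentum is negligible: the normalised tangential velocity tends to `0`. -/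
theorem tendsto_im_conj_mul (H : PerturbedCollision m α B z v F W) (hm : 0 < m)
    (hα : 0 < α) (hα2 : α < 2) :
    Tendsto (fun t => (star (z t) * v t).im * ‖z t‖ ^ (α / 2 - 1)) (𝓝[>] 0) (𝓝 0) := by
  have ht0 : Tendsto (fun t : ℝ => t) (𝓝[>] 0) (𝓝 0) := tendsto_nhdsWithin_of_tendsto_nhds tendsto_id
  have h : Tendsto (fun t => B * t * ‖z t‖ ^ (α / 2)) (𝓝[>] 0) (𝓝 (B * 0 * 0)) :=
    (ht0.const_mul B).mul (H.tendsto_norm_rpow (by linarith))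
  rw [mul_zero] at h
  refine squeeze_zero_norm' ?_ h
  filter_upwards [H.abs_im_conj_mul_le hm hα hα2, H.ne_zero] with t ht hz
  have hr : 0 < ‖z t‖ := norm_pos_iff.2 hz
  have hp : 0 < ‖z t‖ ^ (α / 2 - 1) := Real.rpow_pos_of_pos hr _
  rw [norm_mul, Real.norm_eq_abs, Real.norm_of_nonneg hp.le]
  calc _ ≤ B * ‖z t‖ * t * ‖z t‖ ^ (α / 2 - 1) := mul_le_mul_of_nonneg_right ht hp.le
    _ = B * t * (‖z t‖ ^ (α / 2 - 1) * ‖z t‖) := by ring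
    _ = _ := by rw [← Real.rpow_add_one hr.ne', sub_add_cancel]

/-- The normalised radial velocity tends to `√(2 m / α)`. -/
theorem tendsto_re_conj_mul (H : PerturbedCollision m α B z v F W) (hm : 0 < m)
    (hα : 0 < α) (hα2 : α < 2) :
    Tendsto (fun t => (star (z t) * v t).re * ‖z t‖ ^ (α / 2 - 1)) (𝓝[>] 0)
      (𝓝 √(2 * m / α)) := by
  have h := ((H.tendsto_norm_vel_sq_mul hα).sub
    ((H.tendsto_im_conj_mul hm hα hα2).pow 2)).sqrt
  rw [zero_pow two_ne_zero, sub_zero] at h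
  refine h.congr' ?_
  filter_upwards [H.eventually_re_conj_mul_pos hm hα hα2, H.ne_zero] with t ht hz
  have hr : 0 < ‖z t‖ := norm_pos_iff.2 hz
  have hp : 0 < ‖z t‖ ^ (α / 2 - 1) := Real.rpow_pos_of_pos hr _
  have e1 : (star (z t) * v t).re ^ 2 + (star (z t) * v t).im ^ 2 = ‖z t‖ ^ 2 * ‖v t‖ ^ 2 := by
    rw [← mul_pow, ← norm_star (z t), ← norm_mul, Complex.sq_norm, Complex.normSq_apply]
    ring
  have e2 : ‖z t‖ ^ α = ‖z t‖ ^ 2 * (‖z t‖ ^ (α / 2 - 1)) ^ 2 := by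
    rw [← mul_pow, mul_comm, ← Real.rpow_add_one hr.ne', sub_add_cancel, ← Real.rpow_mul_natCast hr.le]
    norm_num
  rw [← Real.sqrt_sq (mul_pos ht hp).le, e2]
  congr 1
  linear_combination (-(‖z t‖ ^ (α / 2 - 1)) ^ 2) * e1

/-- The normalised velocity tends to `√(2 m / α)` times the limiting direction. -/
theorem tendsto_vel_mul_norm_rpow (H : PerturbedCollision m α B z v F W) (hm : 0 < m)
    (hα : 0 < α) (hα2 : α < 2) {u : ℂ}
    (hu : Tendsto (fun t => z t / (‖z t‖ : ℂ)) (𝓝[>] 0) (𝓝 u)) :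
    Tendsto (fun t => v t * ((‖z t‖ ^ (α / 2) : ℝ) : ℂ)) (𝓝[>] 0)
      (𝓝 (u * (√(2 * m / α) : ℝ))) := by
  have h := hu.mul ((((Complex.continuous_ofReal.tendsto _).comp
    (H.tendsto_re_conj_mul hm hα hα2))).add (((Complex.continuous_ofReal.tendsto _).comp
    (H.tendsto_im_conj_mul hm hα hα2)).mul_const Complex.I))
  rw [Complex.ofReal_zero, zero_mul, add_zero] at h
  refine h.congr' ?_
  filter_upwards [H.ne_zero] with t hz
  have hr : 0 < ‖z t‖ := norm_pos_iff.2 hz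
  have hr' : (‖z t‖ : ℂ) ≠ 0 := by exact_mod_cast hr.ne'
  have e2 : z t * star (z t) = (‖z t‖ : ℂ) ^ 2 := Complex.mul_conj' (z t)
  have e3 : ‖z t‖ ^ (α / 2) = ‖z t‖ ^ (α / 2 - 1) * ‖z t‖ := by
    rw [← Real.rpow_add_one hr.ne', sub_add_cancel]
  have e4 := Complex.re_add_im (star (z t) * v t)
  simp only [Function.comp_apply]
  rw [e3]
  push_cast
  rw [mul_right_comm, ← add_mul, e4]
  generalize ((‖z t‖ ^ (α / 2 - 1) : ℝ) : ℂ) = p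
  field_simp
  linear_combination (v t) * p * e2

/-- The `(α + 2) / 2` power of the distance to the collision grows linearly. -/
theorem tendsto_norm_rpow_div (H : PerturbedCollision m α B z v F W) (hm : 0 < m)
    (hα : 0 < α) (hα2 : α < 2) :
    Tendsto (fun t => ‖z t‖ ^ ((α + 2) / 2) / t) (𝓝[>] 0)
      (𝓝 ((α + 2) / 2 * √(2 * m / α))) := by
  refine HasDerivAt.lhopital_zero_nhdsGT
    (f' := fun t => (α + 2) / 2 * ((star (z t) * v t).re * ‖z t‖ ^ (α / 2 - 1)))
    (g' := fun _ => 1) ?_ (Eventually.of_forall fun t => hasDerivAt_id t)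
    (Eventually.of_forall fun t => one_ne_zero) (H.tendsto_norm_rpow (by linarith))
    (tendsto_nhdsWithin_of_tendsto_nhds tendsto_id) ?_
  · filter_upwards [H.hasDerivAt_norm_sq, H.ne_zero] with t ht hz
    have hr : 0 < ‖z t‖ := norm_pos_iff.2 hz
    have h := ht.rpow_const (p := (α + 2) / 4) (Or.inl (by positivity))
    have e1 : ∀ (x : ℝ) (p : ℝ), 0 ≤ x → (x ^ 2) ^ p = x ^ (2 * p) := fun x p hx => by
      rw [Real.rpow_mul hx, Real.rpow_two]
    simp only [e1 _ _ (norm_nonneg _)] at h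
    convert h using 1
    · ext s
      congr 1
      ring
    · rw [show 2 * ((α + 2) / 4 - 1) = α / 2 - 1 by ring]
      ring
  · simpa using (H.tendsto_re_conj_mul hm hα hα2).const_mul ((α + 2) / 2)

theorem tendsto_norm_div_rpow (H : PerturbedCollision m α B z v F W) (hm : 0 < m)
    (hα : 0 < α) (hα2 : α < 2) {μ : ℝ} (hμ : μ = (α + 2) / 2 * √(2 * m / α)) :
    Tendsto (fun t => ‖z t‖ / t ^ (2 / (α + 2))) (𝓝[>] 0) (𝓝 (μ ^ (2 / (α + 2)))) := by
  have hμ0 : 0 < μ := by rw [hμ]; positivity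
  have h := (hμ ▸ H.tendsto_norm_rpow_div hm hα hα2).rpow_const (p := 2 / (α + 2))
    (Or.inl hμ0.ne')
  refine h.congr' ?_
  filter_upwards [self_mem_nhdsWithin] with t ht
  rw [Real.div_rpow (by positivity) (le_of_lt ht), ← Real.rpow_mul (norm_nonneg _),
    show (α + 2) / 2 * (2 / (α + 2)) = 1 by field_simp, Real.rpow_one]

/-- Sundman's asymptotic estimate for the position at a collision. -/
theorem tendsto_div_rpow (H : PerturbedCollision m α B z v F W) (hm : 0 < m)
    (hα : 0 < α) (hα2 : α < 2) {μ : ℝ} (hμ : μ = (α + 2) / 2 * √(2 * m / α)) {u : ℂ}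
    (hu : Tendsto (fun t => z t / (‖z t‖ : ℂ)) (𝓝[>] 0) (𝓝 u)) :
    Tendsto (fun t => z t / ((t ^ (2 / (α + 2)) : ℝ) : ℂ)) (𝓝[>] 0)
      (𝓝 (((μ ^ (2 / (α + 2)) : ℝ) : ℂ) * u)) := by
  refine (((Complex.continuous_ofReal.tendsto _).comp
    (H.tendsto_norm_div_rpow hm hα hα2 hμ)).mul hu).congr' ?_
  filter_upwards [H.ne_zero] with t hz
  have hr : (‖z t‖ : ℂ) ≠ 0 := by exact_mod_cast (norm_pos_iff.2 hz).ne'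
  simp only [Function.comp_apply]
  push_cast
  field_simp

/-- Sundman's asymptotic estimate for the velocity at a collision. -/
theorem tendsto_vel_div_rpow (H : PerturbedCollision m α B z v F W) (hm : 0 < m)
    (hα : 0 < α) (hα2 : α < 2) {μ : ℝ} (hμ : μ = (α + 2) / 2 * √(2 * m / α)) {u : ℂ}
    (hu : Tendsto (fun t => z t / (‖z t‖ : ℂ)) (𝓝[>] 0) (𝓝 u)) :
    Tendsto (fun t => v t / ((t ^ (2 / (α + 2) - 1) : ℝ) : ℂ)) (𝓝[>] 0)
      (𝓝 (((2 / (α + 2) : ℝ) : ℂ) * (((μ ^ (2 / (α + 2)) : ℝ) : ℂ) * u))) := by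
  have hμ0 : 0 < μ := by rw [hμ]; positivity
  have hα0 : α + 2 ≠ 0 := by positivity
  have he : 2 / (α + 2) * (-(α / 2)) = 2 / (α + 2) - 1 := by field_simp; ring
  have hκ : √(2 * m / α) = 2 / (α + 2) * μ := by rw [hμ]; field_simp
  have h1 := (H.tendsto_norm_div_rpow hm hα hα2 hμ).rpow_const (p := -(α / 2))
    (Or.inl (Real.rpow_pos_of_pos hμ0 _).ne')
  rw [← Real.rpow_mul hμ0.le, he] at h1
  have h2 := (H.tendsto_vel_mul_norm_rpow hm hα hα2 hu).mul
    ((Complex.continuous_ofReal.tendsto _).comp h1)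
  convert h2.congr' ?_ using 2
  · rw [hκ, mul_assoc u, ← Complex.ofReal_mul, mul_assoc _ μ, mul_comm μ,
      ← Real.rpow_add_one hμ0.ne', sub_add_cancel]
    push_cast
    ring
  · filter_upwards [H.ne_zero, self_mem_nhdsWithin] with t hz ht
    have ht : 0 < t := ht
    have hr : 0 < ‖z t‖ := norm_pos_iff.2 hz
    have hra : ‖z t‖ ^ (α / 2) ≠ 0 := (Real.rpow_pos_of_pos hr _).ne'
    simp only [Function.comp_apply]
    rw [Real.div_rpow hr.le (by positivity), ← Real.rpow_mul ht.le, he, Real.rpow_neg hr.le,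
      mul_assoc, ← Complex.ofReal_mul, mul_div_assoc', mul_inv_cancel₀ hra, Complex.ofReal_div,
      Complex.ofReal_one, mul_one_div]

end PerturbedCollision

/-- Rescalings of a function asymptotic to `A * t ^ p` at `0⁺` converge uniformly to this power,
on bounded sets of positive numbers on which the power is bounded. -/
theorem tendstoUniformlyOn_rescale_of_tendsto_div_rpow {f : ℝ → ℂ} {p : ℝ} {A : ℂ}
    (h : Tendsto (fun t => f t / ((t ^ p : ℝ) : ℂ)) (𝓝[>] 0) (𝓝 A)) {lam : ℕ → ℝ}
    (hpos : ∀ n, 0 < lam n) (hlim : Tendsto lam atTop (𝓝 0)) {K : Set ℝ} {T M : ℝ}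
    (hK : ∀ t ∈ K, 0 < t ∧ t ≤ T) (hM : ∀ t ∈ K, t ^ p ≤ M) :
    TendstoUniformlyOn (fun n t => ((lam n ^ (-p) : ℝ) : ℂ) * f (lam n * t))
      (fun t => ((t ^ p : ℝ) : ℂ) * A) atTop K := by
  rw [Metric.tendstoUniformlyOn_iff]
  intro ε hε
  have hM0 : 0 < |M| + 1 := by positivity
  obtain ⟨η, hη, hsub⟩ := mem_nhdsGT_iff_exists_Ioo_subset.1
    (Metric.tendsto_nhds.1 h (ε / (|M| + 1)) (by positivity))
  have hT : Tendsto (fun n => lam n * T) atTop (𝓝 0) := by simpa using hlim.mul_const T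
  filter_upwards [hT.eventually_lt_const hη] with n hn t ht
  obtain ⟨ht0, htT⟩ := hK t ht
  have hs : 0 < lam n * t := mul_pos (hpos n) ht0
  have hd : dist (f (lam n * t) / (((lam n * t) ^ p : ℝ) : ℂ)) A < ε / (|M| + 1) :=
    hsub ⟨hs, (mul_le_mul_of_nonneg_left htT (hpos n).le).trans_lt hn⟩
  have hl : 0 < lam n ^ p := Real.rpow_pos_of_pos (hpos n) p
  have htp : 0 < t ^ p := Real.rpow_pos_of_pos ht0 p
  have hlC : ((lam n ^ p : ℝ) : ℂ) ≠ 0 := by exact_mod_cast hl.ne'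
  have htC : ((t ^ p : ℝ) : ℂ) ≠ 0 := by exact_mod_cast htp.ne'
  have e : ((lam n ^ (-p) : ℝ) : ℂ) * f (lam n * t) =
      ((t ^ p : ℝ) : ℂ) * (f (lam n * t) / (((lam n * t) ^ p : ℝ) : ℂ)) := by
    rw [Real.mul_rpow (hpos n).le ht0.le, Real.rpow_neg (hpos n).le]
    push_cast
    field_simp
  rw [e, dist_comm, dist_eq_norm, ← mul_sub, norm_mul, ← dist_eq_norm,
    Complex.norm_of_nonneg htp.le]
  calc _ ≤ (|M| + 1) * dist (f (lam n * t) / (((lam n * t) ^ p : ℝ) : ℂ)) A := by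
        gcongr
        linarith [hM t ht, le_abs_self M]
    _ < (|M| + 1) * (ε / (|M| + 1)) := mul_lt_mul_of_pos_left hd hM0
    _ = ε := by field_simp

/-- Near an isolated collision with the center `c i = 0`, an `N`-center solution run in the time
direction `σ = ±1` is a perturbed Kepler collision. -/
theorem exists_perturbedCollision_of_nCenter {ι : Type*} [Fintype ι] {c : ι → ℂ} {m : ι → ℝ}
    (hc_inj : Function.Injective c) {i : ι} (hci : c i = 0) {α : ℝ} {δ : ℝ} (hδ : 0 < δ)
    {y : ℝ → ℂ} (hy_cont : ContinuousOn y (Set.Icc (-δ) δ)) (hy0 : y 0 = 0)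
    (hy_ne : ∀ t ∈ Set.Icc (-δ) δ, t ≠ 0 → ∀ j, y t ≠ c j)
    (hy_d1 : ∀ t ∈ Set.Icc (-δ) δ, t ≠ 0 → DifferentiableAt ℝ y t)
    (hy_d2 : ∀ t ∈ Set.Icc (-δ) δ, t ≠ 0 → DifferentiableAt ℝ (deriv y) t)
    (hy_eq : ∀ t ∈ Set.Icc (-δ) δ, t ≠ 0 →
      deriv (deriv y) t = -∑ j, (m j : ℂ) * (y t - c j) / ((‖y t - c j‖ ^ (α + 2) : ℝ) : ℂ))
    {h : ℝ} (hy_energy : ∀ t ∈ Set.Icc (-δ) δ, t ≠ 0 →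
      (1 / 2) * ‖deriv y t‖ ^ 2 - ∑ j, m j / (α * ‖y t - c j‖ ^ α) = h)
    (hα : 0 < α) {σ : ℝ} (hσ : |σ| = 1) :
    ∃ B F W, PerturbedCollision (m i) α B (fun t => y (σ * t)) (fun t => σ • deriv y (σ * t))
      F W := by
  classical
  have hσ2 : σ * σ = 1 := by rw [← abs_mul_abs_self, hσ, one_mul]
  have hσ0 : σ ≠ 0 := by rintro rfl; simp at hσ
  have hmem : ∀ᶠ t in 𝓝[>] (0 : ℝ), σ * t ∈ Set.Icc (-δ) δ ∧ σ * t ≠ 0 := by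
    filter_upwards [Ioo_mem_nhdsGT hδ] with t ht
    refine ⟨abs_le.1 ?_, mul_ne_zero hσ0 ht.1.ne'⟩
    rw [abs_mul, hσ, one_mul, abs_of_pos ht.1]
    exact ht.2.le
  have hlim : Tendsto (fun t => y (σ * t)) (𝓝[>] 0) (𝓝 0) := by
    have h1 : ContinuousAt y (σ * 0) := by
      rw [mul_zero]
      exact hy_cont.continuousAt (Icc_mem_nhds (by linarith) hδ)
    have h2 : ContinuousAt (fun t => y (σ * t)) 0 :=
      ContinuousAt.comp (f := fun t => σ * t) h1 (by fun_prop)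
    have h3 : Tendsto (fun t => y (σ * t)) (𝓝 0) (𝓝 (y (σ * 0))) := h2
    rw [mul_zero, hy0] at h3
    exact h3.mono_left nhdsWithin_le_nhds
  have hcne : ∀ j ∈ Finset.univ.erase i, (0 : ℂ) - c j ≠ 0 := fun j hj => by
    rw [zero_sub, neg_ne_zero, ← hci]
    exact fun hj' => Finset.ne_of_mem_erase hj (hc_inj hj')
  let F₀ : ℂ → ℂ := fun x => -∑ j ∈ Finset.univ.erase i,
    (m j : ℂ) * (x - c j) / ((‖x - c j‖ ^ (α + 2) : ℝ) : ℂ)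
  let W₀ : ℂ → ℝ := fun x => h + ∑ j ∈ Finset.univ.erase i, m j / (α * ‖x - c j‖ ^ α)
  have hpow : ∀ (p : ℝ), ∀ j ∈ Finset.univ.erase i,
      Tendsto (fun x : ℂ => ‖x - c j‖ ^ p) (𝓝 0) (𝓝 (‖0 - c j‖ ^ p)) := fun p j hj =>
    Tendsto.rpow_const ((tendsto_id.sub_const (c j)).norm) (Or.inl (norm_ne_zero_iff.2 (hcne j hj)))
  have hpow_ne : ∀ (p : ℝ), ∀ j ∈ Finset.univ.erase i, ‖0 - c j‖ ^ p ≠ 0 := fun p j hj =>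
    (Real.rpow_pos_of_pos (norm_pos_iff.2 (hcne j hj)) p).ne'
  have hF₀ : Tendsto F₀ (𝓝 0) (𝓝 (F₀ 0)) :=
    (tendsto_finsetSum _ fun j hj => Tendsto.div ((tendsto_id.sub_const (c j)).const_mul _)
      ((Complex.continuous_ofReal.tendsto _).comp (hpow _ j hj))
      (by exact_mod_cast hpow_ne _ j hj)).neg
  have hW₀ : Tendsto W₀ (𝓝 0) (𝓝 (W₀ 0)) :=
    (tendsto_finsetSum _ fun j hj => Tendsto.div tendsto_const_nhds ((hpow _ j hj).const_mul α)
      (mul_ne_zero hα.ne' (hpow_ne _ j hj))).const_add h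
  obtain ⟨B₁, hB₁⟩ := (hF₀.comp hlim).norm.isBoundedUnder_le
  obtain ⟨B₂, hB₂⟩ := (hW₀.comp hlim).norm.isBoundedUnder_le
  rw [eventually_map] at hB₁ hB₂
  refine ⟨max B₁ B₂, fun t => F₀ (y (σ * t)), fun t => W₀ (y (σ * t)), ⟨?_, ?_,
    hB₁.mono fun t ht => ht.trans (le_max_left _ _), ?_,
    hB₂.mono fun t ht => ht.trans (le_max_right _ _), ?_, hlim⟩⟩
  · filter_upwards [hmem] with t ht
    have hd : HasDerivAt (fun s => σ * s) σ t := by simpa using (hasDerivAt_id t).const_mul σ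
    exact (hy_d1 _ ht.1 ht.2).hasDerivAt.scomp t hd
  · filter_upwards [hmem] with t ht
    have hd : HasDerivAt (fun s => σ * s) σ t := by simpa using (hasDerivAt_id t).const_mul σ
    refine (((hy_d2 _ ht.1 ht.2).hasDerivAt.scomp t hd).const_smul σ).congr_deriv ?_
    rw [smul_smul, hσ2, one_smul, hy_eq _ ht.1 ht.2,
      ← Finset.add_sum_erase Finset.univ _ (Finset.mem_univ i), hci, sub_zero, neg_add]
  · filter_upwards [hmem] with t ht
    have hE := hy_energy _ ht.1 ht.2
    rw [← Finset.add_sum_erase Finset.univ _ (Finset.mem_univ i), hci, sub_zero] at hE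
    rw [norm_smul, Real.norm_eq_abs, hσ, one_mul]
    simp only [W₀]
    linarith
  · filter_upwards [hmem] with t ht
    rw [← hci]
    exact hy_ne _ ht.1 ht.2 i

/-- Derivative of a function which on the side of `σ = ±1` is the power `A * |t| ^ p`. -/
theorem deriv_of_eq_rpow_mul {f : ℝ → ℂ} {p σ : ℝ} {A : ℂ} (hσ : σ * σ = 1)
    (hf : ∀ t, 0 < t → f (σ * t) = ((t ^ p : ℝ) : ℂ) * A) {t : ℝ} (ht : 0 < t) :
    deriv f (σ * t) = ((t ^ (p - 1) : ℝ) : ℂ) * (σ * (p * A)) := by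
  have ht' : σ * (σ * t) = t := by rw [← mul_assoc, hσ, one_mul]
  have hd : HasDerivAt (fun s => σ * s) σ (σ * t) := by
    simpa using (hasDerivAt_id (σ * t)).const_mul σ
  have h1 := ((hd.rpow_const (p := p) (Or.inl (by rw [ht']; exact ht.ne'))).ofReal_comp).mul_const A
  have h2 : f =ᶠ[𝓝 (σ * t)] fun s => (((σ * s) ^ p : ℝ) : ℂ) * A := by
    have hpos : ∀ᶠ s in 𝓝 (σ * t), 0 < σ * s := by
      refine (continuous_const_mul σ).continuousAt.eventually_const_lt ?_
      simp only [ht']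
      exact ht
    filter_upwards [hpos] with s hs
    rw [← hf _ hs, ← mul_assoc, hσ, one_mul]
  rw [(h1.congr_of_eventuallyEq h2).deriv, ht']
  push_cast
  ring

/-- One-sided blow-up convergence of a function with power asymptotics. -/
theorem tendstoUniformlyOn_blowup_of_asymptotics {y ybar : ℝ → ℂ} {p σ : ℝ} {A : ℂ} (hp : 0 < p)
    (hσ : σ * σ = 1) (hybar : ∀ t, 0 < t → ybar (σ * t) = ((t ^ p : ℝ) : ℂ) * A)
    (hpos : Tendsto (fun t => y (σ * t) / ((t ^ p : ℝ) : ℂ)) (𝓝[>] 0) (𝓝 A))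
    (hvel : Tendsto (fun t => (σ • deriv y (σ * t)) / ((t ^ (p - 1) : ℝ) : ℂ)) (𝓝[>] 0)
      (𝓝 ((p : ℂ) * A))) {lam : ℕ → ℝ} (hlam : ∀ n, 0 < lam n) (hlim : Tendsto lam atTop (𝓝 0))
    (T : ℝ) :
    TendstoUniformlyOn (fun n t => ((lam n ^ (-p) : ℝ) : ℂ) * y (lam n * t)) ybar atTop
      ((σ * ·) ⁻¹' Set.Ioc 0 T) ∧
    ∀ K ⊆ Set.Ioc 0 T, IsCompact K →
      TendstoUniformlyOn
        (fun n t => deriv (fun s => ((lam n ^ (-p) : ℝ) : ℂ) * y (lam n * s)) t)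
        (deriv ybar) atTop ((σ * ·) ⁻¹' K) := by
  have hσσ : ∀ t, σ * (σ * t) = t := fun t => by rw [← mul_assoc, hσ, one_mul]
  constructor
  · have h := tendstoUniformlyOn_rescale_of_tendsto_div_rpow hpos hlam hlim (K := Set.Ioc 0 T)
      (fun t ht => ht) (fun t ht => Real.rpow_le_rpow ht.1.le ht.2 hp.le)
    refine ((h.comp (σ * ·)).congr (Eventually.of_forall fun n t _ => ?_)).congr_right
      fun t ht => ?_
    · simp only [Function.comp_apply]
      rw [mul_left_comm σ, hσσ]
    · simp only [Function.comp_apply]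
      rw [← hybar _ ht.1, hσσ]
  · intro K hKT hK
    have hvel' : Tendsto (fun t => deriv y (σ * t) / ((t ^ (p - 1) : ℝ) : ℂ)) (𝓝[>] 0)
        (𝓝 (σ * (p * A))) := by
      refine (hvel.const_mul (σ : ℂ)).congr fun t => ?_
      rw [Complex.real_smul, mul_div_assoc', ← mul_assoc, ← Complex.ofReal_mul, hσ,
        Complex.ofReal_one, one_mul]
    have hcont : ContinuousOn (fun t : ℝ => t ^ (p - 1)) K := fun t ht =>
      (Real.continuousAt_rpow_const t (p - 1) (Or.inl (hKT ht).1.ne')).continuousWithinAt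
    obtain ⟨M, hM⟩ := hK.exists_bound_of_continuousOn hcont
    have h := tendstoUniformlyOn_rescale_of_tendsto_div_rpow hvel' hlam hlim (K := K)
      (fun t ht => hKT ht) (fun t ht => (le_abs_self _).trans (hM t ht))
    refine ((h.comp (σ * ·)).congr (Eventually.of_forall fun n t _ => ?_)).congr_right
      fun t ht => ?_
    · simp only [Function.comp_apply]
      rw [mul_left_comm σ, hσσ, deriv_const_mul_field, deriv_comp_mul_left, Complex.real_smul,
        ← mul_assoc, ← Complex.ofReal_mul, ← Real.rpow_add_one (hlam n).ne']
      congr 3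
      ring
    · simp only [Function.comp_apply]
      rw [← deriv_of_eq_rpow_mul hσ hybar (hKT ht).1, hσσ]

theorem TendstoUniformlyOn.union_of_subset {ι X Y : Type*} [UniformSpace Y] {F : ι → X → Y}
    {f : X → Y} {l : Filter ι} {s t r : Set X} (hs : TendstoUniformlyOn F f l s)
    (ht : TendstoUniformlyOn F f l t) (hr : r ⊆ s ∪ t) : TendstoUniformlyOn F f l r := by
  intro V hV
  filter_upwards [hs V hV, ht V hV] with n h1 h2 x hx
  exact (hr hx).elim (h1 x) (h2 x)



/-- blow-up convergence to the parabolic collision-ejection solution. -/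
theorem stmt_9
    (N : ℕ) (hN : 0 < N) (c : Fin N → ℂ) (m : Fin N → ℝ)
    (hc_inj : Function.Injective c) (hm : ∀ j, 0 < m j)
    (α : ℝ) (hα1 : 1 ≤ α) (hα2 : α < 2)
    (hc1 : c ⟨0, hN⟩ = 0)
    (δ : ℝ) (hδ : 0 < δ) (y : ℝ → ℂ)
    (hy_cont : ContinuousOn y (Set.Icc (-δ) δ))
    (hy0 : y 0 = 0)
    (hy_ne : ∀ t ∈ Set.Icc (-δ) δ, t ≠ 0 → ∀ j, y t ≠ c j)
    (hy_d1 : ∀ t ∈ Set.Icc (-δ) δ, t ≠ 0 → DifferentiableAt ℝ y t)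
    (hy_d2 : ∀ t ∈ Set.Icc (-δ) δ, t ≠ 0 → DifferentiableAt ℝ (deriv y) t)
    (hy_eq : ∀ t ∈ Set.Icc (-δ) δ, t ≠ 0 →
      deriv (deriv y) t = -∑ j, (m j : ℂ) * (y t - c j) / ((‖y t - c j‖ ^ (α + 2) : ℝ) : ℂ))
    (h : ℝ)
    (hy_energy : ∀ t ∈ Set.Icc (-δ) δ, t ≠ 0 →
      (1 / 2) * ‖deriv y t‖ ^ 2 - ∑ j, m j / (α * ‖y t - c j‖ ^ α) = h)
    (θm θp : ℝ)
    (hθm : Filter.Tendsto (fun t : ℝ => y t / ((‖y t‖ : ℝ) : ℂ)) (𝓝[<] (0 : ℝ))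
      (𝓝 (Complex.exp ((θm : ℂ) * Complex.I))))
    (hθp : Filter.Tendsto (fun t : ℝ => y t / ((‖y t‖ : ℝ) : ℂ)) (𝓝[>] (0 : ℝ))
      (𝓝 (Complex.exp ((θp : ℂ) * Complex.I))))
    (μ : ℝ) (hμ : μ = (α + 2) * Real.sqrt (m ⟨0, hN⟩ / (2 * α)))
    (ybar : ℝ → ℂ)
    (hybar_pos : ∀ t : ℝ, 0 ≤ t →
      ybar t = (((μ * |t|) ^ (2 / (α + 2)) : ℝ) : ℂ) * Complex.exp ((θp : ℂ) * Complex.I))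
    (hybar_neg : ∀ t : ℝ, t ≤ 0 →
      ybar t = (((μ * |t|) ^ (2 / (α + 2)) : ℝ) : ℂ) * Complex.exp ((θm : ℂ) * Complex.I)) :
    ∀ T : ℝ, 0 < T →
      ∃ lam : ℕ → ℝ, (∀ n, 0 < lam n) ∧
        Filter.Tendsto lam Filter.atTop (𝓝 0) ∧
        TendstoUniformlyOn
          (fun n t => (((lam n) ^ (-(2 / (2 + α))) : ℝ) : ℂ) * y (lam n * t))
          ybar Filter.atTop (Set.Icc (-T) T) ∧
        ∀ K : Set ℝ, K ⊆ Set.Icc (-T) T \ {0} → IsCompact K →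
          TendstoUniformlyOn
            (fun n t => deriv (fun s => (((lam n) ^ (-(2 / (2 + α))) : ℝ) : ℂ) * y (lam n * s)) t)
            (deriv ybar) Filter.atTop K := by
  have hα : 0 < α := by linarith
  have hm₁ := hm ⟨0, hN⟩
  have hμ' : μ = (α + 2) / 2 * √(2 * m ⟨0, hN⟩ / α) := by
    rw [hμ, show 2 * m ⟨0, hN⟩ / α = 2 ^ 2 * (m ⟨0, hN⟩ / (2 * α)) by field_simp,
      Real.sqrt_mul (by positivity), Real.sqrt_sq (by norm_num)]
    ring
  have hμ0 : 0 < μ := by rw [hμ']; positivity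
  have hp : 0 < 2 / (α + 2) := by positivity
  intro T hT
  obtain ⟨lam, hlam, hlim⟩ : ∃ lam : ℕ → ℝ, (∀ n, 0 < lam n) ∧ Tendsto lam atTop (𝓝 0) :=
    ⟨fun n => 1 / ((n : ℝ) + 1), fun n => by positivity, tendsto_one_div_add_atTop_nhds_zero_nat⟩
  have hside : ∀ (σ θ : ℝ), |σ| = 1 →
      Tendsto (fun t => y (σ * t) / (‖y (σ * t)‖ : ℂ)) (𝓝[>] 0)
        (𝓝 (Complex.exp ((θ : ℂ) * Complex.I))) →
      (∀ t, 0 < t → ybar (σ * t) =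
        (((μ * |σ * t|) ^ (2 / (α + 2)) : ℝ) : ℂ) * Complex.exp ((θ : ℂ) * Complex.I)) →
      TendstoUniformlyOn (fun n t => ((lam n ^ (-(2 / (α + 2))) : ℝ) : ℂ) * y (lam n * t)) ybar
        atTop ((σ * ·) ⁻¹' Set.Ioc 0 T) ∧
      ∀ K ⊆ Set.Ioc 0 T, IsCompact K →
        TendstoUniformlyOn
          (fun n t => deriv (fun s => ((lam n ^ (-(2 / (α + 2))) : ℝ) : ℂ) * y (lam n * s)) t)
          (deriv ybar) atTop ((σ * ·) ⁻¹' K) := by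
    intro σ θ hσ hθ hybar
    obtain ⟨B, F, W, H⟩ := exists_perturbedCollision_of_nCenter hc_inj hc1 hδ hy_cont hy0 hy_ne
      hy_d1 hy_d2 hy_eq hy_energy hα hσ
    refine tendstoUniformlyOn_blowup_of_asymptotics hp
      (by rw [← abs_mul_abs_self, hσ, one_mul]) (fun t ht => ?_)
      (H.tendsto_div_rpow hm₁ hα hα2 hμ' hθ) (H.tendsto_vel_div_rpow hm₁ hα hα2 hμ' hθ) hlam hlim T
    rw [hybar t ht, abs_mul, hσ, one_mul, abs_of_pos ht, Real.mul_rpow hμ0.le ht.le]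
    push_cast
    ring
  obtain ⟨hp1, hp2⟩ := hside 1 θp abs_one (by simpa using hθp)
    fun t ht => hybar_pos _ (by linarith)
  have hneg : Tendsto (fun t : ℝ => -1 * t) (𝓝[>] 0) (𝓝[<] 0) := by
    simpa using tendsto_neg_nhdsGT (a := (0 : ℝ))
  obtain ⟨hn1, hn2⟩ := hside (-1) θm (by simp) (hθm.comp hneg)
    fun t ht => hybar_neg _ (by linarith)
  have h0 : TendstoUniformlyOn
      (fun n t => ((lam n ^ (-(2 / (α + 2))) : ℝ) : ℂ) * y (lam n * t)) ybar atTop {0} := by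
    rw [tendstoUniformlyOn_singleton_iff_tendsto]
    simp [hy0, hybar_pos 0 le_rfl, Real.zero_rpow hp.ne']
  refine ⟨lam, hlam, hlim, ?_, fun K hKT hK => ?_⟩
  all_goals rw [add_comm 2 α]
  · refine (hp1.union_of_subset hn1 subset_rfl).union_of_subset h0 fun t ht => ?_
    rcases lt_trichotomy t 0 with h | h | h
    · exact Or.inl (Or.inr ⟨by simpa using h, by linarith [ht.1]⟩)
    · exact Or.inr h
    · exact Or.inl (Or.inl ⟨by simpa using h, by linarith [ht.2]⟩)
  · have hKp : K ∩ Set.Ici 0 ⊆ Set.Ioc 0 T := fun t ht =>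
      ⟨lt_of_le_of_ne ht.2 fun h => (hKT ht.1).2 h.symm, (hKT ht.1).1.2⟩
    have hKn : (fun t : ℝ => -1 * t) '' (K ∩ Set.Iic 0) ⊆ Set.Ioc 0 T := by
      rintro _ ⟨t, ht, rfl⟩
      have : t < 0 := lt_of_le_of_ne ht.2 fun h => (hKT ht.1).2 h
      exact ⟨by linarith, by linarith [(hKT ht.1).1.1]⟩
    refine (hp2 _ hKp (hK.inter_right isClosed_Ici)).union_of_subset
      (hn2 _ hKn ((hK.inter_right isClosed_Iic).image (continuous_const_mul _)))
      fun t ht => ?_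
    rcases le_total 0 t with h | h
    · exact Or.inl (by simpa using And.intro ht h)
    · exact Or.inr ⟨t, ⟨ht, h⟩, rfl⟩
end

section
/- Fixed-time improvement of the collision-ejection solution (Theorem 3): let T > 0, m₁ > 0, α ∈ [1,2), and φ₋, φ₊ ∈ ℝ with 0 < |φ₊ − φ₋| ≤ 2π; assume either α ∈ (1,2), or α = 1 and |φ₊ − φ₋| < 2π. Then there exists a C² curve γ : [−T, T] → ℂ \ {0} with γ(±T) = x̄(±T), admitting a continuous function θ : [−T, T] → ℝ with γ(t) = |γ(t)|·e^{iθ(t)}, θ(−T) = φ₋ and θ(T) = φ₊, such that γ satisfies the Kepler-type equation γ̈(t) = −m₁ γ(t)/|γ(t)|^{α+2} on [−T, T] and Ā_T(γ) < Ā_T(x̄). -/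
open Filter Topology MeasureTheory

theorem exists_forall_half_norm_sq_add_le {H E : Type*}
    [NormedAddCommGroup H] [InnerProductSpace ℝ H] [CompleteSpace H]
    [NormedAddCommGroup E] [NormedSpace ℝ E]
    (K : H →L[ℝ] E) (hK : IsCompactOperator K) (e : E) (G : E → ℝ)
    (hG : Continuous G) (hG0 : ∀ y, 0 ≤ G y) :
    ∃ f : H, ∀ h : H, 1 / 2 * ‖f‖ ^ 2 + G (e + K f) ≤ 1 / 2 * ‖h‖ ^ 2 + G (e + K h) := by
  set F : H → ℝ := fun f => 1 / 2 * ‖f‖ ^ 2 + G (e + K f) with hF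
  have hFc : Continuous F := by fun_prop
  have hF0 : ∀ f, 0 ≤ F f := fun f => add_nonneg (by positivity) (hG0 _)
  have hbdd : BddBelow (Set.range F) := ⟨0, by rintro _ ⟨f, rfl⟩; exact hF0 f⟩
  set I := ⨅ f, F f with hI
  have hIle : ∀ f, I ≤ F f := fun f => ciInf_le hbdd f
  have hex : ∀ n : ℕ, ∃ f, F f < I + 1 / ((n : ℝ) + 1) := fun n =>
    exists_lt_of_ciInf_lt (lt_add_of_pos_right _ (by positivity))
  choose f hf using hex
  have hlim : Tendsto (fun n => F (f n)) atTop (𝓝 I) := by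
    refine tendsto_of_tendsto_of_tendsto_of_le_of_le tendsto_const_nhds
      (?_ : Tendsto (fun n : ℕ => I + 1 / ((n : ℝ) + 1)) atTop (𝓝 I))
      (fun n => hIle _) (fun n => (hf n).le)
    simpa using tendsto_const_nhds.add (tendsto_one_div_add_atTop_nhds_zero_nat (𝕜 := ℝ))
  have hball : ∀ n, f n ∈ Metric.closedBall (0 : H) (2 * I + 3) := by
    intro n
    rw [mem_closedBall_zero_iff]
    have h1 := hf n
    have h2 : 1 / ((n : ℝ) + 1) ≤ 1 := by
      rw [div_le_one (by positivity)]; linarith [n.cast_nonneg (α := ℝ)]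
    have h3 := hG0 (e + K (f n))
    simp only [hF] at h1
    nlinarith [sq_nonneg (‖f n‖ - 1)]
  have hcomp := hK.isCompact_closure_image_closedBall (2 * I + 3)
  obtain ⟨y, -, φ, hφ, hy⟩ := hcomp.tendsto_subseq
    (fun n => subset_closure (Set.mem_image_of_mem K (hball n)))
  have hlim' := hlim.comp hφ.tendsto_atTop
  have hcauchy : CauchySeq (f ∘ φ) := by
    refine Metric.cauchySeq_iff.2 fun ε hε => ?_
    have hε2 : 0 < ε ^ 2 / 100 := by positivity
    obtain ⟨η, hη, hGη⟩ := Metric.continuousAt_iff.1 (hG.continuousAt (x := e + y)) _ hε2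
    obtain ⟨N, hN⟩ := eventually_atTop.1
      ((Metric.tendsto_nhds.1 hy η hη).and
        (hlim'.eventually (gt_mem_nhds (show I < I + ε ^ 2 / 100 by linarith))))
    refine ⟨N, fun m hm n hn => ?_⟩
    obtain ⟨hm1, hm2⟩ := hN m hm
    obtain ⟨hn1, hn2⟩ := hN n hn
    simp only [Function.comp_apply] at hm1 hm2 hn1 hn2 ⊢
    set a := f (φ m)
    set b := f (φ n)
    have hmid := hIle ((1 / 2 : ℝ) • (a + b))
    have hnorm : ‖(1 / 2 : ℝ) • (a + b)‖ ^ 2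
        = 1 / 2 * (‖a‖ ^ 2 + ‖b‖ ^ 2) - 1 / 4 * ‖a - b‖ ^ 2 := by
      have := parallelogram_law_with_norm ℝ a b
      rw [norm_smul, mul_pow]
      norm_num
      nlinarith
    have hGa := hGη (x := e + K a) (by simpa using hm1)
    have hGb := hGη (x := e + K b) (by simpa using hn1)
    have hGc := hGη (x := e + K ((1 / 2 : ℝ) • (a + b))) (by
      rw [dist_add_left, dist_eq_norm]
      rw [dist_eq_norm] at hm1 hn1
      have : K ((1 / 2 : ℝ) • (a + b)) - y = (1 / 2 : ℝ) • ((K a - y) + (K b - y)) := by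
        rw [map_smul, map_add]; module
      rw [this, norm_smul]
      have := norm_add_le (K a - y) (K b - y)
      norm_num
      linarith)
    rw [Real.dist_eq, abs_lt] at hGa hGb hGc
    simp only [hF] at hm2 hn2 hmid
    rw [hnorm] at hmid
    rw [dist_eq_norm]
    by_contra hcon
    push Not at hcon
    nlinarith
  obtain ⟨g, hg⟩ := cauchySeq_tendsto_of_complete hcauchy
  have hgI : F g = I := tendsto_nhds_unique ((hFc.tendsto g).comp hg) hlim'
  exact ⟨g, fun h => by rw [← hF] at *; exact hgI.trans_le (hIle h)⟩

theorem intervalIntegrable_of_Lp_two {a b : ℝ}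
    (f : Lp ℝ 2 (volume.restrict (Set.Ioc a b))) {s t : ℝ}
    (hs : s ∈ Set.Icc a b) (ht : t ∈ Set.Icc a b) : IntervalIntegrable f volume s t := by
  have h : IntegrableOn f (Set.Ioc a b) volume :=
    (Lp.memLp f).integrable (by norm_num)
  rw [intervalIntegrable_iff]
  exact h.mono_set (Set.Ioc_subset_Ioc (le_min hs.1 ht.1) (max_le hs.2 ht.2))

theorem abs_intervalIntegral_le_sqrt_mul_norm {a b : ℝ}
    (f : Lp ℝ 2 (volume.restrict (Set.Ioc a b))) {s t : ℝ}
    (hs : s ∈ Set.Icc a b) (ht : t ∈ Set.Icc a b) :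
    |∫ x in s..t, f x| ≤ Real.sqrt |t - s| * ‖f‖ := by
  wlog hst : s ≤ t generalizing s t
  · rw [intervalIntegral.integral_symm, abs_neg, abs_sub_comm]
    exact this ht hs (not_le.1 hst).le
  have hsub : Set.Ioc s t ⊆ Set.Ioc a b := Set.Ioc_subset_Ioc hs.1 ht.2
  have hfin : (volume.restrict (Set.Ioc a b)) (Set.Ioc s t) ≠ ⊤ := measure_ne_top _ _
  have h := L2.inner_indicatorConstLp_one (𝕜 := ℝ) measurableSet_Ioc hfin f
  have h2 := norm_indicatorConstLp (E := ℝ) (p := 2) (c := (1 : ℝ))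
    (hs := measurableSet_Ioc) (hμs := hfin) (by norm_num) (by norm_num)
  rw [Measure.restrict_restrict measurableSet_Ioc, Set.inter_eq_left.2 hsub] at h
  rw [intervalIntegral.integral_of_le hst, ← h]
  refine (abs_real_inner_le_norm _ _).trans ?_
  rw [h2, measureReal_restrict_apply measurableSet_Ioc, Set.inter_eq_left.2 hsub,
    Real.volume_real_Ioc_of_le hst, abs_of_nonneg (sub_nonneg.2 hst), Real.sqrt_eq_rpow]
  simp

theorem exists_compact_primitive_operator {a b : ℝ} (hab : a < b) :
    ∃ K : Lp ℝ 2 (volume.restrict (Set.Ioc a b)) →L[ℝ]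
        BoundedContinuousFunction (Set.Icc a b) ℝ,
      IsCompactOperator K ∧ ∀ f t, K f t =
        (∫ x in a..(t : ℝ), f x) - ((t : ℝ) - a) / (b - a) * ∫ x in a..b, f x := by
  have ha : a ∈ Set.Icc a b := Set.left_mem_Icc.2 hab.le
  have hb : b ∈ Set.Icc a b := Set.right_mem_Icc.2 hab.le
  have hba : 0 < b - a := sub_pos.2 hab
  set k : Lp ℝ 2 (volume.restrict (Set.Ioc a b)) → Set.Icc a b → ℝ := fun f t =>
    (∫ x in a..(t : ℝ), f x) - ((t : ℝ) - a) / (b - a) * ∫ x in a..b, f x with hk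
  have hmod : ∀ f (s t : Set.Icc a b),
      dist (k f s) (k f t) ≤ 2 * Real.sqrt (dist s t) * ‖f‖ := by
    intro f s t
    have h1 := abs_intervalIntegral_le_sqrt_mul_norm f t.2 s.2
    have h2 := abs_intervalIntegral_le_sqrt_mul_norm f ha hb
    have h3 := intervalIntegral.integral_interval_sub_left
      (intervalIntegrable_of_Lp_two f ha s.2) (intervalIntegrable_of_Lp_two f ha t.2)
    have h4 : k f s - k f t = (∫ x in (t : ℝ)..s, f x)
        - ((s : ℝ) - t) / (b - a) * ∫ x in a..b, f x := by
      rw [← h3, hk]; ring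
    have hd : |(s : ℝ) - t| ≤ b - a := by
      rw [abs_le]; constructor <;> linarith [s.2.1, s.2.2, t.2.1, t.2.2]
    rw [Real.dist_eq, h4, Subtype.dist_eq, Real.dist_eq]
    refine (abs_sub _ _).trans ?_
    rw [abs_mul, abs_div, abs_of_pos hba]
    rw [abs_of_pos hba] at h2
    have h5 : |(s : ℝ) - t| / (b - a) * |∫ x in a..b, f x|
        ≤ Real.sqrt |(s : ℝ) - t| * ‖f‖ := by
      calc |(s : ℝ) - t| / (b - a) * |∫ x in a..b, f x|
          ≤ |(s : ℝ) - t| / (b - a) * (Real.sqrt (b - a) * ‖f‖) := by gcongr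
        _ = Real.sqrt |(s : ℝ) - t| * (Real.sqrt |(s : ℝ) - t| / Real.sqrt (b - a)) * ‖f‖ := by
            have e1 := Real.mul_self_sqrt (abs_nonneg ((s : ℝ) - t))
            have e2 := Real.mul_self_sqrt hba.le
            have e3 := Real.sqrt_pos.2 hba
            rw [← mul_div_assoc, e1]
            nth_rewrite 1 [← e2]
            field_simp
        _ ≤ Real.sqrt |(s : ℝ) - t| * 1 * ‖f‖ := by
            gcongr
            rw [div_le_one (Real.sqrt_pos.2 hba)]
            exact Real.sqrt_le_sqrt hd
        _ = _ := by ring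
    linarith
  have hlim : ∀ C : ℝ, Tendsto (fun d => 2 * Real.sqrt d * C) (𝓝 0) (𝓝 0) := by
    intro C
    have : Continuous fun d => 2 * Real.sqrt d * C := by fun_prop
    simpa using this.tendsto 0
  have hcont : ∀ f, Continuous (k f) := fun f => by
    rw [continuous_iff_continuousAt]
    intro t
    rw [ContinuousAt, tendsto_iff_dist_tendsto_zero]
    refine squeeze_zero (fun _ => dist_nonneg) (fun s => hmod f s t) ?_
    have : Continuous fun s : Set.Icc a b => 2 * Real.sqrt (dist s t) * ‖f‖ := by fun_prop
    simpa using this.tendsto t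
  have hka : ∀ f, k f ⟨a, ha⟩ = 0 := fun f => by simp [hk]
  have hbound : ∀ f t, ‖k f t‖ ≤ 2 * Real.sqrt (b - a) * ‖f‖ := by
    intro f t
    have h := hmod f t ⟨a, ha⟩
    rw [hka, dist_zero_right] at h
    refine h.trans ?_
    gcongr
    rw [Subtype.dist_eq, Real.dist_eq, abs_of_nonneg (by linarith [t.2.1])]
    linarith [t.2.2]
  have hII : ∀ (f : Lp ℝ 2 (volume.restrict (Set.Ioc a b))) {t : ℝ}, t ∈ Set.Icc a b →
      IntervalIntegrable f volume a t := fun f t ht => intervalIntegrable_of_Lp_two f ha ht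
  have hae : ∀ {g h : ℝ → ℝ}, g =ᵐ[volume.restrict (Set.Ioc a b)] h →
      ∀ {t : ℝ}, t ∈ Set.Icc a b → ∫ x in a..t, g x = ∫ x in a..t, h x := by
    intro g h hgh t ht
    rw [intervalIntegral.integral_of_le ht.1, intervalIntegral.integral_of_le ht.1]
    exact integral_congr_ae (ae_restrict_of_ae_restrict_of_subset
      (Set.Ioc_subset_Ioc_right ht.2) hgh)
  have hadd : ∀ f g t, k (f + g) t = k f t + k g t := by
    intro f g t
    have : ∀ {t : ℝ}, t ∈ Set.Icc a b →
        ∫ x in a..t, (f + g : Lp ℝ 2 (volume.restrict (Set.Ioc a b))) x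
          = (∫ x in a..t, f x) + ∫ x in a..t, g x := by
      intro t ht
      rw [← intervalIntegral.integral_add (hII f ht) (hII g ht)]
      exact hae (Lp.coeFn_add f g) ht
    simp only [hk, this t.2, this hb]
    ring
  have hsmul : ∀ (c : ℝ) f t, k (c • f) t = c * k f t := by
    intro c f t
    have : ∀ {t : ℝ}, t ∈ Set.Icc a b →
        ∫ x in a..t, (c • f : Lp ℝ 2 (volume.restrict (Set.Ioc a b))) x
          = c * ∫ x in a..t, f x := by
      intro t ht
      rw [← intervalIntegral.integral_const_mul]
      exact hae (Lp.coeFn_smul c f) ht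
    simp only [hk, this t.2, this hb]
    ring
  let K : Lp ℝ 2 (volume.restrict (Set.Ioc a b)) →L[ℝ]
      BoundedContinuousFunction (Set.Icc a b) ℝ :=
    LinearMap.mkContinuous
      { toFun := fun f => BoundedContinuousFunction.mkOfCompact ⟨k f, hcont f⟩
        map_add' := fun f g => by ext t; exact hadd f g t
        map_smul' := fun c f => by ext t; exact hsmul c f t }
      (2 * Real.sqrt (b - a))
      (fun f => (BoundedContinuousFunction.norm_le (by positivity)).2 (hbound f))
  have hK : ∀ f t, K f t = k f t := fun f t => rfl
  refine ⟨K, ?_, hK⟩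
  refine (isCompactOperator_iff_isCompact_closure_image_closedBall
    K.toLinearMap zero_lt_one).2 ?_
  refine BoundedContinuousFunction.arzela_ascoli
    (Set.Icc (-(2 * Real.sqrt (b - a))) (2 * Real.sqrt (b - a))) isCompact_Icc _ ?_ ?_
  · rintro _ t ⟨f, hf, rfl⟩
    rw [mem_closedBall_zero_iff] at hf
    refine abs_le.1 ((hbound f t).trans ?_)
    nlinarith [Real.sqrt_nonneg (b - a)]
  · refine Metric.equicontinuous_of_continuity_modulus _ (hlim 1) _ ?_
    rintro s t ⟨_, f, hf, rfl⟩
    rw [mem_closedBall_zero_iff] at hf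
    refine (hmod f s t).trans ?_
    gcongr

theorem hasDerivAt_intervalIntegral_comp_add_mul {U U' y η : ℝ → ℝ}
    (hU : ∀ x, HasDerivAt U (U' x) x) (hU' : Continuous U') (hy : Continuous y)
    (hη : Continuous η) (a b : ℝ) :
    HasDerivAt (fun s => ∫ t in a..b, U (y t + s * η t)) (∫ t in a..b, U' (y t) * η t) 0 := by
  have hUc : Continuous U := continuous_iff_continuousAt.2 fun x => (hU x).continuousAt
  have hc : Continuous fun q : ℝ × ℝ => U' (y q.2 + q.1 * η q.2) * η q.2 := by fun_prop
  obtain ⟨C, hC⟩ := ((isCompact_Icc (a := (-1 : ℝ)) (b := 1)).prod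
    (isCompact_uIcc (a := a) (b := b))).exists_bound_of_continuousOn hc.continuousOn
  have := (intervalIntegral.hasDerivAt_integral_of_dominated_loc_of_deriv_le
    (μ := volume) (a := a) (b := b) (bound := fun _ => C)
    (F := fun s t => U (y t + s * η t)) (F' := fun s t => U' (y t + s * η t) * η t)
    (x₀ := (0 : ℝ)) (s := Set.Icc (-1) 1) (Icc_mem_nhds (by norm_num) (by norm_num))
    (Eventually.of_forall fun s => Continuous.aestronglyMeasurable (by fun_prop))
    (Continuous.intervalIntegrable (by fun_prop) _ _)
    (Continuous.aestronglyMeasurable (by fun_prop))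
    (Eventually.of_forall fun t ht s hs => hC (s, t) ⟨hs, Set.uIoc_subset_uIcc ht⟩)
    (by simp)
    (Eventually.of_forall fun t _ s _ => by
      have h1 : HasDerivAt (fun s => y t + s * η t) (η t) s := by
        simpa using ((hasDerivAt_id s).mul_const (η t)).const_add (y t)
      exact (hU _).comp s h1)).2
  simpa using this

theorem memLp_two_restrict_Ioc {v : ℝ → ℝ} (hv : Continuous v) (a b : ℝ) :
    MemLp v 2 (volume.restrict (Set.Ioc a b)) := by
  obtain ⟨C, hC⟩ := (isCompact_Icc (a := a) (b := b)).exists_bound_of_continuousOn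
    hv.continuousOn
  refine MemLp.of_bound hv.aestronglyMeasurable C ?_
  filter_upwards [ae_restrict_mem measurableSet_Ioc] with x hx
  exact hC x (Set.Ioc_subset_Icc_self hx)

theorem inner_toLp_eq_intervalIntegral {a b : ℝ} (hab : a ≤ b)
    (f : Lp ℝ 2 (volume.restrict (Set.Ioc a b))) {v : ℝ → ℝ}
    (hv : MemLp v 2 (volume.restrict (Set.Ioc a b))) :
    inner ℝ f hv.toLp = ∫ x in a..b, f x * v x := by
  rw [L2.inner_def, intervalIntegral.integral_of_le hab]
  refine integral_congr_ae ?_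
  filter_upwards [hv.coeFn_toLp] with x hx
  simp [hx, mul_comm]

theorem intervalIntegral_toLp_eq {a b t : ℝ} (ht : t ∈ Set.Icc a b) {v w : ℝ → ℝ}
    (hv : MemLp v 2 (volume.restrict (Set.Ioc a b))) :
    ∫ x in a..t, (hv.toLp v) x * w x = ∫ x in a..t, v x * w x := by
  rw [intervalIntegral.integral_of_le ht.1, intervalIntegral.integral_of_le ht.1]
  refine integral_congr_ae ?_
  filter_upwards [ae_restrict_of_ae_restrict_of_subset
    (Set.Ioc_subset_Ioc_right ht.2) hv.coeFn_toLp] with x hx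
  simp [hx]

theorem norm_toLp_sq_eq_intervalIntegral {a b : ℝ} (hab : a ≤ b) {v : ℝ → ℝ}
    (hv : MemLp v 2 (volume.restrict (Set.Ioc a b))) :
    ‖hv.toLp‖ ^ 2 = ∫ x in a..b, v x ^ 2 := by
  rw [← real_inner_self_eq_norm_sq, inner_toLp_eq_intervalIntegral hab,
    intervalIntegral_toLp_eq (Set.right_mem_Icc.2 hab)]
  simp only [sq]

theorem intervalIntegral_sub_const_mul {A B : ℝ → ℝ} (hA : Continuous A) (hB : Continuous B)
    (a b k : ℝ) :
    ∫ t in a..b, (A t - k * B t) = (∫ t in a..b, A t) - k * ∫ t in a..b, B t := by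
  rw [← intervalIntegral.integral_const_mul, ← intervalIntegral.integral_sub
    (hA.intervalIntegrable _ _) ((hB.intervalIntegrable _ _).const_mul k)]

theorem exists_C2_minimizer {a b : ℝ} (hab : a < b) (R D : ℝ) {V V' W W' : ℝ → ℝ}
    (hV : ∀ x, HasDerivAt V (V' x) x) (hV' : Continuous V')
    (hW : ∀ x, HasDerivAt W (W' x) x) (hW' : Continuous W')
    (hV0 : ∀ x, 0 ≤ V x) (hW0 : ∀ x, 0 < W x) :
    ∃ r p : ℝ → ℝ, r a = R ∧ r b = R ∧ Continuous p ∧ (∀ t, HasDerivAt r (p t) t) ∧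
      (∀ t, DifferentiableAt ℝ p t) ∧
      (∀ t ∈ Set.Icc a b, HasDerivAt p
        (V' (r t) - 1 / 2 * (D / ∫ x in a..b, W (r x)) ^ 2 * W' (r t)) t) ∧
      ∀ s v : ℝ → ℝ, Continuous v → (∀ t, HasDerivAt s (v t) t) → s a = R → s b = R →
        1 / 2 * (∫ t in a..b, p t ^ 2) + ((∫ t in a..b, V (r t))
            + D ^ 2 / (2 * ∫ t in a..b, W (r t)))
          ≤ 1 / 2 * (∫ t in a..b, v t ^ 2) + ((∫ t in a..b, V (s t))
            + D ^ 2 / (2 * ∫ t in a..b, W (s t))) := by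
  have hVc : Continuous V := continuous_iff_continuousAt.2 fun x => (hV x).continuousAt
  have hWc : Continuous W := continuous_iff_continuousAt.2 fun x => (hW x).continuousAt
  have hba : 0 < b - a := sub_pos.2 hab
  have hb : b ∈ Set.Icc a b := Set.right_mem_Icc.2 hab.le
  obtain ⟨K, hK, hKf⟩ := exists_compact_primitive_operator hab
  set pr : ℝ → Set.Icc a b := Set.projIcc a b hab.le with hpr
  have hprc : Continuous pr := continuous_projIcc
  have hprt : ∀ {t}, t ∈ Set.Icc a b → (pr t : ℝ) = t := fun ht => by
    rw [hpr, Set.projIcc_of_mem _ ht]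
  set e : BoundedContinuousFunction (Set.Icc a b) ℝ := BoundedContinuousFunction.const _ R
  set G : BoundedContinuousFunction (Set.Icc a b) ℝ → ℝ := fun y =>
    (∫ t in a..b, V (y (pr t))) + D ^ 2 / (2 * ∫ t in a..b, W (y (pr t))) with hG
  have hWpos : ∀ {y : ℝ → ℝ}, Continuous y → 0 < ∫ t in a..b, W (y t) := fun hy =>
    intervalIntegral.intervalIntegral_pos_of_pos (Continuous.intervalIntegrable (by fun_prop) _ _)
      (fun _ => hW0 _) hab
  have hyc : ∀ y : BoundedContinuousFunction (Set.Icc a b) ℝ, Continuous fun t => y (pr t) :=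
    fun y => y.continuous.comp hprc
  have heval : Continuous fun q : BoundedContinuousFunction (Set.Icc a b) ℝ × ℝ =>
      q.1 (pr q.2) := by fun_prop
  have hGc : Continuous G := by
    refine Continuous.add ?_ (Continuous.div continuous_const (continuous_const.mul ?_) ?_)
    · exact intervalIntegral.continuous_parametric_intervalIntegral_of_continuous'
        (f := fun (y : BoundedContinuousFunction (Set.Icc a b) ℝ) t => V (y (pr t)))
        (hVc.comp heval) _ _
    · exact intervalIntegral.continuous_parametric_intervalIntegral_of_continuous'
        (f := fun (y : BoundedContinuousFunction (Set.Icc a b) ℝ) t => W (y (pr t)))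
        (hWc.comp heval) _ _
    · intro y
      have := hWpos (hyc y)
      positivity
  have hG0 : ∀ y, 0 ≤ G y := fun y => by
    have h1 := hWpos (hyc y)
    have h2 : 0 ≤ ∫ t in a..b, V (y (pr t)) :=
      intervalIntegral.integral_nonneg hab.le fun _ _ => hV0 _
    positivity
  obtain ⟨f, hf⟩ := exists_forall_half_norm_sq_add_le K hK e G hGc hG0
  set y : ℝ → ℝ := fun t => (e + K f) (pr t) with hy
  have hycont : Continuous y := hyc (e + K f)
  set I := ∫ t in a..b, W (y t) with hI
  have hIpos : 0 < I := hWpos hycont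
  set g : ℝ → ℝ := fun t => V' (y t) - 1 / 2 * (D / I) ^ 2 * W' (y t) with hg
  have hgc : Continuous g := by fun_prop
  set P : ℝ → ℝ := fun t => ∫ x in a..t, g x with hP
  have hPd : ∀ t, HasDerivAt P (g t) t := fun t => hgc.integral_hasStrictDerivAt a t |>.hasDerivAt
  have hPc : Continuous P := continuous_iff_continuousAt.2 fun x => (hPd x).continuousAt
  set m := (∫ x in a..b, P x) / (b - a) with hm
  set p : ℝ → ℝ := fun t => P t - m with hp
  have hpd : ∀ t, HasDerivAt p (g t) t := fun t => (hPd t).sub_const m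
  have hpc : Continuous p := by fun_prop
  have hpLp := memLp_two_restrict_Ioc hpc a b
  have hpint : ∫ x in a..b, p x = 0 := by
    rw [hp, intervalIntegral.integral_sub (hPc.intervalIntegrable _ _) (by simp)]
    simp only [intervalIntegral.integral_const, smul_eq_mul, hm]
    field_simp
    ring
  have hKv : ∀ {v : ℝ → ℝ} (hv : MemLp v 2 (volume.restrict (Set.Ioc a b))) (t : Set.Icc a b),
      K hv.toLp t = (∫ x in a..(t : ℝ), v x) - ((t : ℝ) - a) / (b - a) * ∫ x in a..b, v x := by
    intro v hv t
    have h1 := intervalIntegral_toLp_eq (w := fun _ => 1) t.2 hv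
    have h2 := intervalIntegral_toLp_eq (w := fun _ => 1) hb hv
    simp only [mul_one] at h1 h2
    rw [hKf, h1, h2]
  -- the Euler–Lagrange equation in weak form
  have hEL : ∀ {v : ℝ → ℝ} (_ : Continuous v) (hv : MemLp v 2 (volume.restrict (Set.Ioc a b))),
      inner ℝ (f - hpLp.toLp) hv.toLp = 0 := by
    intro v hvc hv
    set η : ℝ → ℝ := fun t => K hv.toLp (pr t) with hη
    have hηc : Continuous η := hyc _
    have hline : ∀ s : ℝ, ∀ t, (e + K (f + s • hv.toLp)) (pr t) = y t + s * η t := by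
      intro s t
      simp [hy, hη, map_add, map_smul]
      ring
    have hd : HasDerivAt (fun s : ℝ => 1 / 2 * ‖f + s • hv.toLp‖ ^ 2
        + G (e + K (f + s • hv.toLp))) (inner ℝ f hv.toLp + ∫ t in a..b, g t * η t) 0 := by
      have h1 : HasDerivAt (fun s : ℝ => 1 / 2 * ‖f + s • hv.toLp‖ ^ 2) (inner ℝ f hv.toLp) 0 := by
        have h0 : HasDerivAt (fun s : ℝ => f + s • hv.toLp) hv.toLp 0 := by
          simpa using ((hasDerivAt_id (0 : ℝ)).smul_const hv.toLp).const_add f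
        have := (h0.norm_sq).const_mul (1 / 2 : ℝ)
        simpa using this
      have h2 := hasDerivAt_intervalIntegral_comp_add_mul hV hV' hycont hηc a b
      have h3 := hasDerivAt_intervalIntegral_comp_add_mul hW hW' hycont hηc a b
      have h4 := h1.add (h2.add ((hasDerivAt_const (0 : ℝ) (D ^ 2)).div (h3.const_mul 2)
        (by simp only [zero_mul, add_zero]; positivity)))
      simp only [hG, hline]
      refine (h4.congr_deriv ?_)
      simp only [zero_mul, add_zero, zero_sub]
      rw [← hI]
      congr 1
      have h5 : ∫ t in a..b, g t * η t = (∫ t in a..b, V' (y t) * η t)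
          - 1 / 2 * (D / I) ^ 2 * ∫ t in a..b, W' (y t) * η t := by
        rw [← intervalIntegral_sub_const_mul (by fun_prop) (by fun_prop)]
        congr 1; ext t; rw [hg]; ring
      rw [h5]
      field_simp
      ring
    have hmin : IsLocalMin (fun s : ℝ => 1 / 2 * ‖f + s • hv.toLp‖ ^ 2
        + G (e + K (f + s • hv.toLp))) 0 := Eventually.of_forall fun s => by
      simpa using hf (f + s • hv.toLp)
    have h0 := hmin.hasDerivAt_eq_zero hd
    set M := ∫ x in a..b, v x with hM
    have hηeq : ∫ t in a..b, g t * η t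
        = ∫ t in a..b, ((∫ x in a..t, v x) - (t - a) / (b - a) * M) * g t := by
      refine intervalIntegral.integral_congr fun t ht => ?_
      rw [Set.uIcc_of_le hab.le] at ht
      simp only [hη, hKv hv, hprt ht]
      ring
    have hibp := intervalIntegral.integral_mul_deriv_eq_deriv_mul (a := a) (b := b)
      (u := fun t => (∫ x in a..t, v x) - (t - a) / (b - a) * M) (v := P)
      (u' := fun t => v t - 1 / (b - a) * M) (v' := g)
      (fun t _ => by
        refine (hvc.integral_hasStrictDerivAt a t).hasDerivAt.sub (HasDerivAt.mul_const ?_ M)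
        exact ((hasDerivAt_id t).sub_const a).div_const (b - a))
      (fun t _ => hPd t)
      (Continuous.intervalIntegrable (by fun_prop) _ _) (hgc.intervalIntegrable _ _)
    have hfv : IntervalIntegrable (fun t => f t * v t) volume a b := by
      rw [intervalIntegrable_iff, Set.uIoc_of_le hab.le]
      exact (Lp.memLp f).integrable_mul hv
    have h6 : ∫ t in a..b, (v t - 1 / (b - a) * M) * P t = ∫ t in a..b, p t * v t := by
      have e1 : ∫ t in a..b, (v t - 1 / (b - a) * M) * P t
          = (∫ t in a..b, P t * v t) - M / (b - a) * ∫ t in a..b, P t := by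
        rw [← intervalIntegral_sub_const_mul (by fun_prop) (by fun_prop)]
        congr 1; ext t; ring
      have e2 : ∫ t in a..b, p t * v t
          = (∫ t in a..b, P t * v t) - m * ∫ t in a..b, v t := by
        rw [← intervalIntegral_sub_const_mul (by fun_prop) (by fun_prop)]
        congr 1; ext t; rw [hp]; ring
      rw [e1, e2, ← hM, hm]
      ring
    rw [inner_sub_left, inner_toLp_eq_intervalIntegral hab.le (hpLp.toLp p) hv,
      intervalIntegral_toLp_eq hb, ← h6]
    have h7 : (b - a) / (b - a) = 1 := div_self hba.ne'
    simp only [intervalIntegral.integral_same, sub_self, zero_div, zero_mul, h7, one_mul,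
      ← hM] at hibp
    rw [hηeq, hibp] at h0
    linarith
  have hfp : f = hpLp.toLp := by
    rw [← sub_eq_zero]
    have hdense := BoundedContinuousFunction.toLp_denseRange ℝ (volume.restrict (Set.Ioc a b)) ℝ
      (p := 2) (by norm_num)
    refine hdense.eq_zero_of_inner_left ℝ ?_
    intro v
    have hv := memLp_two_restrict_Ioc v.continuous a b
    have : BoundedContinuousFunction.toLp 2 (volume.restrict (Set.Ioc a b)) ℝ v = hv.toLp := by
      refine Lp.ext ?_
      filter_upwards [hv.coeFn_toLp,
        BoundedContinuousFunction.coeFn_toLp 2 (volume.restrict (Set.Ioc a b)) ℝ v] with x h1 h2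
      rw [h1, h2]
    rw [this]
    exact hEL v.continuous hv
  set r : ℝ → ℝ := fun t => R + ∫ x in a..t, p x with hr
  have hrd : ∀ t, HasDerivAt r (p t) t := fun t =>
    (hpc.integral_hasStrictDerivAt a t).hasDerivAt.const_add R
  have hyr : ∀ t ∈ Set.Icc a b, y t = r t := fun t ht => by
    simp [hy, hr, e, hfp, hKv, hprt ht, hpint]
  have hcongr : ∀ U : ℝ → ℝ, ∫ t in a..b, U (y t) = ∫ t in a..b, U (r t) := fun U =>
    intervalIntegral.integral_congr fun t ht => by
      rw [Set.uIcc_of_le hab.le] at ht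
      simp only [hyr t ht]
  refine ⟨r, p, by simp [hr], by simp [hr, hpint], hpc, hrd,
    fun t => (hpd t).differentiableAt, fun t ht => ?_, fun s v hv hs hsa hsb => ?_⟩
  · have := hpd t
    simp only [hg, hI, hcongr W, hyr t ht] at this
    exact this
  · have hvLp := memLp_two_restrict_Ioc hv a b
    have h := hf hvLp.toLp
    have hsv : ∀ t, ∫ x in a..t, v x = s t - R := fun t => by
      rw [intervalIntegral.integral_eq_sub_of_hasDerivAt (fun x _ => hs x)
        (hv.intervalIntegrable _ _), hsa]
    have hKs : ∀ t ∈ Set.Icc a b, (e + K hvLp.toLp) (pr t) = s t := fun t ht => by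
      simp [e, hKv, hprt ht, hsv, hsb]
    have hcs : ∀ U : ℝ → ℝ, ∫ t in a..b, U ((e + K hvLp.toLp) (pr t)) = ∫ t in a..b, U (s t) :=
      fun U => intervalIntegral.integral_congr fun t ht => by
        rw [Set.uIcc_of_le hab.le] at ht
        simp only [hKs t ht]
    have hGf : G (e + K f) = (∫ t in a..b, V (r t)) + D ^ 2 / (2 * ∫ t in a..b, W (r t)) := by
      rw [← hcongr V, ← hcongr W]
    rw [hGf] at h
    simp only [hG, hcs V, hcs W] at h
    rwa [norm_toLp_sq_eq_intervalIntegral hab.le, hfp,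
      norm_toLp_sq_eq_intervalIntegral hab.le] at h

theorem exists_C1_extension_of_antitone {V V' : ℝ → ℝ} {δ : ℝ} (hδ : 0 < δ)
    (hV : ∀ x, 0 < x → HasDerivAt V (V' x) x) (hV' : ContinuousOn V' (Set.Ioi 0))
    (hneg : ∀ x, 0 < x → V' x ≤ 0) (hpos : ∀ x, 0 < x → 0 < V x) :
    ∃ U U' : ℝ → ℝ, (∀ x, HasDerivAt U (U' x) x) ∧ Continuous U' ∧
      (∀ x, δ ≤ x → U x = V x ∧ U' x = V' x) ∧ ∀ x, 0 < U x := by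
  have hmax : ∀ x, 0 < max x δ := fun x => lt_max_of_lt_right hδ
  have hc : Continuous fun x => V' (max x δ) :=
    hV'.comp_continuous (by fun_prop) hmax
  have hU : ∀ x, δ ≤ x → V δ + ∫ y in δ..x, V' (max y δ) = V x := by
    intro x hx
    have : ∫ y in δ..x, V' (max y δ) = V x - V δ := by
      refine intervalIntegral.integral_eq_sub_of_hasDerivAt (fun y hy => ?_)
        (hc.intervalIntegrable _ _)
      rw [Set.uIcc_of_le hx] at hy
      rw [max_eq_left hy.1]
      exact hV y (hδ.trans_le hy.1)
    rw [this]; ring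
  refine ⟨fun x => V δ + ∫ y in δ..x, V' (max y δ), fun x => V' (max x δ),
    fun x => (hc.integral_hasStrictDerivAt δ x).hasDerivAt.const_add _, hc,
    fun x hx => ⟨hU x hx, by simp only [max_eq_left hx]⟩, fun x => ?_⟩
  rcases le_total δ x with hx | hx
  · simp only [hU x hx]
    exact hpos x (hδ.trans_le hx)
  · have h1 : 0 ≤ ∫ y in x..δ, -V' (max y δ) :=
      intervalIntegral.integral_nonneg hx fun y _ => neg_nonneg.2 (hneg _ (hmax y))
    rw [intervalIntegral.integral_neg, ← intervalIntegral.integral_symm] at h1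
    linarith [hpos δ hδ]

theorem two_mul_sub_le_action {a b R δ ℓ t₁ : ℝ} {U Φ r p : ℝ → ℝ}
    (hU : Continuous U) (hU0 : ∀ x, 0 ≤ U x) (hδR : δ ≤ R)
    (hΦ : ∀ x, δ ≤ x → HasDerivAt Φ (Real.sqrt (2 * U x)) x) (hℓ : Φ δ = ℓ)
    (hp : Continuous p) (hr : ∀ t, HasDerivAt r (p t) t) (hra : r a = R) (hrb : r b = R)
    (ht₁ : t₁ ∈ Set.Icc a b) (hrt : r t₁ ≤ δ) :
    2 * (Φ R - ℓ) ≤ 1 / 2 * (∫ t in a..b, p t ^ 2) + ∫ t in a..b, U (r t) := by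
  have hsc : Continuous fun x => Real.sqrt (2 * U x) := by fun_prop
  have hrc : Continuous r := continuous_iff_continuousAt.2 fun x => (hr x).continuousAt
  set Ψ : ℝ → ℝ := fun x => ∫ y in δ..x, Real.sqrt (2 * U y) with hΨ
  have hΨd : ∀ x, HasDerivAt Ψ (Real.sqrt (2 * U x)) x := fun x =>
    (hsc.integral_hasStrictDerivAt δ x).hasDerivAt
  have hΨR : Ψ R = Φ R - ℓ := by
    rw [← hℓ]
    refine intervalIntegral.integral_eq_sub_of_hasDerivAt (fun y hy => ?_)
      (hsc.intervalIntegrable _ _)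
    rw [Set.uIcc_of_le hδR] at hy
    exact hΦ y hy.1
  have hΨt : Ψ (r t₁) ≤ 0 := by
    rw [hΨ]
    simp only
    rw [intervalIntegral.integral_symm, neg_nonpos]
    exact intervalIntegral.integral_nonneg hrt fun _ _ => Real.sqrt_nonneg _
  have hcomp : ∀ t, HasDerivAt (fun t => Ψ (r t)) (Real.sqrt (2 * U (r t)) * p t) t :=
    fun t => (hΨd (r t)).comp t (hr t)
  have hint : ∀ u v, ∫ t in u..v, Real.sqrt (2 * U (r t)) * p t = Ψ (r v) - Ψ (r u) :=
    fun u v => intervalIntegral.integral_eq_sub_of_hasDerivAt (fun t _ => hcomp t)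
      (Continuous.intervalIntegrable (by fun_prop) _ _)
  have hsq : ∀ t, Real.sqrt (2 * U (r t)) ^ 2 = 2 * U (r t) := fun t =>
    Real.sq_sqrt (by linarith [hU0 (r t)])
  have hi : ∀ u v, IntervalIntegrable (fun t => 1 / 2 * p t ^ 2 + U (r t)) volume u v :=
    fun u v => Continuous.intervalIntegrable (by fun_prop) _ _
  have h1 : Ψ (r b) - Ψ (r t₁) ≤ ∫ t in t₁..b, (1 / 2 * p t ^ 2 + U (r t)) := by
    rw [← hint]
    refine intervalIntegral.integral_mono_on ht₁.2
      (Continuous.intervalIntegrable (by fun_prop) _ _) (hi _ _) fun t _ => ?_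
    nlinarith [sq_nonneg (Real.sqrt (2 * U (r t)) - p t), hsq t]
  have h2 : -(Ψ (r t₁) - Ψ (r a)) ≤ ∫ t in a..t₁, (1 / 2 * p t ^ 2 + U (r t)) := by
    rw [← hint, ← intervalIntegral.integral_neg]
    refine intervalIntegral.integral_mono_on ht₁.1
      (Continuous.intervalIntegrable (by fun_prop) _ _) (hi _ _) fun t _ => ?_
    nlinarith [sq_nonneg (Real.sqrt (2 * U (r t)) + p t), hsq t]
  have h3 := intervalIntegral.integral_add_adjacent_intervals (hi a t₁) (hi t₁ b)
  have h4 : ∫ t in a..b, (1 / 2 * p t ^ 2 + U (r t))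
      = 1 / 2 * (∫ t in a..b, p t ^ 2) + ∫ t in a..b, U (r t) := by
    rw [intervalIntegral.integral_add (Continuous.intervalIntegrable (by fun_prop) _ _)
      (Continuous.intervalIntegrable (by fun_prop) _ _), intervalIntegral.integral_const_mul]
  rw [hra] at h2
  rw [hrb] at h1
  linarith

theorem exists_polar_solution {a b R D : ℝ} (hab : a < b) (hR : 0 < R) {V V' Φ : ℝ → ℝ}
    (hV : ∀ x, 0 < x → HasDerivAt V (V' x) x) (hV' : ContinuousOn V' (Set.Ioi 0))
    (hneg : ∀ x, 0 < x → V' x ≤ 0) (hpos : ∀ x, 0 < x → 0 < V x)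
    (hΦ : ∀ x, 0 < x → HasDerivAt Φ (Real.sqrt (2 * V x)) x)
    (hΦ0 : Tendsto Φ (𝓝[>] 0) (𝓝 0))
    {s v : ℝ → ℝ} (hv : Continuous v) (hs : ∀ t, HasDerivAt s (v t) t)
    (hsa : s a = R) (hsb : s b = R) (hspos : ∀ t ∈ Set.Icc a b, 0 < s t)
    (hact : 1 / 2 * (∫ t in a..b, v t ^ 2) + ((∫ t in a..b, V (s t))
      + D ^ 2 / (2 * ∫ t in a..b, (s t ^ 2)⁻¹)) < 2 * Φ R) :
    ∃ (c : ℝ) (r p ω : ℝ → ℝ), r a = R ∧ r b = R ∧ Continuous p ∧ Continuous ω ∧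
      (∀ t, HasDerivAt r (p t) t) ∧ (∀ t, DifferentiableAt ℝ p t) ∧
      (∀ t, DifferentiableAt ℝ ω t) ∧
      (∀ t ∈ Set.Icc a b, 0 < r t ∧ ω t = c / r t ^ 2 ∧
        HasDerivAt p (V' (r t) + c ^ 2 / r t ^ 3) t ∧
        HasDerivAt ω (-2 * c * p t / r t ^ 3) t) ∧
      (∫ t in a..b, ω t) = D ∧
      (∫ t in a..b, (1 / 2 * (p t ^ 2 + (r t * ω t) ^ 2) + V (r t))) < 2 * Φ R := by
  set J := 1 / 2 * (∫ t in a..b, v t ^ 2) + ((∫ t in a..b, V (s t))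
    + D ^ 2 / (2 * ∫ t in a..b, (s t ^ 2)⁻¹)) with hJ
  have hsc : Continuous s := continuous_iff_continuousAt.2 fun x => (hs x).continuousAt
  obtain ⟨t₀, ht₀, hmin⟩ := (isCompact_Icc (a := a) (b := b)).exists_isMinOn
    (Set.nonempty_Icc.2 hab.le) hsc.continuousOn
  obtain ⟨δ, ⟨hδΦ, hδs, hδR⟩, hδ⟩ : ∃ δ, (Φ δ < (2 * Φ R - J) / 2 ∧ δ < s t₀ ∧ δ < R) ∧ 0 < δ := by
    have h1 : ∀ᶠ x in 𝓝[>] (0 : ℝ), Φ x < (2 * Φ R - J) / 2 :=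
      hΦ0.eventually (gt_mem_nhds (by linarith))
    have h2 : ∀ᶠ x in 𝓝[>] (0 : ℝ), x < s t₀ :=
      nhdsWithin_le_nhds (gt_mem_nhds (hspos t₀ ht₀))
    have h3 : ∀ᶠ x in 𝓝[>] (0 : ℝ), x < R := nhdsWithin_le_nhds (gt_mem_nhds hR)
    exact ((h1.and (h2.and h3)).and self_mem_nhdsWithin).exists
  obtain ⟨U, U', hU, hU', hUV, hU0⟩ := exists_C1_extension_of_antitone hδ hV hV' hneg hpos
  obtain ⟨W, W', hW, hW', hWV, hW0⟩ := exists_C1_extension_of_antitone (V := fun x => (x ^ 2)⁻¹)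
    (V' := fun x => -2 / x ^ 3) hδ
    (fun x hx => by
      have := (hasDerivAt_pow 2 x).inv (by positivity)
      refine this.congr_deriv ?_
      field_simp
      norm_num [mul_comm])
    (by
      refine ContinuousOn.div continuousOn_const (by fun_prop) fun x hx => ?_
      exact pow_ne_zero _ (ne_of_gt hx))
    (fun x hx => div_nonpos_of_nonpos_of_nonneg (by norm_num) (by positivity))
    (fun x hx => by positivity)
  obtain ⟨r, p, hra, hrb, hp, hr, hpd, hpe, hle⟩ :=
    exists_C2_minimizer hab R D hU hU' hW hW' (fun x => (hU0 x).le) hW0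
  have hUc : Continuous U := continuous_iff_continuousAt.2 fun x => (hU x).continuousAt
  have hWc : Continuous W := continuous_iff_continuousAt.2 fun x => (hW x).continuousAt
  have hrc : Continuous r := continuous_iff_continuousAt.2 fun x => (hr x).continuousAt
  set I := ∫ t in a..b, W (r t) with hI
  have hIpos : 0 < I := intervalIntegral.intervalIntegral_pos_of_pos
    (Continuous.intervalIntegrable (by fun_prop) _ _) (fun _ => hW0 _) hab
  have hrJ : 1 / 2 * (∫ t in a..b, p t ^ 2) + ((∫ t in a..b, U (r t)) + D ^ 2 / (2 * I)) ≤ J := by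
    refine (hle s v hv hs hsa hsb).trans_eq ?_
    have hsδ : ∀ t ∈ Set.uIcc a b, δ ≤ s t := fun t ht =>
      hδs.le.trans (hmin (by rwa [Set.uIcc_of_le hab.le] at ht))
    rw [hJ, intervalIntegral.integral_congr fun t ht => (hUV _ (hsδ t ht)).1,
      intervalIntegral.integral_congr fun t ht => (hWV _ (hsδ t ht)).1]
  have hrδ : ∀ t ∈ Set.Icc a b, δ ≤ r t := by
    intro t ht
    by_contra! hlt
    have h := two_mul_sub_le_action (Φ := Φ) hUc (fun x => (hU0 x).le) hδR.le
      (fun x hx => by rw [(hUV x hx).1]; exact hΦ x (hδ.trans_le hx)) rfl hp hr hra hrb ht hlt.le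
    have h2 : 0 ≤ D ^ 2 / (2 * I) := by positivity
    linarith
  set c := D / I with hc
  refine ⟨c, r, p, fun t => c * W (r t), hra, hrb, hp, by fun_prop, hr, hpd, fun t =>
    ((hW (r t)).comp t (hr t)).differentiableAt.const_mul c, fun t ht => ?_, ?_, ?_⟩
  · obtain ⟨h1, h2⟩ := hUV _ (hrδ t ht)
    obtain ⟨h3, h4⟩ := hWV _ (hrδ t ht)
    have hrpos : 0 < r t := hδ.trans_le (hrδ t ht)
    refine ⟨hrpos, by simp only [h3]; rw [div_eq_mul_inv], ?_, ?_⟩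
    · refine (hpe t ht).congr_deriv ?_
      rw [h2, h4]; ring
    · refine (((hW (r t)).comp t (hr t)).const_mul c).congr_deriv ?_
      rw [h4]; ring
  · rw [intervalIntegral.integral_const_mul, ← hI, hc]
    field_simp
  · have h1 : ∫ t in a..b, (1 / 2 * (p t ^ 2 + (r t * (c * W (r t))) ^ 2) + V (r t))
        = ∫ t in a..b, (1 / 2 * p t ^ 2 + (U (r t) + 1 / 2 * c ^ 2 * W (r t))) := by
      refine intervalIntegral.integral_congr fun t ht => ?_
      rw [Set.uIcc_of_le hab.le] at ht
      have hrpos : 0 < r t := hδ.trans_le (hrδ t ht)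
      simp only [(hUV _ (hrδ t ht)).1, (hWV _ (hrδ t ht)).1]
      field_simp
      ring
    have h2 : ∫ t in a..b, (1 / 2 * p t ^ 2 + (U (r t) + 1 / 2 * c ^ 2 * W (r t)))
        = 1 / 2 * (∫ t in a..b, p t ^ 2) + ((∫ t in a..b, U (r t)) + D ^ 2 / (2 * I)) := by
      rw [intervalIntegral.integral_add (Continuous.intervalIntegrable (by fun_prop) _ _)
        (Continuous.intervalIntegrable (by fun_prop) _ _),
        intervalIntegral.integral_add (Continuous.intervalIntegrable (by fun_prop) _ _)
        (Continuous.intervalIntegrable (by fun_prop) _ _), intervalIntegral.integral_const_mul,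
        intervalIntegral.integral_const_mul, ← hI, hc]
      field_simp
    simp only [h1, h2]
    linarith

theorem hasDerivAt_ofReal_mul_exp {r θ : ℝ → ℝ} {r' θ' t : ℝ} (hr : HasDerivAt r r' t)
    (hθ : HasDerivAt θ θ' t) :
    HasDerivAt (fun t => (r t : ℂ) * Complex.exp ((θ t : ℂ) * Complex.I))
      (((r' : ℂ) + (r t * θ' : ℝ) * Complex.I) * Complex.exp ((θ t : ℂ) * Complex.I)) t := by
  refine (hr.ofReal_comp.mul (hθ.ofReal_comp.mul_const Complex.I).cexp).congr_deriv ?_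
  push_cast
  ring

theorem norm_add_mul_I_mul_exp_sq (x y θ : ℝ) :
    ‖((x : ℂ) + (y : ℂ) * Complex.I) * Complex.exp ((θ : ℂ) * Complex.I)‖ ^ 2
      = x ^ 2 + y ^ 2 := by
  rw [norm_mul, Complex.norm_exp_ofReal_mul_I, mul_one, Complex.sq_norm, Complex.normSq_add_mul_I]

theorem complex_solution_of_polar {m α c a b : ℝ} {r p ω θ : ℝ → ℝ}
    (hr : ∀ t, HasDerivAt r (p t) t) (hpd : ∀ t, DifferentiableAt ℝ p t)
    (hωd : ∀ t, DifferentiableAt ℝ ω t) (hθ : ∀ t, HasDerivAt θ (ω t) t)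
    (hpol : ∀ t ∈ Set.Icc a b, 0 < r t ∧ ω t = c / r t ^ 2 ∧
        HasDerivAt p (-m / r t ^ (α + 1) + c ^ 2 / r t ^ 3) t ∧
        HasDerivAt ω (-2 * c * p t / r t ^ 3) t)
    {γ : ℝ → ℂ} (hγ : γ = fun t => (r t : ℂ) * Complex.exp ((θ t : ℂ) * Complex.I)) :
    (∀ t, DifferentiableAt ℝ γ t ∧ DifferentiableAt ℝ (deriv γ) t) ∧
    (∀ t ∈ Set.Icc a b, ‖γ t‖ = r t) ∧
    (∀ t, ‖deriv γ t‖ ^ 2 = p t ^ 2 + (r t * ω t) ^ 2) ∧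
    ∀ t ∈ Set.Icc a b,
      deriv (deriv γ) t = -(m : ℂ) * γ t / ((‖γ t‖ ^ (α + 2) : ℝ) : ℂ) := by
  have hγd : ∀ t, HasDerivAt γ (((p t : ℂ) + (r t * ω t : ℝ) * Complex.I)
      * Complex.exp ((θ t : ℂ) * Complex.I)) t := fun t => by
    rw [hγ]; exact hasDerivAt_ofReal_mul_exp (hr t) (hθ t)
  have hdγ : deriv γ = fun t => ((p t : ℂ) + (r t * ω t : ℝ) * Complex.I)
      * Complex.exp ((θ t : ℂ) * Complex.I) := funext fun t => (hγd t).deriv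
  have hdd : ∀ {t p' ω' : ℝ}, HasDerivAt p p' t → HasDerivAt ω ω' t →
      HasDerivAt (deriv γ) (((p' - r t * ω t ^ 2 : ℝ) + (2 * p t * ω t + r t * ω' : ℝ) * Complex.I)
        * Complex.exp ((θ t : ℂ) * Complex.I)) t := by
    intro t p' ω' hp hω
    rw [hdγ]
    refine ((hp.ofReal_comp.add ((((hr t).mul hω).ofReal_comp).mul_const Complex.I)).mul
      ((hθ t).ofReal_comp.mul_const Complex.I).cexp).congr_deriv ?_
    simp only [Pi.add_apply, Pi.mul_apply]
    push_cast
    linear_combination (r t * ω t ^ 2 * Complex.exp ((θ t : ℂ) * Complex.I)) * Complex.I_sq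
  have hnorm : ∀ t ∈ Set.Icc a b, ‖γ t‖ = r t := fun t ht => by
    rw [hγ]
    simp only [norm_mul, Complex.norm_exp_ofReal_mul_I, mul_one, Complex.norm_real,
      Real.norm_eq_abs, abs_of_pos (hpol t ht).1]
  refine ⟨fun t => ⟨(hγd t).differentiableAt,
    (hdd (hpd t).hasDerivAt (hωd t).hasDerivAt).differentiableAt⟩, hnorm, fun t => ?_,
    fun t ht => ?_⟩
  · rw [hdγ]
    exact norm_add_mul_I_mul_exp_sq _ _ _
  · obtain ⟨hrt, hω, hp, hω'⟩ := hpol t ht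
    rw [hnorm t ht, (hdd hp hω').deriv, hω]
    have e1 : -m / r t ^ (α + 1) + c ^ 2 / r t ^ 3 - r t * (c / r t ^ 2) ^ 2
        = -m * r t / r t ^ (α + 2) := by
      have : r t ^ (α + 2) = r t ^ (α + 1) * r t := by
        rw [← Real.rpow_add_one hrt.ne']; ring_nf
      rw [this]
      have := Real.rpow_pos_of_pos hrt (α + 1)
      field_simp
      ring
    have e2 : 2 * p t * (c / r t ^ 2) + r t * (-2 * c * p t / r t ^ 3) = 0 := by
      field_simp
      ring
    rw [e1, e2, hγ]
    push_cast
    ring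

theorem exists_hasDerivAt_inverse_primitive {k : ℝ → ℝ} {k₀ : ℝ} (hk : Continuous k)
    (hk₀ : 0 < k₀) (hle : ∀ x, k₀ ≤ k x) :
    ∃ z : ℝ → ℝ, (∀ t, HasDerivAt z (k (z t))⁻¹ t) ∧ ∀ x, z (∫ y in (0 : ℝ)..x, k y) = x := by
  set τ : ℝ → ℝ := fun x => ∫ y in (0 : ℝ)..x, k y with hτ
  have hτd : ∀ x, HasDerivAt τ (k x) x := fun x => (hk.integral_hasStrictDerivAt 0 x).hasDerivAt
  have hτc : Continuous τ := continuous_iff_continuousAt.2 fun x => (hτd x).continuousAt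
  have hpos : ∀ x, 0 < k x := fun x => hk₀.trans_le (hle x)
  have hmono : StrictMono τ := strictMono_of_deriv_pos fun x => by
    rw [(hτd x).deriv]; exact hpos x
  have hdiff : Monotone fun x => τ x - k₀ * x := by
    have hd : ∀ x, HasDerivAt (fun x => τ x - k₀ * x) (k x - k₀ * 1) x := fun x =>
      (hτd x).fun_sub ((hasDerivAt_id x).const_mul k₀)
    refine monotone_of_deriv_nonneg (fun x => (hd x).differentiableAt) fun x => ?_
    rw [(hd x).deriv]
    linarith [hle x]
  have h0 : τ 0 = 0 := by simp [hτ]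
  have htop : Tendsto τ atTop atTop := by
    refine tendsto_atTop_mono' _ ?_ (tendsto_id.const_mul_atTop hk₀)
    filter_upwards [eventually_ge_atTop 0] with x hx
    have := hdiff hx
    simp only [h0] at this
    simp only [id]
    linarith
  have hbot : Tendsto τ atBot atBot := by
    refine tendsto_atBot_mono' _ ?_ (tendsto_id.const_mul_atBot hk₀)
    filter_upwards [eventually_le_atBot 0] with x hx
    have := hdiff hx
    simp only [h0] at this
    simp only [id]
    linarith
  let e := hmono.orderIsoOfSurjective τ (hτc.surjective htop hbot)
  have he : ∀ t, τ (e.symm t) = t := fun t => e.apply_symm_apply t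
  exact ⟨e.symm, fun t => HasDerivAt.of_local_left_inverse e.symm.continuous.continuousAt
    (hτd _) (hpos _).ne' (Eventually.of_forall he), fun x => e.symm_apply_apply x⟩

theorem rpow_le_integral_add_sq_rpow {ε S k : ℝ} (hε : 0 < ε) (hS : 0 ≤ S) (hk : 0 ≤ k) :
    S ^ (2 * k + 1) / (2 * k + 1) ≤ ∫ x in (0 : ℝ)..S, (ε ^ 2 + x ^ 2) ^ k ∧
    ∫ x in (0 : ℝ)..S, (ε ^ 2 + x ^ 2) ^ k ≤ (S + ε) ^ (2 * k + 1) / (2 * k + 1) := by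
  have hc : Continuous fun x : ℝ => (ε ^ 2 + x ^ 2) ^ k :=
    Continuous.rpow_const (by fun_prop) fun _ => Or.inr hk
  have hc1 : Continuous fun x : ℝ => x ^ (2 * k) :=
    continuous_id.rpow_const fun _ => Or.inr (by positivity)
  have hsq : ∀ x : ℝ, 0 ≤ x → (x ^ 2) ^ k = x ^ (2 * k) := fun x hx => by
    rw [Real.rpow_mul hx]; norm_cast
  constructor
  · have h1 : ∫ x in (0 : ℝ)..S, x ^ (2 * k) = S ^ (2 * k + 1) / (2 * k + 1) := by
      rw [integral_rpow (Or.inl (by linarith)), Real.zero_rpow (by positivity), sub_zero]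
    rw [← h1]
    refine intervalIntegral.integral_mono_on hS (hc1.intervalIntegrable _ _)
      (hc.intervalIntegrable _ _) fun x hx => ?_
    rw [← hsq x hx.1]
    exact Real.rpow_le_rpow (by positivity) (by nlinarith) hk
  · have h1 : ∫ x in (0 : ℝ)..S, (x + ε) ^ (2 * k)
        = ((S + ε) ^ (2 * k + 1) - ε ^ (2 * k + 1)) / (2 * k + 1) := by
      rw [intervalIntegral.integral_comp_add_right (fun x => x ^ (2 * k)),
        integral_rpow (Or.inl (by linarith)), zero_add]
    calc ∫ x in (0 : ℝ)..S, (ε ^ 2 + x ^ 2) ^ k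
        ≤ ∫ x in (0 : ℝ)..S, (x + ε) ^ (2 * k) := by
          refine intervalIntegral.integral_mono_on hS (hc.intervalIntegrable _ _)
            ((hc1.comp (continuous_id.add continuous_const)).intervalIntegrable _ _)
            fun x hx => ?_
          rw [← hsq _ (by linarith [hx.1])]
          exact Real.rpow_le_rpow (by positivity) (by nlinarith [hx.1]) hk
      _ ≤ _ := by
          rw [h1]
          gcongr
          linarith [Real.rpow_nonneg hε.le (2 * k + 1)]

theorem exists_small_detour {ρ k d : ℝ} (hρ : 0 < ρ) (hk : 0 ≤ k) (hd0 : 0 ≤ d)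
    (hd : d < Real.pi / 2) :
    ∃ ε S l : ℝ, 0 < ε ∧ 0 < S ∧ 0 < l ∧ ε ^ 2 + S ^ 2 = ρ ^ 2 ∧
      l * (∫ x in (0 : ℝ)..S, (ε ^ 2 + x ^ 2) ^ k) = ρ ^ (2 * k + 1) / (2 * k + 1) ∧
      S * (l + 1 / l) - ε / l * (Real.arctan (S / ε) - d ^ 2 / Real.arctan (S / ε)) < 2 * ρ := by
  set S : ℝ → ℝ := fun ε => Real.sqrt (ρ ^ 2 - ε ^ 2) with hS
  have hS0 : S 0 = ρ := by simp [hS, hρ.le]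
  have hSd : DifferentiableAt ℝ S 0 := by
    refine DifferentiableAt.sqrt (by fun_prop) ?_
    simp [hρ.ne']
  have hSc : Tendsto S (𝓝[>] 0) (𝓝 ρ) := by
    have := hSd.continuousAt.tendsto
    rw [hS0] at this
    exact this.mono_left nhdsWithin_le_nhds
  set f₁ : ℝ → ℝ := fun ε => (ρ / (S ε + ε)) ^ (2 * k + 1) with hf₁
  set f₂ : ℝ → ℝ := fun ε => (ρ / S ε) ^ (2 * k + 1) with hf₂
  have hf₁d : DifferentiableAt ℝ f₁ 0 := by
    refine DifferentiableAt.rpow_const (DifferentiableAt.div (by fun_prop) (by fun_prop) ?_)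
      (Or.inl ?_) <;> simp [hS0, hρ.ne']
  have hf₂d : DifferentiableAt ℝ f₂ 0 := by
    refine DifferentiableAt.rpow_const (DifferentiableAt.div (by fun_prop) (by fun_prop) ?_)
      (Or.inl ?_) <;> simp [hS0, hρ.ne']
  have hf₁0 : f₁ 0 = 1 := by simp [hf₁, hS0, hρ.ne']
  have hf₂0 : f₂ 0 = 1 := by simp [hf₂, hS0, hρ.ne']
  obtain ⟨C₁, hC₁⟩ := hf₁d.isBigO_sub.bound
  obtain ⟨C₂, hC₂⟩ := hf₂d.isBigO_sub.bound
  simp only [hf₁0, hf₂0, sub_zero, Real.norm_eq_abs] at hC₁ hC₂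
  set η := Real.pi / 2 - d ^ 2 / (Real.pi / 2) with hη
  have hηpos : 0 < η := by
    have hpi := Real.pi_pos
    rw [hη, sub_pos, div_lt_iff₀ (by positivity)]
    nlinarith
  have hA : Tendsto (fun ε => Real.arctan (S ε / ε)) (𝓝[>] 0) (𝓝 (Real.pi / 2)) := by
    refine (Real.tendsto_arctan_atTop.mono_right nhdsWithin_le_nhds).comp ?_
    simp only [div_eq_mul_inv]
    exact hSc.pos_mul_atTop hρ tendsto_inv_nhdsGT_zero
  have hAη : Tendsto (fun ε => Real.arctan (S ε / ε) - d ^ 2 / Real.arctan (S ε / ε))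
      (𝓝[>] 0) (𝓝 η) :=
    hA.sub (tendsto_const_nhds.div hA (by positivity))
  have hsmall : Tendsto (fun ε : ℝ => ρ * (|C₁| + |C₂|) ^ 2 * ε) (𝓝[>] 0) (𝓝 0) := by
    have : Continuous fun ε : ℝ => ρ * (|C₁| + |C₂|) ^ 2 * ε := by fun_prop
    simpa using (this.tendsto 0).mono_left nhdsWithin_le_nhds
  have hC₁' : ∀ᶠ ε in 𝓝[>] (0 : ℝ), |f₁ ε - 1| ≤ C₁ * |ε| := nhdsWithin_le_nhds hC₁
  have hC₂' : ∀ᶠ ε in 𝓝[>] (0 : ℝ), |f₂ ε - 1| ≤ C₂ * |ε| := nhdsWithin_le_nhds hC₂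
  have hlt : ∀ᶠ ε in 𝓝[>] (0 : ℝ), ε < ρ := nhdsWithin_le_nhds (gt_mem_nhds hρ)
  have hgt : ∀ᶠ ε in 𝓝[>] (0 : ℝ), 0 < ε := self_mem_nhdsWithin
  obtain ⟨ε, hAε, hsm, h1, h2, hερ, hε0⟩ := ((hAη.eventually (lt_mem_nhds (half_lt_self hηpos))).and
    ((hsmall.eventually (gt_mem_nhds (half_pos hηpos))).and
    (hC₁'.and (hC₂'.and (hlt.and hgt))))).exists
  have hrad : 0 < ρ ^ 2 - ε ^ 2 := by nlinarith
  have hSpos : 0 < S ε := Real.sqrt_pos.2 hrad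
  have hSsq : S ε ^ 2 = ρ ^ 2 - ε ^ 2 := Real.sq_sqrt hrad.le
  have hSρ : S ε ≤ ρ := by nlinarith
  obtain ⟨hN1, hN2⟩ := rpow_le_integral_add_sq_rpow hε0 hSpos.le hk
  set N := ∫ x in (0 : ℝ)..S ε, (ε ^ 2 + x ^ 2) ^ k with hN
  have hk1 : 0 < 2 * k + 1 := by positivity
  have hNpos : 0 < N := lt_of_lt_of_le (by positivity) hN1
  set l := ρ ^ (2 * k + 1) / (2 * k + 1) / N with hl
  have hlpos : 0 < l := by positivity
  have hl1 : f₁ ε ≤ l := by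
    rw [hf₁, hl]
    simp only
    rw [Real.div_rpow hρ.le (by positivity), div_div]
    refine div_le_div_of_nonneg_left (by positivity) (by positivity) ?_
    rw [le_div_iff₀ hk1] at hN2
    linarith
  have hl2 : l ≤ f₂ ε := by
    rw [hf₂, hl]
    simp only
    rw [Real.div_rpow hρ.le hSpos.le, div_div]
    refine div_le_div_of_nonneg_left (by positivity) (by positivity) ?_
    rw [div_le_iff₀ hk1] at hN1
    linarith
  have hlabs : |l - 1| ≤ (|C₁| + |C₂|) * ε := by
    rw [abs_of_pos hε0, abs_le] at h1 h2
    have e1 := mul_le_mul_of_nonneg_right (le_abs_self C₁) hε0.le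
    have e2 := mul_le_mul_of_nonneg_right (le_abs_self C₂) hε0.le
    have e3 := mul_nonneg (abs_nonneg C₁) hε0.le
    have e4 := mul_nonneg (abs_nonneg C₂) hε0.le
    rw [abs_le]
    constructor <;> nlinarith
  have hlsq : (l - 1) ^ 2 ≤ ((|C₁| + |C₂|) * ε) ^ 2 := by
    rw [← sq_abs (l - 1)]
    exact pow_le_pow_left₀ (abs_nonneg _) hlabs 2
  refine ⟨ε, S ε, l, hε0, hSpos, hlpos, by linarith, div_mul_cancel₀ _ hNpos.ne', ?_⟩
  set B := Real.arctan (S ε / ε) - d ^ 2 / Real.arctan (S ε / ε) with hB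
  have hkey : S ε * (l ^ 2 + 1) - ε * B < 2 * ρ * l := by
    have e1 : S ε * (l - 1) ^ 2 ≤ ρ * ((|C₁| + |C₂|) * ε) ^ 2 := by gcongr
    have e2 : ρ * ((|C₁| + |C₂|) * ε) ^ 2 < ε * (η / 2) := by
      have := mul_lt_mul_of_pos_left hsm hε0
      linarith
    have e3 : ε * (η / 2) < ε * B := mul_lt_mul_of_pos_left hAε hε0
    have e4 := mul_le_mul_of_nonneg_right hSρ hlpos.le
    have e5 : S ε * (l ^ 2 + 1) = S ε * (l - 1) ^ 2 + 2 * (S ε * l) := by ring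
    linarith
  have : S ε * (l + 1 / l) - ε / l * B = (S ε * (l ^ 2 + 1) - ε * B) / l := by
    field_simp
  rw [this, div_lt_iff₀ hlpos]
  linarith

theorem integral_inv_sq_add_sq_symm {ε : ℝ} (hε : 0 < ε) (S : ℝ) :
    ∫ x in (-S)..S, (ε ^ 2 + x ^ 2)⁻¹ = 2 * Real.arctan (S / ε) / ε := by
  have h : ∀ x, HasDerivAt (fun x => Real.arctan (x / ε) / ε) (ε ^ 2 + x ^ 2)⁻¹ x := fun x => by
    refine (((hasDerivAt_id x).div_const ε).arctan.div_const ε).congr_deriv ?_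
    have : ε ^ 2 + x ^ 2 ≠ 0 := by positivity
    have : 1 + (x / ε) ^ 2 ≠ 0 := by positivity
    simp only [id]
    field_simp
  have hc : Continuous fun x : ℝ => (ε ^ 2 + x ^ 2)⁻¹ :=
    Continuous.inv₀ (by fun_prop) fun x => by positivity
  rw [intervalIntegral.integral_eq_sub_of_hasDerivAt (fun x _ => h x) (hc.intervalIntegrable _ _),
    neg_div, Real.arctan_neg]
  ring

theorem exists_competitor {T m α μ D R : ℝ} (hT : 0 < T) (hm : 0 < m) (hα1 : 1 ≤ α) (hα2 : α < 2)
    (hμ : μ = (α + 2) * (Real.sqrt (2 * m / α) / 2)) (hR : R = (μ * T) ^ (2 / (α + 2)))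
    (hD : |D| ≤ 2 * Real.pi) (hcase : 1 < α ∨ α = 1 ∧ |D| < 2 * Real.pi) :
    ∃ s v : ℝ → ℝ, Continuous v ∧ (∀ t, HasDerivAt s (v t) t) ∧ s (-T) = R ∧ s T = R ∧
      (∀ t, 0 < s t) ∧
      1 / 2 * (∫ t in (-T)..T, v t ^ 2) + ((∫ t in (-T)..T, m / (α * s t ^ α)) +
        D ^ 2 / (2 * ∫ t in (-T)..T, (s t ^ 2)⁻¹))
      < 2 * (Real.sqrt (2 * m / α) / ((2 - α) / 2) * R ^ ((2 - α) / 2)) := by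
  set σ := Real.sqrt (2 * m / α) with hσ
  set κ := (2 - α) / 2 with hκ
  have hα0 : 0 < α := by linarith
  have hκ0 : 0 < κ := by rw [hκ]; linarith
  have hακ : α = 2 - 2 * κ := by rw [hκ]; ring
  have hσ0 : 0 < σ := Real.sqrt_pos.2 (by positivity)
  have hσ2 : σ ^ 2 = 2 * m / α := Real.sq_sqrt (by positivity)
  have hμ0 : 0 < μ := by rw [hμ]; positivity
  have hR0 : 0 < R := by rw [hR]; positivity
  set k := α / (2 * κ) with hk
  set n := 1 / (2 * κ) with hn
  have hk0 : 0 < k := by positivity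
  have hkn : k = 2 * n - 1 := by rw [hk, hn, hακ]; field_simp
  have hnα : n * α = k := by rw [hk, hn]; ring
  have hπ := Real.pi_pos
  have hd : κ * |D| / 2 < Real.pi / 2 := by
    rcases hcase with h | ⟨h, h'⟩
    · have : κ < 1 / 2 := by rw [hκ]; linarith
      nlinarith [abs_nonneg D]
    · have : κ = 1 / 2 := by rw [hκ, h]; norm_num
      rw [this]; linarith
  set ρ := R ^ κ with hρ
  have hρ0 : 0 < ρ := Real.rpow_pos_of_pos hR0 κ
  obtain ⟨ε, S, l, hε, hS, hl, hεS, hint, hlt⟩ :=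
    exists_small_detour hρ0 hk0.le (by positivity) hd
  set A := Real.arctan (S / ε) with hA
  have hA0 : 0 < A := Real.arctan_pos.2 (by positivity)
  have hTint : ρ ^ (2 * k + 1) / (2 * k + 1) = T * κ * σ := by
    have h2 : κ * (2 * k + 1) = (α + 2) / 2 := by
      have : κ * k = α / 2 := by rw [hk]; field_simp
      linear_combination 2 * this + (1 / 2 : ℝ) * hακ
    have h1 : ρ ^ (2 * k + 1) = μ * T := by
      rw [hρ, hR, ← Real.rpow_mul (by positivity), ← Real.rpow_mul (by positivity)]
      convert Real.rpow_one (μ * T) using 2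
      rw [h2]
      field_simp
    rw [h1, hμ, div_eq_iff (by positivity)]
    linear_combination -T * σ * h2
  have hQ : ∀ x : ℝ, 0 < ε ^ 2 + x ^ 2 := fun x => by positivity
  set w : ℝ → ℝ := fun x => l / (κ * σ) * (ε ^ 2 + x ^ 2) ^ k with hw
  have hwc : Continuous w :=
    continuous_const.mul (Continuous.rpow_const (by fun_prop) fun _ => Or.inr hk0.le)
  have hw0 : ∀ x, 0 < w x := fun x => mul_pos (by positivity) (Real.rpow_pos_of_pos (hQ x) k)
  obtain ⟨z, hz, hzinv⟩ := exists_hasDerivAt_inverse_primitive hwc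
    (k₀ := l / (κ * σ) * (ε ^ 2) ^ k) (by positivity) fun x => by
      rw [hw]
      exact mul_le_mul_of_nonneg_left (Real.rpow_le_rpow (by positivity)
        (by nlinarith [sq_nonneg x]) hk0.le) (by positivity)
  have hwS : ∫ x in (0 : ℝ)..S, w x = T := by
    rw [hw, intervalIntegral.integral_const_mul, div_mul_eq_mul_div, hint, hTint]
    field_simp
  have hwS' : ∫ x in (0 : ℝ)..(-S), w x = -T := by
    have h := intervalIntegral.integral_comp_neg (a := 0) (b := S) w
    have heven : (fun x => w (-x)) = w := by ext x; simp [hw]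
    rw [heven, neg_zero, hwS] at h
    rw [intervalIntegral.integral_symm, ← h]
  have hzT : z T = S := by rw [← hzinv S, hwS]
  have hzT' : z (-T) = -S := by rw [← hzinv (-S), hwS']
  have hzc : Continuous z := continuous_iff_continuousAt.2 fun t => (hz t).continuousAt
  have hcov : ∀ {F : ℝ → ℝ}, Continuous F →
      ∫ t in (-T)..T, F (z t) = ∫ x in (-S)..S, F x * w x := fun {F} hF => by
    rw [← hzT', ← hzT, ← intervalIntegral.integral_comp_mul_deriv (f := z)
      (f' := fun t => (w (z t))⁻¹) (g := fun x => F x * w x) (fun t _ => hz t)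
      (Continuous.continuousOn ((hwc.comp hzc).inv₀ fun t => (hw0 _).ne')) (hF.mul hwc)]
    refine intervalIntegral.integral_congr fun t _ => ?_
    simp only [Function.comp]
    rw [mul_assoc, mul_inv_cancel₀ (hw0 _).ne', mul_one]
  have hqc : Continuous fun x : ℝ => (ε ^ 2 + x ^ 2) ^ n :=
    Continuous.rpow_const (by fun_prop) fun x => Or.inl (hQ x).ne'
  have hq0 : ∀ x, 0 < (ε ^ 2 + x ^ 2) ^ n := fun x => Real.rpow_pos_of_pos (hQ x) n
  have hqk : ∀ x, (ε ^ 2 + x ^ 2) ^ k * (ε ^ 2 + x ^ 2) = ((ε ^ 2 + x ^ 2) ^ n) ^ 2 := fun x => by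
    rw [← Real.rpow_add_one (hQ x).ne',
      ← Real.rpow_natCast ((ε ^ 2 + x ^ 2) ^ n), ← Real.rpow_mul (hQ x).le, hkn]
    congr 1; push_cast; ring
  have hqα : ∀ x, ((ε ^ 2 + x ^ 2) ^ n) ^ α = (ε ^ 2 + x ^ 2) ^ k := fun x => by
    rw [← Real.rpow_mul (hQ x).le, hnα]
  have hqR : (ε ^ 2 + S ^ 2) ^ n = R := by
    rw [hεS, ← Real.rpow_natCast, ← Real.rpow_mul hρ0.le, hρ, ← Real.rpow_mul hR0.le]
    convert Real.rpow_one R using 2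
    rw [hn]; push_cast; field_simp
  have hinv := integral_inv_sq_add_sq_symm hε S
  have hinvc : Continuous fun x : ℝ => (ε ^ 2 + x ^ 2)⁻¹ :=
    Continuous.inv₀ (by fun_prop) fun x => (hQ x).ne'
  refine ⟨fun t => (ε ^ 2 + z t ^ 2) ^ n, fun t => σ / l * (z t / (ε ^ 2 + z t ^ 2) ^ n),
    ?_, fun t => ?_, ?_, ?_, fun t => hq0 _, ?_⟩
  · exact continuous_const.mul (hzc.div (hqc.comp hzc) fun t => (hq0 _).ne')
  · refine ((((hz t).fun_pow 2).const_add (ε ^ 2)).rpow_const (p := n)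
      (Or.inl (hQ _).ne')).congr_deriv ?_
    have h1 := hqk (z t)
    have h2 := hq0 (z t)
    have h3 := Real.rpow_pos_of_pos (hQ (z t)) k
    have h4 := hQ (z t)
    rw [hw, Real.rpow_sub_one h4.ne']
    have h5 : n * κ * 2 = 1 := by rw [hn]; field_simp
    simp only
    generalize (ε ^ 2 + z t ^ 2) ^ n = q at *
    generalize (ε ^ 2 + z t ^ 2) ^ k = y at *
    generalize ε ^ 2 + z t ^ 2 = Q at *
    push_cast
    field_simp
    linear_combination z t * q ^ 2 * h5 - z t * h1
  · simp only; rw [hzT', neg_sq, hqR]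
  · simp only; rw [hzT, hqR]
  have i1 : ∫ t in (-T)..T, (σ / l * (z t / (ε ^ 2 + z t ^ 2) ^ n)) ^ 2
      = σ / (κ * l) * (2 * S - 2 * ε * A) := by
    rw [hcov (F := fun x => (σ / l * (x / (ε ^ 2 + x ^ 2) ^ n)) ^ 2)
      ((continuous_const.mul (continuous_id.div hqc fun x => (hq0 x).ne')).pow 2)]
    have : ∀ x, (σ / l * (x / (ε ^ 2 + x ^ 2) ^ n)) ^ 2 * w x
        = σ / (κ * l) * (1 - ε ^ 2 * (ε ^ 2 + x ^ 2)⁻¹) := fun x => by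
      rw [mul_pow, div_pow x, ← hqk, hw]
      have h3 := Real.rpow_pos_of_pos (hQ x) k
      have h4 := hQ x
      field_simp
      ring
    simp only [this]
    rw [intervalIntegral.integral_const_mul, intervalIntegral.integral_sub
      (by simp) ((hinvc.intervalIntegrable _ _).const_mul _), intervalIntegral.integral_const_mul,
      hinv]
    simp only [intervalIntegral.integral_const, smul_eq_mul]
    field_simp
    ring
  have i2 : ∫ t in (-T)..T, m / (α * ((ε ^ 2 + z t ^ 2) ^ n) ^ α) = σ * l * S / κ := by
    simp only [hqα]
    rw [hcov (F := fun x => m / (α * (ε ^ 2 + x ^ 2) ^ k)) (continuous_const.div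
      (continuous_const.mul (Continuous.rpow_const (by fun_prop) fun _ => Or.inr hk0.le))
      fun x => (mul_pos hα0 (Real.rpow_pos_of_pos (hQ x) k)).ne')]
    have : ∀ x, m / (α * (ε ^ 2 + x ^ 2) ^ k) * w x = σ * l / (2 * κ) := fun x => by
      have h3 := Real.rpow_pos_of_pos (hQ x) k
      have h5 : m = σ ^ 2 * α / 2 := by rw [hσ2]; field_simp
      rw [hw, h5]
      field_simp
    simp only [this, intervalIntegral.integral_const, smul_eq_mul]
    field_simp
    ring
  have i3 : ∫ t in (-T)..T, (((ε ^ 2 + z t ^ 2) ^ n) ^ 2)⁻¹ = l / (κ * σ) * (2 * A / ε) := by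
    rw [hcov (F := fun x => (((ε ^ 2 + x ^ 2) ^ n) ^ 2)⁻¹)
      ((hqc.pow 2).inv₀ fun x => (pow_pos (hq0 x) 2).ne'), ← hinv,
      ← intervalIntegral.integral_const_mul]
    refine intervalIntegral.integral_congr fun x _ => ?_
    have h3 := Real.rpow_pos_of_pos (hQ x) k
    have h4 := hQ x
    simp only [hw]
    rw [← hqk]
    field_simp
  rw [i1, i2, i3]
  have hdsq : (κ * |D| / 2) ^ 2 = κ ^ 2 * D ^ 2 / 4 := by
    rw [div_pow, mul_pow, sq_abs]; norm_num
  rw [hdsq] at hlt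
  have := mul_lt_mul_of_pos_left hlt (div_pos hσ0 hκ0)
  calc _ = σ / κ * (S * (l + 1 / l) - ε / l * (A - κ ^ 2 * D ^ 2 / 4 / A)) := by
        field_simp
        ring
    _ < σ / κ * (2 * ρ) := this
    _ = _ := by ring

theorem hasDerivAt_kepler_potential {m α x : ℝ} (hx : 0 < x) (hα : α ≠ 0) :
    HasDerivAt (fun x : ℝ => m / (α * x ^ α)) (-m / x ^ (α + 1)) x := by
  have h := (((Real.hasDerivAt_rpow_const (p := α) (Or.inl hx.ne')).const_mul α).fun_inv
    (mul_ne_zero hα (Real.rpow_pos_of_pos hx α).ne')).const_mul m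
  simp only [← div_eq_mul_inv] at h
  refine h.congr_deriv ?_
  have h1 : x ^ (α + 1) = x ^ α * x := Real.rpow_add_one hx.ne' α
  have h2 : x ^ (α - 1) = x ^ α / x := Real.rpow_sub_one hx.ne' α
  have := (Real.rpow_pos_of_pos hx α).ne'
  rw [h1, h2]
  field_simp

theorem sqrt_two_mul_kepler_potential {m α x : ℝ} (hx : 0 < x) (hm : 0 < m) (hα : 0 < α) :
    Real.sqrt (2 * (m / (α * x ^ α))) = Real.sqrt (2 * m / α) * x ^ (-(α / 2)) := by
  have h : x ^ α = (x ^ (α / 2)) ^ 2 := by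
    rw [← Real.rpow_natCast, ← Real.rpow_mul hx.le]; congr 1; norm_num
  have hp := Real.rpow_pos_of_pos hx (α / 2)
  rw [h, show 2 * (m / (α * (x ^ (α / 2)) ^ 2)) = 2 * m / α / (x ^ (α / 2)) ^ 2 by field_simp,
    Real.sqrt_div' _ (by positivity), Real.sqrt_sq hp.le, Real.rpow_neg hx.le, div_eq_mul_inv]

theorem sqrt_div_two_mul {m α : ℝ} (hα : 0 < α) :
    Real.sqrt (m / (2 * α)) = Real.sqrt (2 * m / α) / 2 := by
  rw [show m / (2 * α) = 2 * m / α / 2 ^ 2 by field_simp, Real.sqrt_div' _ (by positivity),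
    Real.sqrt_sq (by positivity)]

theorem action_parabolic {T m α μ : ℝ} (hT : 0 < T) (hm : 0 < m) (hα1 : 1 ≤ α) (hα2 : α < 2)
    (hμσ : μ = (α + 2) * (Real.sqrt (2 * m / α) / 2)) {x : ℝ → ℂ} {φ : ℝ}
    (hx : ∀ t, 0 ≤ t →
      x t = (((μ * |t|) ^ (2 / (α + 2)) : ℝ) : ℂ) * Complex.exp ((φ : ℂ) * Complex.I)) :
    IntervalIntegrable (fun t => 1 / 2 * ‖deriv x t‖ ^ 2 + m / (α * ‖x t‖ ^ α)) volume 0 T ∧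
    ∫ t in (0 : ℝ)..T, (1 / 2 * ‖deriv x t‖ ^ 2 + m / (α * ‖x t‖ ^ α)) =
      Real.sqrt (2 * m / α) / ((2 - α) / 2) * ((μ * T) ^ (2 / (α + 2))) ^ ((2 - α) / 2) := by
  set σ := Real.sqrt (2 * m / α) with hσ
  have hα0 : 0 < α := by linarith
  have hσ0 : 0 < σ := Real.sqrt_pos.2 (by positivity)
  have hσ2 : σ ^ 2 = 2 * m / α := Real.sq_sqrt (by positivity)
  have hμ0 : 0 < μ := by rw [hμσ]; positivity
  set β := 2 / (α + 2) with hβ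
  set E := -(α * β) with hE
  have hE1 : E + 1 = β * ((2 - α) / 2) := by rw [hE, hβ]; field_simp; ring
  have hE1pos : 0 < E + 1 := by
    rw [hE1, hβ]; have : 0 < 2 - α := by linarith
    positivity
  have hpt : ∀ t, 0 < t → 1 / 2 * ‖deriv x t‖ ^ 2 + m / (α * ‖x t‖ ^ α)
      = σ ^ 2 * μ ^ E * t ^ E := fun t ht => by
    have hy : 0 < μ * t := mul_pos hμ0 ht
    have hd : HasDerivAt (fun s : ℝ => ((((μ * s) ^ β : ℝ) : ℂ) * Complex.exp (φ * Complex.I)))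
        (((μ * 1 * β * (μ * t) ^ (β - 1) : ℝ) : ℂ) * Complex.exp (φ * Complex.I)) t :=
      (HasDerivAt.rpow_const ((hasDerivAt_id t).const_mul μ) (Or.inl hy.ne')).ofReal_comp.mul_const _
    have heq : x =ᶠ[𝓝 t] fun s : ℝ => ((((μ * s) ^ β : ℝ) : ℂ) * Complex.exp (φ * Complex.I)) := by
      filter_upwards [lt_mem_nhds ht] with s hs
      rw [hx s hs.le, abs_of_pos hs]
    rw [(hd.congr_of_eventuallyEq heq).deriv, hx t ht.le, abs_of_pos ht, norm_mul, norm_mul,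
      Complex.norm_exp_ofReal_mul_I, Complex.norm_real, Complex.norm_real,
      Real.norm_of_nonneg (by positivity), Real.norm_of_nonneg (by positivity), mul_one, mul_one,
      mul_one, mul_assoc (σ ^ 2), ← Real.mul_rpow hμ0.le ht.le, ← Real.rpow_mul hy.le]
    have h1 : ((μ * t) ^ (β - 1)) ^ 2 = (μ * t) ^ E := by
      rw [← Real.rpow_natCast, ← Real.rpow_mul hy.le]
      congr 1
      rw [hE, hβ]; field_simp; push_cast; ring
    have h2 : (μ * t) ^ (β * α) = ((μ * t) ^ E)⁻¹ := by
      rw [← Real.rpow_neg hy.le, hE]; congr 1; ring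
    rw [mul_pow, mul_pow, h1, h2, hσ2]
    have h3 : μ ^ 2 * β ^ 2 = 2 * m / α := by
      rw [← hσ2, hμσ, hβ]; field_simp
    rw [h3]
    have := (Real.rpow_pos_of_pos hy E).ne'
    field_simp
    ring
  have hae : ∀ᵐ t ∂volume, t ∈ Set.uIoc 0 T →
      1 / 2 * ‖deriv x t‖ ^ 2 + m / (α * ‖x t‖ ^ α) = σ ^ 2 * μ ^ E * t ^ E :=
    ae_of_all _ fun t ht => hpt t (by rw [Set.uIoc_of_le hT.le] at ht; exact ht.1)
  constructor
  · have h := (intervalIntegral.intervalIntegrable_rpow' (a := 0) (b := T)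
      (by linarith : -1 < E)).const_mul (σ ^ 2 * μ ^ E)
    refine h.congr fun t ht => (hpt t ?_).symm
    rw [Set.uIoc_of_le hT.le] at ht; exact ht.1
  · rw [intervalIntegral.integral_congr_ae hae, intervalIntegral.integral_const_mul,
      integral_rpow (Or.inl (by linarith)), Real.zero_rpow hE1pos.ne', sub_zero,
      ← Real.rpow_mul (by positivity), ← hE1, Real.mul_rpow hμ0.le hT.le,
      Real.rpow_add_one hμ0.ne']
    have hfin : σ * (2 - α) / 2 = μ * (E + 1) := by rw [hE1, hμσ, hβ]; field_simp
    have : 0 < 2 - α := by linarith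
    rw [mul_div_assoc', div_mul_eq_mul_div, div_eq_div_iff hE1pos.ne' (by positivity)]
    linear_combination σ * μ ^ E * T ^ (E + 1) * hfin

theorem action_collision_ejection {T m α μ : ℝ} (hT : 0 < T) (hm : 0 < m) (hα1 : 1 ≤ α)
    (hα2 : α < 2) (hμ : μ = (α + 2) * (Real.sqrt (2 * m / α) / 2)) {x : ℝ → ℂ} {φm φp : ℝ}
    (hpos : ∀ t, 0 ≤ t →
      x t = (((μ * |t|) ^ (2 / (α + 2)) : ℝ) : ℂ) * Complex.exp ((φp : ℂ) * Complex.I))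
    (hneg : ∀ t, t ≤ 0 →
      x t = (((μ * |t|) ^ (2 / (α + 2)) : ℝ) : ℂ) * Complex.exp ((φm : ℂ) * Complex.I)) :
    ∫ t in (-T)..T, (1 / 2 * ‖deriv x t‖ ^ 2 + m / (α * ‖x t‖ ^ α)) =
      2 * (Real.sqrt (2 * m / α) / ((2 - α) / 2) *
        ((μ * T) ^ (2 / (α + 2))) ^ ((2 - α) / 2)) := by
  obtain ⟨hi, hr⟩ := action_parabolic hT hm hα1 hα2 hμ hpos
  obtain ⟨hi', hr'⟩ := action_parabolic (x := fun t => x (-t)) hT hm hα1 hα2 hμ fun t ht => by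
    rw [hneg (-t) (by linarith), abs_neg]
  simp only [deriv_comp_neg, norm_neg] at hi' hr'
  rw [intervalIntegral.integral_comp_neg
    (fun t => 1 / 2 * ‖deriv x t‖ ^ 2 + m / (α * ‖x t‖ ^ α)), neg_zero] at hr'
  have hi'' : IntervalIntegrable (fun t => 1 / 2 * ‖deriv x t‖ ^ 2 + m / (α * ‖x t‖ ^ α))
      volume (-T) 0 := by
    have := (IntervalIntegrable.iff_comp_neg (by simp)).1 hi'
    simpa using this.symm
  rw [← intervalIntegral.integral_add_adjacent_intervals hi'' hi, hr, hr']
  ring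

theorem hasDerivAt_sqrt_two_mul_primitive {m α x : ℝ} (hm : 0 < m) (hα : 0 < α) (hα2 : α < 2)
    (hx : 0 < x) :
    HasDerivAt (fun x : ℝ => Real.sqrt (2 * m / α) / ((2 - α) / 2) * x ^ ((2 - α) / 2))
      (Real.sqrt (2 * (m / (α * x ^ α)))) x := by
  refine ((Real.hasDerivAt_rpow_const (Or.inl hx.ne')).const_mul _).congr_deriv ?_
  rw [sqrt_two_mul_kepler_potential hx hm hα, show (2 - α) / 2 - 1 = -(α / 2) by ring]
  have : 2 - α ≠ 0 := by linarith
  field_simp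

/-- Theorem 3: fixed-time improvement of the collision-ejection solution. -/
theorem stmt_12
    (T m₁ α φm φp μ : ℝ) (hT : 0 < T) (hm : 0 < m₁)
    (hα1 : 1 ≤ α) (hα2 : α < 2)
    (hμ : μ = (α + 2) * Real.sqrt (m₁ / (2 * α)))
    (xbar : ℝ → ℂ)
    (hxbar_pos : ∀ t : ℝ, 0 ≤ t →
      xbar t = (((μ * |t|) ^ (2 / (α + 2)) : ℝ) : ℂ) * Complex.exp ((φp : ℂ) * Complex.I))
    (hxbar_neg : ∀ t : ℝ, t ≤ 0 →
      xbar t = (((μ * |t|) ^ (2 / (α + 2)) : ℝ) : ℂ) * Complex.exp ((φm : ℂ) * Complex.I))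
    (hφ0 : 0 < |φp - φm|) (hφ : |φp - φm| ≤ 2 * Real.pi)
    (hcase : 1 < α ∨ (α = 1 ∧ |φp - φm| < 2 * Real.pi)) :
    ∃ γ : ℝ → ℂ,
      (∀ t ∈ Set.Icc (-T) T, γ t ≠ 0) ∧
      γ (-T) = xbar (-T) ∧ γ T = xbar T ∧
      (∀ t ∈ Set.Icc (-T) T, DifferentiableAt ℝ γ t ∧ DifferentiableAt ℝ (deriv γ) t) ∧
      ContinuousOn (deriv (deriv γ)) (Set.Icc (-T) T) ∧
      (∃ θ : ℝ → ℝ, ContinuousOn θ (Set.Icc (-T) T) ∧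
        (∀ t ∈ Set.Icc (-T) T, γ t = ((‖γ t‖ : ℝ) : ℂ) * Complex.exp ((θ t : ℂ) * Complex.I)) ∧
        θ (-T) = φm ∧ θ T = φp) ∧
      (∀ t ∈ Set.Icc (-T) T,
        deriv (deriv γ) t = -(m₁ : ℂ) * γ t / ((‖γ t‖ ^ (α + 2) : ℝ) : ℂ)) ∧
      (∫ t in (-T)..T, ((1 / 2) * ‖deriv γ t‖ ^ 2 + m₁ / (α * ‖γ t‖ ^ α)))
        < ∫ t in (-T)..T, ((1 / 2) * ‖deriv xbar t‖ ^ 2 + m₁ / (α * ‖xbar t‖ ^ α)) := by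
  have hα0 : 0 < α := by linarith
  have hκ0 : 0 < (2 - α) / 2 := by linarith
  rw [sqrt_div_two_mul hα0] at hμ
  have hσ0 : 0 < Real.sqrt (2 * m₁ / α) := Real.sqrt_pos.2 (by positivity)
  have hμ0 : 0 < μ := by rw [hμ]; positivity
  set R := (μ * T) ^ (2 / (α + 2)) with hR
  have hR0 : 0 < R := by rw [hR]; positivity
  obtain ⟨s, v, hv, hs, hsa, hsb, hspos, hact⟩ :=
    exists_competitor (D := φp - φm) hT hm hα1 hα2 hμ hR hφ hcase
  have hΦ0 : Tendsto (fun x : ℝ => Real.sqrt (2 * m₁ / α) / ((2 - α) / 2) * x ^ ((2 - α) / 2))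
      (𝓝[>] 0) (𝓝 0) := by
    have hc : Continuous fun x : ℝ =>
        Real.sqrt (2 * m₁ / α) / ((2 - α) / 2) * x ^ ((2 - α) / 2) :=
      continuous_const.mul (continuous_id.rpow_const fun _ => Or.inr hκ0.le)
    have h := (hc.tendsto 0).mono_left (nhdsWithin_le_nhds (s := Set.Ioi 0))
    rwa [Real.zero_rpow hκ0.ne', mul_zero] at h
  have hV' : ContinuousOn (fun x : ℝ => -m₁ / x ^ (α + 1)) (Set.Ioi 0) :=
    continuousOn_const.div (continuousOn_id.rpow_const fun x hx => Or.inl (ne_of_gt hx))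
      fun x hx => (Real.rpow_pos_of_pos hx _).ne'
  obtain ⟨c, r, p, ω, hra, hrb, hp, hω, hr, hpd, hωd, hpol, hωint, hlt⟩ :=
    exists_polar_solution (by linarith : -T < T) hR0
      (fun x hx => hasDerivAt_kepler_potential (m := m₁) hx hα0.ne') hV'
      (fun x hx => div_nonpos_of_nonpos_of_nonneg (by linarith) (Real.rpow_nonneg hx.le _))
      (fun x hx => div_pos hm (mul_pos hα0 (Real.rpow_pos_of_pos hx α)))
      (fun x hx => hasDerivAt_sqrt_two_mul_primitive hm hα0 hα2 hx) hΦ0 hv hs hsa hsb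
      (fun t _ => hspos t) hact
  set θ : ℝ → ℝ := fun t => φm + ∫ u in (-T)..t, ω u with hθ
  have hθd : ∀ t, HasDerivAt θ (ω t) t := fun t =>
    (hω.integral_hasStrictDerivAt (-T) t).hasDerivAt.const_add φm
  have hθa : θ (-T) = φm := by simp [hθ]
  have hθb : θ T = φp := by simp [hθ, hωint]
  obtain ⟨hdiff, hnorm, hspeed, hode⟩ := complex_solution_of_polar hr hpd hωd hθd hpol rfl
  set γ : ℝ → ℂ := fun t => (r t : ℂ) * Complex.exp ((θ t : ℂ) * Complex.I) with hγ
  have hle : -T ≤ T := by linarith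
  have hne : ∀ t ∈ Set.Icc (-T) T, γ t ≠ 0 := fun t ht =>
    norm_pos_iff.1 (by rw [hnorm t ht]; exact (hpol t ht).1)
  have hγc : Continuous γ := continuous_iff_continuousAt.2 fun t => (hdiff t).1.continuousAt
  refine ⟨γ, hne, ?_, ?_, fun t _ => hdiff t, ?_, ⟨θ, ?_, fun t ht => ?_, hθa, hθb⟩, hode, ?_⟩
  · rw [hxbar_neg _ (by linarith), abs_neg, abs_of_pos hT, ← hR, hγ]
    simp only [hra, hθa]
  · rw [hxbar_pos _ hT.le, abs_of_pos hT, ← hR, hγ]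
    simp only [hrb, hθb]
  · refine ContinuousOn.congr ?_ hode
    refine (continuous_const.mul hγc).continuousOn.div ?_ fun t ht => ?_
    · exact Complex.continuous_ofReal.comp_continuousOn
        (hγc.norm.continuousOn.rpow_const fun t ht => Or.inl (norm_ne_zero_iff.2 (hne t ht)))
    · exact Complex.ofReal_ne_zero.2
        (Real.rpow_pos_of_pos (norm_pos_iff.2 (hne t ht)) _).ne'
  · exact (continuous_iff_continuousAt.2 fun t => (hθd t).continuousAt).continuousOn
  · rw [hnorm t ht]
  · rw [action_collision_ejection hT hm hα1 hα2 hμ hxbar_pos hxbar_neg]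
    refine lt_of_eq_of_lt (intervalIntegral.integral_congr fun t ht => ?_) hlt
    rw [Set.uIcc_of_le hle] at ht
    simp only [hspeed]
    rw [hnorm t ht]
end
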